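/- Let 1 < q < 2, λ, μ > 0 and φ ∈ L¹(ℝ), and let u = u^μ_λ be the classical solution of the rescaled regularized problem. Then for every 0 < t₁ < t₂ < ∞ the following energy identity holds: ‖u(t₂,·)‖²_{L²(ℝ)} + λ^q ∫_{t₁}^{t₂} ∫_ℝ ∫_ℝ J_λ(x−y)·(u(t,x) − u(t,y))² dx dy dt + 2μ ∫_{t₁}^{t₂} ∫_ℝ (∂_x u(t,x))² dx dt = ‖u(t₁,·)‖²_{L²(ℝ)}. -/

import Mathlib

open MeasureTheory Filter ENNReal

/-- `u` is a classical solution of the rescaled regularized problem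
`u_t + |u|^{q-1} u_x = λ^q (J_λ ∗ u - u) + μ u_xx` with initial datum
`φ_λ(x) = λ φ(λ x)`, where `J_λ(x) = λ J(λ x)`. -/
def IsRescaledSol (J : ℝ → ℝ) (q lam μ : ℝ) (φ : ℝ → ℝ) (u : ℝ → ℝ → ℝ) : Prop :=
  (∀ t : ℝ, 0 ≤ t → Integrable (u t)) ∧
  (∀ t₀ : ℝ, 0 ≤ t₀ →
    Tendsto (fun t => ∫ x, |u t x - u t₀ x|) (nhdsWithin t₀ (Set.Ici 0)) (nhds 0)) ∧
  (∀ t : ℝ, 0 < t → ContDiff ℝ 2 (u t)) ∧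
  (∀ x : ℝ, ContDiffOn ℝ 1 (fun s => u s x) (Set.Ioi 0)) ∧
  (∀ t : ℝ, 0 < t → ∀ x : ℝ,
    deriv (fun s => u s x) t + |u t x| ^ (q - 1) * deriv (u t) x
      = lam ^ q * ((∫ y, lam * J (lam * (x - y)) * u t y) - u t x)
        + μ * deriv (deriv (u t)) x) ∧
  (u 0 =ᵐ[volume] fun x => lam * φ (lam * x))

set_option linter.unusedVariables false

namespace NL
open Set Topology

noncomputable def rho (δ r : ℝ) : ℝ := (1 + |r|) ^ (-(1 + δ))
noncomputable def b1 (δ r : ℝ) : ℝ := ∫ s in (0:ℝ)..r, rho δ s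
noncomputable def b0 (δ r : ℝ) : ℝ := ∫ s in (0:ℝ)..r, b1 δ s
noncomputable def hh (δ r : ℝ) : ℝ := ∫ s in (0:ℝ)..r, √(|s| * rho δ s)

lemma rho_pos (δ r : ℝ) : 0 < rho δ r := by
  unfold rho; positivity

lemma rho_cont (δ : ℝ) : Continuous (rho δ) := by
  unfold rho
  refine Continuous.rpow_const (by fun_prop) (fun x => Or.inl (by positivity))

lemma rho_le_one {δ : ℝ} (h : 0 < δ) (r : ℝ) : rho δ r ≤ 1 := by
  unfold rho
  apply Real.rpow_le_one_of_one_le_of_nonpos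
  · linarith [abs_nonneg r]
  · linarith

lemma rho_anti {δ : ℝ} (h : 0 < δ) {r s : ℝ} (hrs : |r| ≤ |s|) : rho δ s ≤ rho δ r := by
  unfold rho
  apply Real.rpow_le_rpow_of_nonpos (by positivity) (by linarith) (by linarith)

lemma rho_neg (δ r : ℝ) : rho δ (-r) = rho δ r := by simp [rho]

lemma b1_deriv (δ r : ℝ) : HasDerivAt (b1 δ) (rho δ r) r :=
  intervalIntegral.integral_hasDerivAt_right ((rho_cont δ).intervalIntegrable _ _)
    ((rho_cont δ).stronglyMeasurableAtFilter _ _) (rho_cont δ).continuousAt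

lemma b1_cont (δ : ℝ) : Continuous (b1 δ) :=
  continuous_iff_continuousAt.2 fun r => (b1_deriv δ r).continuousAt

lemma b0_deriv (δ r : ℝ) : HasDerivAt (b0 δ) (b1 δ r) r :=
  intervalIntegral.integral_hasDerivAt_right ((b1_cont δ).intervalIntegrable _ _)
    ((b1_cont δ).stronglyMeasurableAtFilter _ _) (b1_cont δ).continuousAt

lemma hint_cont (δ : ℝ) : Continuous (fun s : ℝ => √(|s| * rho δ s)) := by
  have := rho_cont δ
  fun_prop

lemma hh_deriv (δ r : ℝ) : HasDerivAt (hh δ) (√(|r| * rho δ r)) r :=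
  intervalIntegral.integral_hasDerivAt_right ((hint_cont δ).intervalIntegrable _ _)
    ((hint_cont δ).stronglyMeasurableAtFilter _ _) (hint_cont δ).continuousAt

lemma b0_cont (δ : ℝ) : Continuous (b0 δ) :=
  continuous_iff_continuousAt.2 fun r => (b0_deriv δ r).continuousAt
lemma hh_cont (δ : ℝ) : Continuous (hh δ) :=
  continuous_iff_continuousAt.2 fun r => (hh_deriv δ r).continuousAt

lemma b1_zero (δ : ℝ) : b1 δ 0 = 0 := by simp [b1]
lemma b0_zero (δ : ℝ) : b0 δ 0 = 0 := by simp [b0]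
lemma hh_zero (δ : ℝ) : hh δ 0 = 0 := by simp [hh]

lemma b1_neg (δ r : ℝ) : b1 δ (-r) = - b1 δ r := by
  unfold b1
  have := intervalIntegral.integral_comp_neg (a := 0) (b := r) (fun s => rho δ s)
  simp only [rho_neg, neg_zero] at this
  rw [this, intervalIntegral.integral_symm]

lemma hh_neg (δ r : ℝ) : hh δ (-r) = - hh δ r := by
  unfold hh
  have := intervalIntegral.integral_comp_neg (a := 0) (b := r) (fun s => √(|s| * rho δ s))
  simp only [rho_neg, neg_zero, abs_neg] at this
  rw [this, intervalIntegral.integral_symm]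

lemma b0_neg (δ r : ℝ) : b0 δ (-r) = b0 δ r := by
  unfold b0
  have := intervalIntegral.integral_comp_neg (a := 0) (b := r) (fun s => b1 δ s)
  simp only [b1_neg, neg_zero, intervalIntegral.integral_neg] at this
  rw [intervalIntegral.integral_symm, ← this]; simp

lemma b1_mono (δ : ℝ) : Monotone (b1 δ) := 
  monotone_of_deriv_nonneg (fun r => (b1_deriv δ r).differentiableAt)
    (fun r => by rw [(b1_deriv δ r).deriv]; exact (rho_pos δ r).le)

lemma b1_nonneg {δ r : ℝ} (hr : 0 ≤ r) : 0 ≤ b1 δ r := by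
  have := b1_mono δ hr; rwa [b1_zero] at this

lemma b1_le {δ r : ℝ} (hδ : 0 < δ) (hr : 0 ≤ r) : b1 δ r ≤ 1 / δ := by
  have h : b1 δ r = -(1/δ) * (1 + r) ^ (-δ) - (-(1/δ) * (1 + 0) ^ (-δ)) := by
    unfold b1
    apply intervalIntegral.integral_eq_sub_of_hasDerivAt (f := fun s => -(1/δ) * (1 + s) ^ (-δ))
    · intro s hs
      rw [uIcc_of_le hr] at hs
      have hs0 : 0 < 1 + s := by linarith [hs.1]
      have h1 := ((((hasDerivAt_id s).const_add 1).rpow_const (p := -δ) (Or.inl hs0.ne')).const_mul (-(1/δ)))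
      refine h1.congr_deriv ?_
      unfold rho; rw [abs_of_nonneg hs.1]
      rw [show -(1+δ) = -δ - 1 by ring]
      field_simp; simp
    · exact (rho_cont δ).intervalIntegrable _ _
  rw [h]
  have : 0 ≤ (1/δ) * (1 + r) ^ (-δ) := by positivity
  simp only [add_zero, Real.one_rpow]; linarith

lemma abs_b1_le {δ : ℝ} (hδ : 0 < δ) (r : ℝ) : |b1 δ r| ≤ 1 / δ := by
  rcases le_total 0 r with h | h
  · rw [abs_of_nonneg (b1_nonneg h)]; exact b1_le hδ h
  · have h' : 0 ≤ -r := by linarith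
    have := b1_le hδ h'
    rw [← abs_neg, ← b1_neg, abs_of_nonneg (b1_nonneg h')]; exact this

lemma abs_b1_le' {δ : ℝ} (hδ : 0 < δ) (r : ℝ) : |b1 δ r| ≤ |r| := by
  have := intervalIntegral.norm_integral_le_of_norm_le_const (a := 0) (b := r) (C := 1) (f := rho δ)
    (fun x _ => by rw [Real.norm_eq_abs, abs_of_pos (rho_pos δ x)]; exact rho_le_one hδ x)
  simpa [b1] using this

lemma abs_hh_le {δ : ℝ} (hδ : 0 < δ) (r : ℝ) : |hh δ r| ≤ |r| := by
  have := intervalIntegral.norm_integral_le_of_norm_le_const (a := 0) (b := r) (C := 1)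
    (f := fun s => √(|s| * rho δ s))
    (fun x _ => by
      rw [Real.norm_eq_abs, abs_of_nonneg (Real.sqrt_nonneg _)]
      rw [Real.sqrt_le_iff, one_pow]
      refine ⟨zero_le_one, ?_⟩
      unfold rho
      rw [Real.rpow_neg (by positivity), ← div_eq_mul_inv, div_le_one (by positivity)]
      calc |x| ≤ 1 + |x| := by linarith
        _ = (1+|x|)^(1:ℝ) := by simp
        _ ≤ _ := Real.rpow_le_rpow_of_exponent_le (by linarith [abs_nonneg x]) (by linarith))
  simpa [hh] using this

lemma b0_nonneg (δ r : ℝ) : 0 ≤ b0 δ r := by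
  wlog h : 0 ≤ r
  · rw [← b0_neg]; exact this δ (-r) (by linarith)
  exact intervalIntegral.integral_nonneg h (fun s hs => b1_nonneg hs.1)

lemma b0_le {δ : ℝ} (hδ : 0 < δ) (r : ℝ) : b0 δ r ≤ 1 / δ * |r| := by
  have := intervalIntegral.norm_integral_le_of_norm_le_const (a := 0) (b := r) (C := 1/δ)
    (f := b1 δ) (fun x _ => abs_b1_le hδ x)
  rw [sub_zero] at this
  exact (le_abs_self _).trans this

lemma b1_one_pos (δ : ℝ) : 0 < b1 δ 1 := by
  unfold b1
  apply intervalIntegral.intervalIntegral_pos_of_pos ((rho_cont δ).intervalIntegrable _ _)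
    (rho_pos δ) one_pos

lemma b0_ge (δ r : ℝ) : b1 δ 1 * (|r| - 1) ≤ b0 δ r := by
  wlog h : 0 ≤ r
  · rw [← b0_neg, ← abs_neg]; exact this δ (-r) (by linarith)
  rw [abs_of_nonneg h]
  rcases le_total r 1 with h1 | h1
  · have := b1_one_pos δ
    have := b0_nonneg δ r
    nlinarith
  · have hInt0 : ∀ a b, IntervalIntegrable (b1 δ) volume a b := fun a b => (b1_cont δ).intervalIntegrable _ _
    have h2 : b0 δ r = b0 δ 1 + ∫ s in (1:ℝ)..r, b1 δ s := by
      unfold b0; rw [intervalIntegral.integral_add_adjacent_intervals (hInt0 _ _) (hInt0 _ _)]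
    have h3 : ∫ s in (1:ℝ)..r, b1 δ 1 ≤ ∫ s in (1:ℝ)..r, b1 δ s :=
      intervalIntegral.integral_mono_on h1 (by simp) (hInt0 _ _) (fun s hs => b1_mono δ hs.1)
    have := b0_nonneg δ 1
    simp at h3
    nlinarith

lemma hh_lower {δ : ℝ} (hδ : 0 < δ) (r : ℝ) : |r|^3 * rho δ r ≤ 8 * (hh δ r)^2 := by
  wlog h : 0 ≤ r
  · have := this hδ (-r) (by linarith)
    simpa [hh_neg, rho_neg] using this
  have hInt0 : ∀ a b, IntervalIntegrable (fun s : ℝ => √(|s| * rho δ s)) volume a b :=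
    fun a b => (hint_cont δ).intervalIntegrable _ _
  have h0 : 0 ≤ ∫ s in (0:ℝ)..(r/2), √(|s| * rho δ s) :=
    intervalIntegral.integral_nonneg (by linarith) (fun s hs => Real.sqrt_nonneg _)
  have h3 : ∫ s in (r/2:ℝ)..r, √(r/2 * rho δ r) ≤ ∫ s in (r/2:ℝ)..r, √(|s| * rho δ s) := by
    refine intervalIntegral.integral_mono_on (by linarith) (by simp) (hInt0 _ _) (fun s hs => ?_)
    apply Real.sqrt_le_sqrt
    have hs0 : 0 ≤ s := by linarith [hs.1]
    rw [abs_of_nonneg hs0]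
    apply mul_le_mul hs.1 _ (rho_pos _ _).le hs0
    apply rho_anti hδ
    rw [abs_of_nonneg hs0, abs_of_nonneg h]; exact hs.2
  have h4 : hh δ r = (∫ s in (0:ℝ)..(r/2), √(|s| * rho δ s)) + ∫ s in (r/2:ℝ)..r, √(|s| * rho δ s) := by
    unfold hh; rw [intervalIntegral.integral_add_adjacent_intervals (hInt0 _ _) (hInt0 _ _)]
  rw [intervalIntegral.integral_const, smul_eq_mul] at h3
  have h5 : (r - r/2) * √(r/2 * rho δ r) ≤ hh δ r := by linarith
  have h6 : 0 ≤ r/2 * rho δ r := mul_nonneg (by linarith) (rho_pos _ _).le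
  have h7 : ((r - r/2) * √(r/2 * rho δ r))^2 ≤ (hh δ r)^2 := by
    apply pow_le_pow_left₀ _ h5
    apply mul_nonneg (by linarith) (Real.sqrt_nonneg _)
  rw [mul_pow, Real.sq_sqrt h6] at h7
  rw [abs_of_nonneg h]
  nlinarith

lemma hh_lower' {δ : ℝ} (hδ : 0 < δ) (r : ℝ) : r^4 * rho δ r ≤ 8 * (hh δ r)^2 * |r| := by
  have := mul_le_mul_of_nonneg_right (hh_lower hδ r) (abs_nonneg r)
  have h4 : r^4 = |r|^3 * |r| := by rw [← pow_succ]; simp [Even.pow_abs (show Even 4 by decide)]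
  rw [h4]; linarith

lemma rho_scale {δ : ℝ} (hδ : 0 < δ) {k : ℝ} (hk : 0 < k) :
    ∃ C, 0 ≤ C ∧ ∀ r, rho δ (k * r) ≤ C * rho δ r := by
  refine ⟨(min 1 k) ^ (-(1+δ)), by positivity, fun r => ?_⟩
  unfold rho
  rw [← Real.mul_rpow (by positivity) (by positivity)]
  apply Real.rpow_le_rpow_of_nonpos (by positivity) _ (by linarith)
  rw [abs_mul, abs_of_pos hk, mul_add]
  have h1 := min_le_left 1 k
  have h2 := mul_le_mul_of_nonneg_right (min_le_right 1 k) (abs_nonneg r)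
  linarith

lemma rho_shift {δ : ℝ} (hδ : 0 < δ) (r v : ℝ) :
    rho δ (r - v) ≤ (1 + |v|) ^ (1 + δ) * rho δ r := by
  unfold rho
  rw [Real.rpow_neg (by positivity), Real.rpow_neg (by positivity), ← div_eq_mul_inv,
    le_div_iff₀ (by positivity), inv_mul_le_iff₀ (by positivity),
    ← Real.mul_rpow (by positivity) (by positivity)]
  apply Real.rpow_le_rpow (by positivity) _ (by linarith)
  have : |r| ≤ |r - v| + |v| := by simpa using abs_add_le (r - v) v
  nlinarith [abs_nonneg (r-v), abs_nonneg v]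

lemma rho_inv (δ r : ℝ) : (rho δ r)⁻¹ = (1 + |r|) ^ (1 + δ) := by
  unfold rho; rw [Real.rpow_neg (by positivity), inv_inv]

/-- base inequality -/
lemma base_ineq {δ q : ℝ} (hδ : 0 < δ) (hδ1 : δ < 1) (hq : 1 < q) (hq2 : q + δ < 2) {κ : ℝ} (hκ : 0 < κ) :
    ∃ C, 0 ≤ C ∧ ∀ r, (1 + |r|) ^ (2 * q - 1 + δ) ≤ κ * (r^4 * rho δ r) + C := by
  have hlim : Tendsto (fun y : ℝ => y ^ (-(4 - 2*q - 2*δ))) atTop (𝓝 0) :=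
    tendsto_rpow_neg_atTop (by linarith)
  have hev := (hlim.eventually (gt_mem_nhds (show (0:ℝ) < κ/16 by positivity))).and (eventually_ge_atTop 2)
  obtain ⟨R, hR⟩ := eventually_atTop.1 hev
  refine ⟨(max R 1) ^ (2 * q - 1 + δ), by positivity, fun r => ?_⟩
  have hρ := rho_pos δ r
  rcases le_total R (1 + |r|) with h | h
  · obtain ⟨h1, h2⟩ := hR _ h
    have h3 : r^4 * 16 ≥ (1 + |r|)^4 := by
      have : (1+|r|)^4 ≤ (2*|r|)^4 := pow_le_pow_left₀ (by positivity) (by linarith) 4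
      rw [mul_pow, Even.pow_abs (show Even 4 by decide)] at this
      linarith
    have h5 : (1 + |r|) ^ (2 * q - 1 + δ) = (1+|r|)^(-(4 - 2*q - 2*δ)) * ((1+|r|)^4 * rho δ r) := by
      unfold rho
      rw [← Real.rpow_natCast, ← Real.rpow_add (by positivity), ← Real.rpow_add (by positivity)]
      congr 1; push_cast; ring
    rw [h5]
    have h6 : (1+|r|)^4 * rho δ r ≤ r^4 * 16 * rho δ r := mul_le_mul_of_nonneg_right h3 hρ.le
    calc _ ≤ κ/16 * (r^4 * 16 * rho δ r) := mul_le_mul h1.le h6 (by positivity) (by positivity)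
      _ = κ * (r^4 * rho δ r) := by ring
      _ ≤ _ := by have : 0 ≤ (max R 1) ^ (2 * q - 1 + δ) := by positivity
                  linarith
  · have : (1 + |r|) ^ (2 * q - 1 + δ) ≤ (max R 1) ^ (2 * q - 1 + δ) :=
      Real.rpow_le_rpow (by positivity) (h.trans (le_max_left _ _)) (by linarith)
    have : 0 ≤ κ * (r^4 * rho δ r) := by positivity
    linarith

lemma amgm {κ ρ a p : ℝ} (hκ : 0 < κ) (hρ : 0 < ρ) : a * p ≤ κ * (ρ * p^2) + (4*κ)⁻¹ * (a^2 * ρ⁻¹) := by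
  have h : κ * (ρ * p^2) + (4*κ)⁻¹ * (a^2 * ρ⁻¹) - a * p = (2*κ*ρ*p - a)^2 * ((4*κ)⁻¹ * ρ⁻¹) := by
    field_simp; ring
  have : 0 ≤ (2*κ*ρ*p - a)^2 * ((4*κ)⁻¹ * ρ⁻¹) := by positivity
  linarith

lemma conv_sq {δ q : ℝ} (hδ : 0 < δ) (hq : 1 < q) (r : ℝ) :
    (|r| ^ (q-1))^2 * (rho δ r)⁻¹ ≤ (1 + |r|) ^ (2 * q - 1 + δ) := by
  rw [rho_inv, show 2*q-1+δ = (q-1)*2 + (1 + δ) by ring, Real.rpow_add (x := 1+|r|) (by positivity) ((q-1)*2),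
    Real.rpow_mul (by positivity)]
  apply mul_le_mul_of_nonneg_right _ (by positivity)
  rw [Real.rpow_two]
  apply pow_le_pow_left₀ (by positivity)
  exact Real.rpow_le_rpow (by positivity) (by linarith) (by linarith)

lemma I1 {δ q : ℝ} (hδ : 0 < δ) (hδ1 : δ < 1) (hq : 1 < q) (hq2 : q + δ < 2) {κ : ℝ} (hκ : 0 < κ) :
    ∃ C, 0 ≤ C ∧ ∀ r p, |r| ^ (q-1) * |p| ≤ κ * (rho δ r * p^2) + κ * (r^4 * rho δ r) + C := by
  obtain ⟨C, hC, h⟩ := base_ineq hδ hδ1 hq hq2 (κ := 4*κ*κ) (by positivity)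
  refine ⟨(4*κ)⁻¹ * C, by positivity, fun r p => ?_⟩
  have h1 := amgm (a := |r|^(q-1)) (p := |p|) hκ (rho_pos δ r)
  have h2 := (conv_sq hδ hq r).trans (h r)
  have h3 := mul_le_mul_of_nonneg_left h2 (show 0 ≤ (4*κ)⁻¹ by positivity)
  have h4 : (4*κ)⁻¹ * (4*κ*κ * (r^4 * rho δ r) + C) = κ * (r^4 * rho δ r) + (4*κ)⁻¹ * C := by
    field_simp
  rw [sq_abs] at h1
  linarith

lemma I3 {δ q : ℝ} (hδ : 0 < δ) (hδ1 : δ < 1) (hq : 1 < q) (hq2 : q + δ < 2) :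
    ∃ C, 0 ≤ C ∧ ∀ r p, |p| ≤ rho δ r * p^2 + (r^4 * rho δ r) + C := by
  obtain ⟨C, hC, h⟩ := base_ineq hδ hδ1 hq hq2 (κ := 4) (by positivity)
  refine ⟨4⁻¹ * C, by positivity, fun r p => ?_⟩
  have h1 := amgm (a := 1) (p := |p|) one_pos (rho_pos δ r)
  have h2 : (rho δ r)⁻¹ ≤ (1 + |r|) ^ (2 * q - 1 + δ) := by
    rw [rho_inv]
    exact Real.rpow_le_rpow_of_exponent_le (by linarith [abs_nonneg r]) (by linarith)
  have h3 := h r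
  rw [sq_abs] at h1
  norm_num at h1 ⊢
  linarith

lemma I2 {δ q : ℝ} (hδ : 0 < δ) (hδ1 : δ < 1) (hq : 1 < q) (hq2 : q + δ < 2) {κ L : ℝ} (hκ : 0 < κ)
    (hL : 0 < L) :
    ∃ C, 0 ≤ C ∧ ∀ r p d, |d| ≤ L → |d| ≤ L * |r| →
      |d| * (|r| ^ (q-1) * |p|) ≤ κ * (rho δ r * p^2) + κ * (r^4 * rho δ r) + C * |r| := by
  obtain ⟨C, hC, h⟩ := base_ineq hδ hδ1 hq hq2 (κ := 4*κ*κ/L^2) (by positivity)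
  refine ⟨(4*κ)⁻¹ * (L^2 * C + L^2 * 2 ^ (2*q-1+δ)), by positivity, fun r p d hd hd' => ?_⟩
  have h1 := amgm (a := |d| * |r|^(q-1)) (p := |p|) hκ (rho_pos δ r)
  rw [sq_abs] at h1
  have hρ := rho_pos δ r
  have h2 : (|d| * |r|^(q-1))^2 * (rho δ r)⁻¹ ≤ d^2 * (1 + |r|) ^ (2 * q - 1 + δ) := by
    rw [mul_pow, mul_assoc, sq_abs]
    exact mul_le_mul_of_nonneg_left (conv_sq hδ hq r) (sq_nonneg _)
  have h3 : d^2 * (1 + |r|) ^ (2 * q - 1 + δ) ≤ 4*κ*κ * (r^4 * rho δ r) + 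
      (L^2 * C + L^2 * 2 ^ (2*q-1+δ)) * |r| := by
    have hP : 0 ≤ 4*κ*κ * (r^4 * rho δ r) := by positivity
    rcases le_total |r| 1 with hr | hr
    · have a1 : d^2 ≤ L^2 * |r| := by
        rw [← sq_abs]
        calc |d|^2 ≤ (L*|r|)^2 := pow_le_pow_left₀ (abs_nonneg _) hd' 2
          _ = L^2 * (|r| * |r|) := by ring
          _ ≤ L^2 * (|r| * 1) := by gcongr
          _ = _ := by ring
      have a2 : (1 + |r|) ^ (2 * q - 1 + δ) ≤ 2 ^ (2 * q - 1 + δ) :=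
        Real.rpow_le_rpow (by positivity) (by linarith) (by linarith)
      have a3 := mul_le_mul a1 a2 (by positivity) (by positivity)
      have a4 : 0 ≤ L^2 * C * |r| := by positivity
      nlinarith
    · have a1 : d^2 ≤ L^2 := by
        rw [← sq_abs]; exact pow_le_pow_left₀ (abs_nonneg _) hd 2
      have a3 := mul_le_mul a1 (h r) (by positivity) (by positivity)
      have a4 : L^2 * (4*κ*κ/L^2 * (r^4 * rho δ r) + C) = 4*κ*κ * (r^4 * rho δ r) + L^2 * C := by
        field_simp
      have a5 : L^2 * C ≤ L^2 * C * |r| := le_mul_of_one_le_right (by positivity) hr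
      have a6 : 0 ≤ L^2 * 2 ^ (2*q-1+δ) * |r| := by positivity
      nlinarith
  have h5 := mul_le_mul_of_nonneg_left (h2.trans h3) (show 0 ≤ (4*κ)⁻¹ by positivity)
  have h6 : (4*κ)⁻¹ * (4*κ*κ * (r^4 * rho δ r) + (L^2 * C + L^2 * 2 ^ (2*q-1+δ)) * |r|)
    = κ * (r^4 * rho δ r) + (4*κ)⁻¹ * (L^2 * C + L^2 * 2 ^ (2*q-1+δ)) * |r| := by
    field_simp
  nlinarith

end NL

namespace NL
open Set Topology

structure C2 (w p pp : ℝ → ℝ) : Prop where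
  h1 : ∀ x, HasDerivAt w (p x) x
  h2 : ∀ x, HasDerivAt p (pp x) x
  h3 : Continuous pp

lemma C2.c0 {w p pp} (h : C2 w p pp) : Continuous w :=
  continuous_iff_continuousAt.2 fun r => (h.h1 r).continuousAt
lemma C2.c1 {w p pp} (h : C2 w p pp) : Continuous p :=
  continuous_iff_continuousAt.2 fun r => (h.h2 r).continuousAt

lemma C2.of_contDiff {w : ℝ → ℝ} (h : ContDiff ℝ 2 w) : C2 w (deriv w) (deriv (deriv w)) := by
  have h' : ContDiff ℝ (1+1) w := by simpa [one_add_one_eq_two] using h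
  rw [contDiff_succ_iff_deriv] at h'
  have h2 := h'.2.2
  have h3 : ContDiff ℝ (0+1) (deriv w) := by simpa using h2
  rw [contDiff_succ_iff_deriv] at h3
  exact ⟨fun x => (h'.1 x).hasDerivAt, fun x => (h3.1 x).hasDerivAt, h3.2.2.continuous⟩

lemma C2.contDiff {w p pp : ℝ → ℝ} (h : C2 w p pp) : ContDiff ℝ 2 w := by
  have e1 : deriv w = p := funext fun x => (h.h1 x).deriv
  have e2 : deriv p = pp := funext fun x => (h.h2 x).deriv
  have h3 : ContDiff ℝ (0+1) p := by
    rw [contDiff_succ_iff_deriv]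
    exact ⟨fun x => (h.h2 x).differentiableAt, by simp, by rw [e2, contDiff_zero]; exact h.h3⟩
  have h' : ContDiff ℝ (1+1) w := by
    rw [contDiff_succ_iff_deriv]
    exact ⟨fun x => (h.h1 x).differentiableAt, by simp, by rw [e1]; simpa using h3⟩
  simpa [one_add_one_eq_two] using h'

lemma C2.z1 {w p pp} (h : C2 w p pp) {x : ℝ} (hx : x ∉ tsupport w) : p x = 0 := by
  have e1 : deriv w = p := funext fun x => (h.h1 x).deriv
  by_contra hne
  exact hx (support_deriv_subset (by rw [e1]; exact hne))
lemma C2.z0 {w : ℝ → ℝ} {x : ℝ} (hx : x ∉ tsupport w) : w x = 0 := image_eq_zero_of_notMem_tsupport hx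
lemma C2.z2 {w p pp} (h : C2 w p pp) {x : ℝ} (hx : x ∉ tsupport w) : pp x = 0 := by
  have e1 : deriv w = p := funext fun x => (h.h1 x).deriv
  have e2 : deriv p = pp := funext fun x => (h.h2 x).deriv
  by_contra hne
  have : x ∈ tsupport p := support_deriv_subset (by rw [e2]; exact hne)
  apply hx
  rw [← e1] at this
  exact closure_minimal support_deriv_subset (isClosed_tsupport _) this

/-- integrability of compactly supported continuous functions -/
lemma ics {χ g : ℝ → ℝ} (hχ : HasCompactSupport χ) (hg : Continuous g)
    (h : ∀ x, x ∉ tsupport χ → g x = 0) : Integrable g :=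
  hg.integrable_of_hasCompactSupport (hχ.mono' (fun x hx => by
    by_contra h'; exact hx (h x h')))

lemma ics2 {χ g F : ℝ → ℝ} (hχ : HasCompactSupport χ) (hg : Continuous g)
    (h : ∀ x, x ∉ tsupport χ → g x = 0) (hF : Integrable F) : Integrable (fun x => g x * F x) := by
  obtain ⟨C, hC⟩ := hg.bounded_above_of_compact_support (hχ.mono' (fun x hx => by
    by_contra h'; exact hx (h x h')))
  exact hF.bdd_mul hg.aestronglyMeasurable (Eventually.of_forall hC)

lemma int_deriv_zero {χ z z' : ℝ → ℝ} (hχ : HasCompactSupport χ) (hz : ∀ x, HasDerivAt z (z' x) x)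
    (hz' : Continuous z') (h : ∀ x, x ∉ tsupport χ → z x = 0)
    (h' : ∀ x, x ∉ tsupport χ → z' x = 0) : ∫ x, z' x = 0 :=
  integral_eq_zero_of_hasDerivAt_of_integrable hz (ics hχ hz' h')
    (ics hχ (continuous_iff_continuousAt.2 fun r => (hz r).continuousAt) h)

lemma sup_le_int {χ z z' : ℝ → ℝ} (hχ : HasCompactSupport χ) (hz : ∀ x, HasDerivAt z (z' x) x)
    (hz' : Continuous z') (h : ∀ x, x ∉ tsupport χ → z x = 0)
    (h' : ∀ x, x ∉ tsupport χ → z' x = 0) (x : ℝ) : |z x| ≤ ∫ y, |z' y| := by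
  have hi := ics hχ hz' h'
  have e : ∫ y in Iic x, z' y = z x := by
    have hcs : HasCompactSupport z := hχ.mono' (fun x hx => by by_contra h''; exact hx (h x h''))
    have ht : Tendsto z atBot (𝓝 0) := by
      have h2 : Tendsto z (cocompact ℝ) (𝓝 0) := by
        apply tendsto_const_nhds.congr'
        have h3 := hasCompactSupport_iff_eventuallyEq.1 hcs
        rw [coclosedCompact_eq_cocompact] at h3
        exact h3.symm
      exact h2.mono_left atBot_le_cocompact
    have := integral_Iic_of_hasDerivAt_of_tendsto' (a := x) (fun y _ => hz y) hi.integrableOn ht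
    simpa using this
  rw [← e]
  calc |∫ y in Iic x, z' y| ≤ ∫ y in Iic x, |z' y| := abs_integral_le_integral_abs
    _ ≤ ∫ y, |z' y| := setIntegral_le_integral hi.abs (Eventually.of_forall fun y => abs_nonneg _)

lemma C2.sq {χ χ1 χ2 : ℝ → ℝ} (h : C2 χ χ1 χ2) :
    C2 (fun x => (χ x)^2) (fun x => 2 * χ x * χ1 x) (fun x => 2 * (χ1 x)^2 + 2 * χ x * χ2 x) := by
  have := h.c0; have := h.c1; have := h.h3
  refine ⟨fun x => ?_, fun x => ?_, by fun_prop⟩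
  · have := (h.h1 x).pow 2
    refine this.congr_deriv (by simp)
  · have := ((h.h1 x).const_mul 2).mul (h.h2 x)
    refine this.congr_deriv (by ring)

/-- cutoffs -/
structure Cut (X V : ℝ) (χ χ1 χ2 : ℝ → ℝ) : Prop where
  c2 : C2 χ χ1 χ2
  cs : HasCompactSupport χ
  b0 : ∀ x, |χ x| ≤ 1
  b1 : ∀ x, |χ1 x| ≤ X
  b2 : ∀ x, |χ2 x| ≤ X
  vol : ∫ x, (χ x)^2 ≤ V

lemma Cut.X0 {X V χ χ1 χ2} (h : Cut X V χ χ1 χ2) : 0 ≤ X := (abs_nonneg _).trans (h.b1 0)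
lemma Cut.sq1 {X V χ χ1 χ2} (h : Cut X V χ χ1 χ2) (x : ℝ) : (χ x)^2 ≤ 1 := by
  rw [← sq_abs]; exact pow_le_one₀ (abs_nonneg _) (h.b0 x)

lemma Cut.p2 {X V χ χ1 χ2} (h : Cut X V χ χ1 χ2) (x : ℝ) :
    |2 * (χ1 x)^2 + 2 * χ x * χ2 x| ≤ 2 * X^2 + 2 * X := by
  have h1 : (χ1 x)^2 ≤ X^2 := by rw [← sq_abs]; exact pow_le_pow_left₀ (abs_nonneg _) (h.b1 x) 2
  have h2 : |χ x * χ2 x| ≤ 1 * X := by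
    rw [abs_mul]; exact mul_le_mul (h.b0 x) (h.b2 x) (abs_nonneg _) zero_le_one
  have h3 := abs_le.1 h2
  rw [abs_le]; constructor <;> nlinarith [sq_nonneg (χ1 x)]

/-- weighted dissipation -/
noncomputable def YY (δ : ℝ) (χ w p : ℝ → ℝ) : ℝ := ∫ x, (χ x)^2 * (rho δ (w x) * (p x)^2)
noncomputable def ZZ (δ : ℝ) (χ w : ℝ → ℝ) : ℝ := ∫ x, (χ x)^2 * ((w x)^4 * rho δ (w x))

lemma YY_nonneg (δ : ℝ) (χ w p : ℝ → ℝ) : 0 ≤ YY δ χ w p :=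
  integral_nonneg fun x => by have := rho_pos δ (w x); positivity

lemma YY_int {δ X V χ χ1 χ2 w p pp} (h : Cut X V χ χ1 χ2) (hw : C2 w p pp) :
    Integrable (fun x => (χ x)^2 * (rho δ (w x) * (p x)^2)) := by
  have := h.c2.c0; have := hw.c0; have := hw.c1; have := rho_cont δ
  exact ics h.cs (by fun_prop) (fun x hx => by simp [C2.z0 hx])

lemma ZZ_int {δ X V χ χ1 χ2 w p pp} (h : Cut X V χ χ1 χ2) (hw : C2 w p pp) :
    Integrable (fun x => (χ x)^2 * ((w x)^4 * rho δ (w x))) := by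
  have := h.c2.c0; have := hw.c0; have := hw.c1; have := rho_cont δ
  exact ics h.cs (by fun_prop) (fun x hx => by simp [C2.z0 hx])

lemma ZZ_le {δ X V C0 : ℝ} {χ χ1 χ2 w p pp} (hδ : 0 < δ) (h : Cut X V χ χ1 χ2) (hw : C2 w p pp)
    (hi : Integrable w) (hC : ∫ x, |w x| ≤ C0) :
    ZZ δ χ w ≤ 8 * ((1 + C0)/2 + X * C0)^2 * C0 * (YY δ χ w p + 1) := by
  have cχ := h.c2.c0; have cχ1 := h.c2.c1; have cw := hw.c0; have cp := hw.c1; have cρ := rho_cont δ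
  have ch := hh_cont δ
  have hC0 : 0 ≤ C0 := (integral_nonneg fun x => abs_nonneg _).trans hC
  have hX := h.X0
  set Y := YY δ χ w p with hY
  have hY0 : 0 ≤ Y := YY_nonneg _ _ _ _
  set A := (1 + C0)/2 + X * C0 with hA
  have hA0 : 0 ≤ A := by positivity
  have ch' := hint_cont δ
  have cgh : Continuous (fun x => √(|w x| * rho δ (w x))) := by fun_prop
  -- sup bound
  have hz : ∀ x, |χ x * hh δ (w x)| ≤ A * √(Y+1) := by
    intro x
    have h1 := sup_le_int (χ := χ) (z := fun x => χ x * hh δ (w x))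
      (z' := fun x => χ1 x * hh δ (w x) + χ x * (√(|w x| * rho δ (w x)) * p x)) h.cs
      (fun x => (h.c2.h1 x).mul ((hh_deriv δ (w x)).comp x (hw.h1 x)))
      (by fun_prop) (fun x hx => by simp [C2.z0 hx])
      (fun x hx => by simp [C2.z0 hx, h.c2.z1 hx]) x
    refine h1.trans ?_
    set θ := (√(Y+1))⁻¹ with hθ
    have hs : 0 < √(Y+1) := Real.sqrt_pos.2 (by linarith)
    have hs1 : 1 ≤ √(Y+1) := by rw [Real.one_le_sqrt]; linarith
    have hss : √(Y+1) * √(Y+1) = Y + 1 := Real.mul_self_sqrt (by linarith)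
    have hb : ∀ y, |χ1 y * hh δ (w y) + χ y * (√(|w y| * rho δ (w y)) * p y)| ≤
       X * |w y| + ((2 * √(Y+1))⁻¹ * ((χ y)^2 * (rho δ (w y) * (p y)^2)) + √(Y+1)/2 * |w y|) := by
      intro y
      refine (abs_add_le _ _).trans (add_le_add ?_ ?_)
      · rw [abs_mul]; exact mul_le_mul (h.b1 y) (abs_hh_le hδ _) (abs_nonneg _) hX
      · rw [Real.sqrt_mul (abs_nonneg _)]
        have e1 : (√|w y|)^2 = |w y| := Real.sq_sqrt (abs_nonneg _)
        have e2 : (√(rho δ (w y)))^2 = rho δ (w y) := Real.sq_sqrt (rho_pos _ _).le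
        rw [show √(Y+1)/2 * |w y| = √(Y+1)/2 * (√|w y|)^2 by rw [e1]]
        set a := √|w y|; set b := √(rho δ (w y))
        have e3 : |χ y * (a * b * p y)| = a * |χ y * b * p y| := by
          rw [show χ y * (a * b * p y) = a * (χ y * b * p y) by ring, abs_mul,
            abs_of_nonneg (Real.sqrt_nonneg _ : 0 ≤ a)]
        have e4 : (χ y)^2 * (rho δ (w y) * (p y)^2) = |χ y * b * p y|^2 := by rw [sq_abs, ← e2]; ring
        rw [e3, e4]
        set c := |χ y * b * p y|
        have : (2 * √(Y+1))⁻¹ * c^2 + √(Y+1)/2 * a^2 - a * c = (2 * √(Y+1))⁻¹ * (c - √(Y+1) * a)^2 := by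
          field_simp; ring
        have : 0 ≤ (2 * √(Y+1))⁻¹ * (c - √(Y+1) * a)^2 := by positivity
        linarith
    have i1 : Integrable (fun y => X * |w y|) := hi.abs.const_mul _
    have i2 : Integrable (fun y => (2 * √(Y+1))⁻¹ * ((χ y)^2 * (rho δ (w y) * (p y)^2))) :=
      (YY_int h hw).const_mul _
    have i3 : Integrable (fun y => √(Y+1)/2 * |w y|) := hi.abs.const_mul _
    have i4 : Integrable (fun y => χ1 y * hh δ (w y) + χ y * (√(|w y| * rho δ (w y)) * p y)) :=
      ics h.cs (by fun_prop) (fun x hx => by simp [C2.z0 hx, h.c2.z1 hx])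
    refine (integral_mono i4.abs (i1.add (i2.add i3)) hb).trans ?_
    have E1 := integral_add i1 (i2.add i3)
    have E2 := integral_add i2 i3
    simp only [Pi.add_apply] at E1 E2 ⊢
    rw [E1, E2, integral_const_mul, integral_const_mul, integral_const_mul]
    change X * (∫ y, |w y|) + ((2 * √(Y+1))⁻¹ * Y + √(Y+1)/2 * ∫ y, |w y|) ≤ _
    have e5 : (2 * √(Y+1))⁻¹ * Y ≤ √(Y+1)/2 := by
      rw [inv_mul_le_iff₀ (by positivity)]; nlinarith
    have e6 : X * (∫ y, |w y|) ≤ X * C0 := mul_le_mul_of_nonneg_left hC hX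
    have e7 : √(Y+1)/2 * (∫ y, |w y|) ≤ √(Y+1)/2 * C0 := mul_le_mul_of_nonneg_left hC (by positivity)
    have e8 : X * C0 ≤ X * C0 * √(Y+1) := le_mul_of_one_le_right (by positivity) hs1
    rw [hA]; nlinarith
  have hpt : ∀ x, (χ x)^2 * ((w x)^4 * rho δ (w x)) ≤ 8 * (A^2 * (Y+1)) * |w x| := by
    intro x
    have h1 := mul_le_mul_of_nonneg_left (hh_lower' hδ (w x)) (sq_nonneg (χ x))
    have h2 : (χ x * hh δ (w x))^2 ≤ A^2 * (Y+1) := by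
      rw [← sq_abs]
      refine (pow_le_pow_left₀ (abs_nonneg _) (hz x) 2).trans ?_
      rw [mul_pow, Real.sq_sqrt (by linarith)]
    have h3 := mul_le_mul_of_nonneg_right h2 (show 0 ≤ 8 * |w x| by positivity)
    calc _ ≤ _ := h1
      _ = (χ x * hh δ (w x))^2 * (8 * |w x|) := by ring
      _ ≤ _ := h3
      _ = _ := by ring
  calc ZZ δ χ w ≤ ∫ x, 8 * (A^2 * (Y+1)) * |w x| :=
        integral_mono (ZZ_int h hw) (hi.abs.const_mul _) hpt
    _ = 8 * (A^2 * (Y+1)) * ∫ x, |w x| := integral_const_mul _ _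
    _ ≤ 8 * (A^2 * (Y+1)) * C0 := mul_le_mul_of_nonneg_left hC (by positivity)
    _ = _ := by ring

end NL

namespace NL
open Set Topology

/-- class of test nonlinearities -/
structure SF (δ L M : ℝ) (S S1 S2 : ℝ → ℝ) : Prop where
  h1 : ∀ r, HasDerivAt S (S1 r) r
  h2 : ∀ r, HasDerivAt S1 (S2 r) r
  h3 : Continuous S2
  z0 : S 0 = 0
  b1 : ∀ r, |S1 r| ≤ L
  b2 : ∀ r, |S2 r| ≤ M * rho δ r

lemma SF.toC2 {δ L M S S1 S2} (h : SF δ L M S S1 S2) : C2 S S1 S2 := ⟨h.h1, h.h2, h.h3⟩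
lemma SF.L0 {δ L M S S1 S2} (h : SF δ L M S S1 S2) : 0 ≤ L := (abs_nonneg _).trans (h.b1 0)

lemma SF.lip {δ L M S S1 S2} (h : SF δ L M S S1 S2) (a b : ℝ) : |S a - S b| ≤ L * |a - b| := by
  have := Convex.norm_image_sub_le_of_norm_hasDerivWithin_le (f := S) (f' := S1) (s := univ) (C := L)
    (x := b) (y := a) (fun x _ => (h.h1 x).hasDerivWithinAt) (fun x _ => h.b1 x) convex_univ
    (mem_univ _) (mem_univ _)
  simpa using this
lemma SF.b0 {δ L M S S1 S2} (h : SF δ L M S S1 S2) (a : ℝ) : |S a| ≤ L * |a| := by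
  have := h.lip a 0
  simpa [h.z0] using this

lemma convA {q δ κ : ℝ} (hδ : 0 < δ) (hδ1 : δ < 1) (hq : 1 < q) (hqδ : q + δ < 2) (hκ : 0 < κ)
    (C0 X V : ℝ) (hC0 : 0 ≤ C0) : ∃ C : ℝ, 0 ≤ C ∧ ∀ χ χ1 χ2 w p pp : ℝ → ℝ, Cut X V χ χ1 χ2 → C2 w p pp →
      Integrable w → ∫ x, |w x| ≤ C0 →
      ∫ x, (χ x)^2 * (|w x|^(q-1) * |p x|) ≤ κ * YY δ χ w p + C := by
  set K := 8 * ((1 + C0)/2 + X * C0)^2 * C0 with hK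
  have hK0 : 0 ≤ K := by positivity
  have hκ' : 0 < κ/(1+K) := by positivity
  obtain ⟨C1, hC1, hI⟩ := I1 hδ hδ1 hq hqδ hκ'
  refine ⟨κ/(1+K)*K + C1 * |V|, by positivity, ?_⟩
  intro χ χ1 χ2 w p pp h hw hi hC
  have cχ := h.c2.c0; have cw := hw.c0; have cp := hw.c1
  have ca : Continuous fun x => |w x|^(q-1) := cw.abs.rpow_const (fun x => Or.inr (by linarith))
  have i0 : Integrable (fun x => (χ x)^2 * (|w x|^(q-1) * |p x|)) :=
    ics h.cs (by fun_prop) (fun x hx => by simp [C2.z0 hx])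
  have i1 : Integrable (fun x => κ/(1+K) * ((χ x)^2 * (rho δ (w x) * (p x)^2))) := (YY_int h hw).const_mul _
  have i2 : Integrable (fun x => κ/(1+K) * ((χ x)^2 * ((w x)^4 * rho δ (w x)))) := (ZZ_int h hw).const_mul _
  have i3 : Integrable (fun x => C1 * (χ x)^2) :=
    (ics h.cs (by fun_prop) (fun x hx => by simp [C2.z0 hx])).const_mul _
  have hz := ZZ_le hδ h hw hi hC
  rw [← hK] at hz
  have E1 := integral_add i1 (i2.add i3)
  have E2 := integral_add i2 i3
  have M := integral_mono i0 (i1.add (i2.add i3)) (fun x => by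
    have := mul_le_mul_of_nonneg_left (hI (w x) (p x)) (sq_nonneg (χ x))
    simp only [Pi.add_apply]
    linarith)
  simp only [Pi.add_apply] at E1 E2 M
  rw [E1, E2, integral_const_mul, integral_const_mul, integral_const_mul] at M
  change _ ≤ κ/(1+K) * YY δ χ w p + (κ/(1+K) * ZZ δ χ w + C1 * _) at M
  have v1 : C1 * ∫ x, (χ x)^2 ≤ C1 * |V| := mul_le_mul_of_nonneg_left (h.vol.trans (le_abs_self _)) hC1
  have v2 := mul_le_mul_of_nonneg_left hz hκ'.le
  have v3 : κ/(1+K) * YY δ χ w p + κ/(1+K) * (K * (YY δ χ w p + 1)) = κ * YY δ χ w p + κ/(1+K)*K := by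
    field_simp; ring
  linarith

lemma convB {q δ κ L : ℝ} (hδ : 0 < δ) (hδ1 : δ < 1) (hq : 1 < q) (hqδ : q + δ < 2) (hκ : 0 < κ) (hL : 0 < L)
    (C0 X : ℝ) (hC0 : 0 ≤ C0) : ∃ C : ℝ, 0 ≤ C ∧ ∀ V, ∀ χ χ1 χ2 w p pp d : ℝ → ℝ, Cut X V χ χ1 χ2 → C2 w p pp →
      Integrable w → ∫ x, |w x| ≤ C0 → Continuous d → (∀ x, |d x| ≤ L) → (∀ x, |d x| ≤ L * |w x|) →
      ∫ x, (χ x)^2 * (|d x| * (|w x|^(q-1) * |p x|)) ≤ κ * YY δ χ w p + C := by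
  set K := 8 * ((1 + C0)/2 + X * C0)^2 * C0 with hK
  have hK0 : 0 ≤ K := by positivity
  have hκ' : 0 < κ/(1+K) := by positivity
  obtain ⟨C1, hC1, hI⟩ := I2 hδ hδ1 hq hqδ hκ' hL
  refine ⟨κ/(1+K)*K + C1 * C0, by positivity, ?_⟩
  intro V χ χ1 χ2 w p pp d h hw hi hC cd d1 d2
  have cχ := h.c2.c0; have cw := hw.c0; have cp := hw.c1
  have ca : Continuous fun x => |w x|^(q-1) := cw.abs.rpow_const (fun x => Or.inr (by linarith))
  have i0 : Integrable (fun x => (χ x)^2 * (|d x| * (|w x|^(q-1) * |p x|))) :=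
    ics h.cs (by fun_prop) (fun x hx => by simp [C2.z0 hx])
  have i1 : Integrable (fun x => κ/(1+K) * ((χ x)^2 * (rho δ (w x) * (p x)^2))) := (YY_int h hw).const_mul _
  have i2 : Integrable (fun x => κ/(1+K) * ((χ x)^2 * ((w x)^4 * rho δ (w x)))) := (ZZ_int h hw).const_mul _
  have i3 : Integrable (fun x => C1 * |w x|) := hi.abs.const_mul _
  have hz := ZZ_le hδ h hw hi hC
  rw [← hK] at hz
  have E1 := integral_add i1 (i2.add i3)
  have E2 := integral_add i2 i3
  have M := integral_mono i0 (i1.add (i2.add i3)) (fun x => by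
    have := mul_le_mul_of_nonneg_left (hI (w x) (p x) (d x) (d1 x) (d2 x)) (sq_nonneg (χ x))
    have h3 : (χ x)^2 * (C1 * |w x|) ≤ 1 * (C1 * |w x|) :=
      mul_le_mul_of_nonneg_right (h.sq1 x) (by positivity)
    simp only [Pi.add_apply]
    linarith)
  simp only [Pi.add_apply] at E1 E2 M
  rw [E1, E2, integral_const_mul, integral_const_mul, integral_const_mul] at M
  change _ ≤ κ/(1+K) * YY δ χ w p + (κ/(1+K) * ZZ δ χ w + C1 * _) at M
  have v1 : C1 * ∫ x, |w x| ≤ C1 * C0 := mul_le_mul_of_nonneg_left hC hC1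
  have v2 := mul_le_mul_of_nonneg_left hz hκ'.le
  have v3 : κ/(1+K) * YY δ χ w p + κ/(1+K) * (K * (YY δ χ w p + 1)) = κ * YY δ χ w p + κ/(1+K)*K := by
    field_simp; ring
  linarith

/-- integration by parts -/
lemma ibp {ψ ψ1 ψ2 w p pp v v1 v2 S S1 S2 : ℝ → ℝ} (hψ : C2 ψ ψ1 ψ2) (hc : HasCompactSupport ψ)
    (hw : C2 w p pp) (hv : C2 v v1 v2) (hS : C2 S S1 S2) :
    ∫ x, ψ x * S1 (w x - v x) * pp x = (∫ x, ψ2 x * S (w x - v x))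
      - (∫ x, ψ x * (S2 (w x - v x) * (p x - v1 x)^2)) + ∫ x, ψ x * S1 (w x - v x) * v2 x := by
  have a1 := hψ.c0; have a2 := hψ.c1; have a3 := hψ.h3
  have b1 := hw.c0; have b2 := hw.c1; have b3 := hw.h3
  have c1 := hv.c0; have c2 := hv.c1; have c3 := hv.h3
  have d1 := hS.c0; have d2 := hS.c1; have d3 := hS.h3
  have i1 : Integrable (fun x => ψ x * S1 (w x - v x) * pp x) :=
    ics hc (by fun_prop) (fun x hx => by simp [C2.z0 hx])
  have i2 : Integrable (fun x => ψ2 x * S (w x - v x)) :=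
    ics hc (by fun_prop) (fun x hx => by simp [hψ.z2 hx])
  have i3 : Integrable (fun x => ψ x * (S2 (w x - v x) * (p x - v1 x)^2)) :=
    ics hc (by fun_prop) (fun x hx => by simp [C2.z0 hx])
  have i4 : Integrable (fun x => ψ x * S1 (w x - v x) * v2 x) :=
    ics hc (by fun_prop) (fun x hx => by simp [C2.z0 hx])
  have hd : ∀ x, HasDerivAt (fun x => w x - v x) (p x - v1 x) x := fun x => (hw.h1 x).sub (hv.h1 x)
  have hd' : ∀ x, HasDerivAt (fun x => p x - v1 x) (pp x - v2 x) x := fun x => (hw.h2 x).sub (hv.h2 x)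
  have Z := int_deriv_zero (χ := ψ)
    (z := fun x => ψ x * (S1 (w x - v x) * (p x - v1 x)) - ψ1 x * S (w x - v x))
    (z' := fun x => ((ψ x * S1 (w x - v x) * pp x - ψ2 x * S (w x - v x)) +
       ψ x * (S2 (w x - v x) * (p x - v1 x)^2)) - ψ x * S1 (w x - v x) * v2 x) hc
    (fun x => by
      have h1 := (hψ.h1 x).mul (((hS.h2 _).comp x (hd x)).mul (hd' x))
      have h2 := (hψ.h2 x).mul ((hS.h1 _).comp x (hd x))
      refine (h1.sub h2).congr_deriv ?_
      simp only [Function.comp, Pi.mul_apply]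
      ring) (by fun_prop) (fun x hx => by simp [C2.z0 hx, hψ.z1 hx])
    (fun x hx => by simp [C2.z0 hx, hψ.z2 hx])
  have E1 := integral_sub ((i1.sub i2).add i3) i4
  have E2 := integral_add (i1.sub i2) i3
  have E3 := integral_sub i1 i2
  simp only [Pi.add_apply, Pi.sub_apply] at E1 E2 E3
  rw [E1, E2, E3] at Z
  linarith

end NL

namespace NL
open Set Topology

lemma ale {g F : ℝ → ℝ} {M : ℝ} (hF : Integrable F) (hg : ∀ x, |g x| ≤ M * |F x|) :
    |∫ x, g x| ≤ M * ∫ x, |F x| := by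
  rw [← integral_const_mul]
  rw [← Real.norm_eq_abs]
  exact norm_integral_le_of_norm_le (hF.abs.const_mul _) (Eventually.of_forall fun x => hg x)

lemma ale' {g F : ℝ → ℝ} (hF : Integrable F) (hg : ∀ x, |g x| ≤ F x) : |∫ x, g x| ≤ ∫ x, F x := by
  rw [← Real.norm_eq_abs]
  exact norm_integral_le_of_norm_le hF (Eventually.of_forall fun x => hg x)

lemma C2.zero : C2 (fun _ => 0) (fun _ => 0) (fun _ => 0) :=
  ⟨fun x => hasDerivAt_const x _, fun x => hasDerivAt_const x _, continuous_const⟩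

lemma split {q μ : ℝ} (hq : 1 < q) {ψ σ w p pp f : ℝ → ℝ} (cψ : Continuous ψ) (hc : HasCompactSupport ψ)
    (cσ : Continuous σ) (hw : C2 w p pp) (hf : Integrable f) :
    Integrable (fun x => ψ x * σ x * (-(|w x|^(q-1) * p x) + μ * pp x + f x)) ∧
    ∫ x, ψ x * σ x * (-(|w x|^(q-1) * p x) + μ * pp x + f x) =
      -(∫ x, ψ x * σ x * (|w x|^(q-1) * p x)) + μ * (∫ x, ψ x * σ x * pp x) + ∫ x, ψ x * σ x * f x := by
  have b1 := hw.c0; have b2 := hw.c1; have b3 := hw.h3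
  have ca : Continuous fun x => |w x|^(q-1) := b1.abs.rpow_const (fun x => Or.inr (by linarith))
  have i1 : Integrable (fun x => ψ x * σ x * (|w x|^(q-1) * p x)) :=
    ics hc (by fun_prop) (fun x hx => by simp [C2.z0 hx])
  have i2 : Integrable (fun x => ψ x * σ x * pp x) :=
    ics hc (by fun_prop) (fun x hx => by simp [C2.z0 hx])
  have i3 : Integrable (fun x => ψ x * σ x * f x) :=
    ics2 hc (by fun_prop) (fun x hx => by simp [C2.z0 hx]) hf
  have e : (fun x => ψ x * σ x * (-(|w x|^(q-1) * p x) + μ * pp x + f x)) =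
    fun x => -(ψ x * σ x * (|w x|^(q-1) * p x)) + μ * (ψ x * σ x * pp x) + ψ x * σ x * f x := by
    funext x; ring
  rw [e]
  refine ⟨(i1.neg.add (i2.const_mul μ)).add i3, ?_⟩
  have E1 := integral_add (i1.neg.add (i2.const_mul μ)) i3
  have E2 := integral_add i1.neg (i2.const_mul μ)
  simp only [Pi.add_apply, Pi.neg_apply] at E1 E2
  rw [E1, E2, integral_neg, integral_const_mul]

/-- energy estimate at a fixed time -/
lemma energy {q δ μ : ℝ} (hδ : 0 < δ) (hδ1 : δ < 1) (hq : 1 < q) (hqδ : q + δ < 2) (hμ : 0 < μ)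
    (C0 X : ℝ) (hC0 : 0 ≤ C0) (hX : 0 ≤ X) : ∃ C : ℝ, 0 ≤ C ∧ ∀ V, ∀ χ χ1 χ2 w p pp f : ℝ → ℝ,
      Cut X V χ χ1 χ2 → C2 w p pp →
      Integrable w → ∫ x, |w x| ≤ C0 → Integrable f → ∫ x, |f x| ≤ C0 →
      ∫ x, (χ x)^2 * b1 δ (w x) * (-(|w x|^(q-1) * p x) + μ * pp x + f x) ≤ -(μ/2) * YY δ χ w p + C := by
  obtain ⟨C1, hC1, hB⟩ := convB (κ := μ/2) (L := max 1 (1/δ)) hδ hδ1 hq hqδ (by positivity) (by positivity) C0 X hC0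
  refine ⟨C1 + μ * ((2 * X^2 + 2*X) * (1/δ) * C0) + 1/δ * C0, by positivity, ?_⟩
  intro V χ χ1 χ2 w p pp f h hw hi hC hf hfC
  have cχ := h.c2.c0; have b1' := hw.c0; have b2 := hw.c1; have b3 := hw.h3
  have cb := b1_cont δ
  have hcs : HasCompactSupport (fun x => (χ x)^2) := h.cs.comp_left (g := fun r => r^2) (by simp)
  rw [(split hq (ψ := fun x => (χ x)^2) (σ := fun x => b1 δ (w x)) (by fun_prop) hcs (by fun_prop) hw hf).2]
  have P := ibp h.c2.sq hcs hw C2.zero (S := b0 δ) ⟨b0_deriv δ, b1_deriv δ, rho_cont δ⟩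
  simp only [sub_zero, mul_zero, integral_zero, add_zero] at P
  change _ = _ - YY δ χ w p at P
  rw [P]
  have ca : Continuous fun x => |w x|^(q-1) := b1'.abs.rpow_const (fun x => Or.inr (by linarith))
  have T1 := hB V χ χ1 χ2 w p pp (fun x => b1 δ (w x)) h hw hi hC (by fun_prop)
    (fun x => (abs_b1_le hδ _).trans (le_max_right _ _))
    (fun x => (abs_b1_le' hδ _).trans (le_mul_of_one_le_left (abs_nonneg _) (le_max_left _ _)))
  have T2 := ale' (g := fun x => (χ x)^2 * b1 δ (w x) * (|w x|^(q-1) * p x))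
    (F := fun x => (χ x)^2 * (|b1 δ (w x)| * (|w x|^(q-1) * |p x|)))
    (ics h.cs (by fun_prop) (fun x hx => by simp [C2.z0 hx])) (fun x => by
      have := Real.rpow_nonneg (abs_nonneg (w x)) (q-1)
      rw [abs_mul, abs_mul, abs_mul, abs_of_nonneg (sq_nonneg (χ x)), abs_of_nonneg this]
      exact (by ring : _ = _).le)
  have T3 := ale (g := fun x => (2 * (χ1 x)^2 + 2 * χ x * χ2 x) * b0 δ (w x)) (F := w)
    (M := (2 * X^2 + 2*X) * (1/δ)) hi (fun x => by
      rw [abs_mul, mul_assoc (2 * X^2 + 2*X)]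
      refine mul_le_mul (h.p2 x) ?_ (abs_nonneg _) (by positivity)
      rw [abs_of_nonneg (b0_nonneg _ _)]; exact b0_le hδ _)
  have T4 := ale (g := fun x => (χ x)^2 * b1 δ (w x) * f x) (F := f) (M := 1/δ) hf (fun x => by
      rw [abs_mul, abs_mul]
      refine mul_le_mul_of_nonneg_right ?_ (abs_nonneg _)
      have := mul_le_mul (a := |(χ x)^2|) (b := 1) (by rw [abs_of_nonneg (sq_nonneg _)]; exact h.sq1 x)
        (abs_b1_le hδ (w x)) (abs_nonneg _) zero_le_one
      linarith)
  have T3' := mul_le_mul_of_nonneg_left hC (show 0 ≤ (2 * X^2 + 2*X) * (1/δ) by positivity)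
  have T4' := mul_le_mul_of_nonneg_left hfC (show 0 ≤ 1/δ by positivity)
  have := (abs_le.1 T2).1
  have T5 := mul_le_mul_of_nonneg_left ((le_abs_self _).trans (T3.trans T3')) hμ.le
  have := (le_abs_self _).trans (T4.trans T4')
  linarith

/-- Kato type estimate at a fixed time -/
lemma kato {q δ μ κ : ℝ} (hδ : 0 < δ) (hδ1 : δ < 1) (hq : 1 < q) (hqδ : q + δ < 2) (hμ : 0 < μ) (hκ : 0 < κ)
    (C0 X V L n : ℝ) (hC0 : 0 ≤ C0) (hX : 0 ≤ X) (hL : 0 ≤ L) (hn : 0 ≤ n) : ∃ C : ℝ, 0 ≤ C ∧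
    ∀ M, ∀ S S1 S2 χ χ1 χ2 w p pp f v v1 v2 : ℝ → ℝ, SF δ L M S S1 S2 → (∀ r, 0 ≤ S2 r) →
      Cut X V χ χ1 χ2 → C2 w p pp →
      Integrable w → ∫ x, |w x| ≤ C0 → Integrable f → ∫ x, |f x| ≤ C0 →
      C2 v v1 v2 → Integrable v → ∫ x, |v x| ≤ C0 → (∀ x ∈ tsupport χ, |v2 x| ≤ n) →
      ∫ x, (χ x)^2 * S1 (w x - v x) * (-(|w x|^(q-1) * p x) + μ * pp x + f x) ≤ κ * YY δ χ w p + C := by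
  obtain ⟨C1, hC1, hB⟩ := convA (κ := κ/(L+1)) hδ hδ1 hq hqδ (by positivity) C0 X V hC0
  refine ⟨L * C1 + μ * ((2 * X^2 + 2*X) * L * (2*C0) + L * n * |V|) + L * C0, by positivity, ?_⟩
  intro M S S1 S2 χ χ1 χ2 w p pp f v v1 v2 hS hS2 h hw hi hC hf hfC hv hvi hvC hvn
  have cχ := h.c2.c0; have b1' := hw.c0; have b2 := hw.c1; have b3 := hw.h3
  have d1 := hS.toC2.c0; have d2 := hS.toC2.c1; have d3 := hS.toC2.h3; have e1 := hv.c0; have e2 := hv.c1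
  have e3 := hv.h3
  have hcs : HasCompactSupport (fun x => (χ x)^2) := h.cs.comp_left (g := fun r => r^2) (by simp)
  rw [(split hq (ψ := fun x => (χ x)^2) (σ := fun x => S1 (w x - v x)) (by fun_prop) hcs (by fun_prop) hw hf).2]
  rw [ibp h.c2.sq hcs hw hv hS.toC2]
  have ca : Continuous fun x => |w x|^(q-1) := b1'.abs.rpow_const (fun x => Or.inr (by linarith))
  have T1 := hB χ χ1 χ2 w p pp h hw hi hC
  have T2 := ale' (g := fun x => (χ x)^2 * S1 (w x - v x) * (|w x|^(q-1) * p x))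
    (F := fun x => L * ((χ x)^2 * (|w x|^(q-1) * |p x|)))
    ((ics h.cs (by fun_prop) (fun x hx => by simp [C2.z0 hx])).const_mul L) (fun x => by
      have := Real.rpow_nonneg (abs_nonneg (w x)) (q-1)
      rw [abs_mul, abs_mul, abs_mul, abs_of_nonneg (sq_nonneg (χ x)), abs_of_nonneg this]
      have := mul_le_mul_of_nonneg_right (hS.b1 (w x - v x)) (show 0 ≤ (χ x)^2 * (|w x|^(q-1) * |p x|) by positivity)
      linarith)
  rw [integral_const_mul] at T2
  have T3 := ale (g := fun x => (2 * (χ1 x)^2 + 2 * χ x * χ2 x) * S (w x - v x)) (F := fun x => w x - v x)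
    (M := (2 * X^2 + 2*X) * L) (hi.sub hvi) (fun x => by
      rw [abs_mul, mul_assoc (2 * X^2 + 2*X)]
      exact mul_le_mul (h.p2 x) (hS.b0 _) (abs_nonneg _) (by positivity))
  have T3a : ∫ x, |w x - v x| ≤ 2 * C0 := by
    have := integral_mono (hi.sub hvi).abs (hi.abs.add hvi.abs) (fun x => abs_sub (w x) (v x))
    have E := integral_add hi.abs hvi.abs
    simp only [Pi.add_apply] at this E
    simp only [Pi.sub_apply] at this
    linarith
  have T6 := ale' (g := fun x => (χ x)^2 * S1 (w x - v x) * v2 x) (F := fun x => L * n * (χ x)^2)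
    ((ics h.cs (by fun_prop) (fun x hx => by simp [C2.z0 hx])).const_mul _) (fun x => by
      by_cases hx : x ∈ tsupport χ
      · have := mul_le_mul (hS.b1 (w x - v x)) (hvn x hx) (abs_nonneg _) hL
        have := mul_le_mul_of_nonneg_left this (sq_nonneg (χ x))
        rw [abs_mul, abs_mul, abs_of_nonneg (sq_nonneg (χ x))]
        linarith
      · simp [C2.z0 hx])
  rw [integral_const_mul] at T6
  have T6' := mul_le_mul_of_nonneg_left (h.vol.trans (le_abs_self _)) (show 0 ≤ L * n by positivity)
  have T7 : 0 ≤ ∫ x, (χ x)^2 * (S2 (w x - v x) * (p x - v1 x)^2) :=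
    integral_nonneg fun x => mul_nonneg (sq_nonneg _) (mul_nonneg (hS2 _) (sq_nonneg _))
  have T4 := ale (g := fun x => (χ x)^2 * S1 (w x - v x) * f x) (F := f) (M := L) hf (fun x => by
      rw [abs_mul, abs_mul]
      refine mul_le_mul_of_nonneg_right ?_ (abs_nonneg _)
      have := mul_le_mul (a := |(χ x)^2|) (b := 1) (by rw [abs_of_nonneg (sq_nonneg _)]; exact h.sq1 x)
        (hS.b1 (w x - v x)) (abs_nonneg _) zero_le_one
      linarith)
  have T3' := mul_le_mul_of_nonneg_left T3a (show 0 ≤ (2 * X^2 + 2*X) * L by positivity)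
  have T4' := mul_le_mul_of_nonneg_left hfC hL
  have := (abs_le.1 T2).1
  have T5 := mul_le_mul_of_nonneg_left (a := μ) (add_le_add (sub_le_sub ((le_abs_self _).trans (T3.trans T3')) T7)
    ((le_abs_self _).trans (T6.trans T6'))) hμ.le
  have := (le_abs_self _).trans (T4.trans T4')
  have T8 := mul_le_mul_of_nonneg_left T1 hL
  have T9 : L * (κ/(L+1)*YY δ χ w p) ≤ κ * YY δ χ w p := by
    have := YY_nonneg δ χ w p
    have h2 : L * (κ/(L+1)) ≤ κ := by rw [mul_div_assoc', div_le_iff₀ (by positivity)]; nlinarith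
    have := mul_le_mul_of_nonneg_right h2 this
    linarith
  linarith

/-- bound for general test functions -/
lemma gbound {q δ μ : ℝ} (hδ : 0 < δ) (hδ1 : δ < 1) (hq : 1 < q) (hqδ : q + δ < 2) (hμ : 0 < μ)
    {C0 X V L M : ℝ} (hC0 : 0 ≤ C0) {S S1 S2 χ χ1 χ2 ψ ψ1 ψ2 v v1 v2 : ℝ → ℝ} (hS : SF δ L M S S1 S2)
    (h : Cut X V χ χ1 χ2) (hψ : C2 ψ ψ1 ψ2) (hc : HasCompactSupport ψ) (h1 : ∀ x ∈ tsupport ψ, χ x = 1)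
    (hv : C2 v v1 v2) (hvi : Integrable v) : ∃ C : ℝ, 0 ≤ C ∧
    ∀ w p pp f : ℝ → ℝ, C2 w p pp → Integrable w → ∫ x, |w x| ≤ C0 → Integrable f → ∫ x, |f x| ≤ C0 →
      |∫ x, ψ x * S1 (w x - v x) * (-(|w x|^(q-1) * p x) + μ * pp x + f x)| ≤ C * (1 + YY δ χ w p) := by
  obtain ⟨C1, hC1, hB⟩ := convA (κ := 1) hδ hδ1 hq hqδ (by positivity) C0 X V hC0
  have d1 := hS.toC2.c0; have d2 := hS.toC2.c1; have d3 := hS.toC2.h3; have e1 := hv.c0; have e2 := hv.c1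
  have e3 := hv.h3
  have cχ := h.c2.c0
  have a1 := hψ.c0; have a2 := hψ.c1; have a3 := hψ.h3
  have cv : Continuous (fun x => (1 + |v x|)^(1+δ)) :=
    (by fun_prop : Continuous fun x => 1 + |v x|).rpow_const (fun x => Or.inr (by linarith))
  have bd : ∀ g : ℝ → ℝ, Continuous g → (∀ x, x ∉ tsupport ψ → g x = 0) → ∃ B, 0 ≤ B ∧ ∀ x, |g x| ≤ B := by
    intro g hg hg0
    obtain ⟨B, hB⟩ := hg.bounded_above_of_compact_support (hc.mono' (fun x hx => by
      by_contra h'; exact hx (hg0 x h')))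
    exact ⟨B, (abs_nonneg _).trans (hB 0), hB⟩
  obtain ⟨B0, hB0, hb0⟩ := bd ψ a1 (fun x hx => C2.z0 hx)
  obtain ⟨B2, hB2, hb2⟩ := bd ψ2 a3 (fun x hx => hψ.z2 hx)
  obtain ⟨B1, hB1, hb1⟩ := bd (fun x => |ψ x| * (1 + |v x|)^(1+δ)) (by fun_prop) (fun x hx => by simp [C2.z0 hx])
  have hL := hS.L0
  have hM : 0 ≤ M := by
    have := (abs_nonneg _).trans (hS.b2 0)
    exact nonneg_of_mul_nonneg_left this (rho_pos δ 0)
  set D1 := ∫ x, |ψ x| * (1 + |v x|)^(1+δ) * (v1 x)^2 with hD1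
  set D2 := ∫ x, |ψ x| * |v2 x| with hD2
  set D3 := ∫ x, |v x| with hD3
  have hD1' : 0 ≤ D1 := integral_nonneg fun x => by positivity
  have hD2' : 0 ≤ D2 := integral_nonneg fun x => by positivity
  have hD3' : 0 ≤ D3 := integral_nonneg fun x => by positivity
  have hsupp : ∀ x (B : ℝ), 0 ≤ B → |ψ x| ≤ B → |ψ x| ≤ B * (χ x)^2 := by
    intro x B hB hb
    by_cases hx : x ∈ tsupport ψ
    · simp [h1 x hx, hb]
    · simp only [C2.z0 hx, abs_zero]; positivity
  refine ⟨B0 * L * (1 + C1) + μ * (B2 * L * (C0 + D3) + 2 * M * (B1 + D1) + L * D2) + B0 * L * C0, by positivity, ?_⟩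
  intro w p pp f hw hi hC hf hfC
  have b1' := hw.c0; have b2 := hw.c1; have b3 := hw.h3; have cρ := rho_cont δ
  rw [(split hq (ψ := ψ) (σ := fun x => S1 (w x - v x)) (by fun_prop) hc (by fun_prop) hw hf).2]
  rw [ibp hψ hc hw hv hS.toC2]
  have ca : Continuous fun x => |w x|^(q-1) := b1'.abs.rpow_const (fun x => Or.inr (by linarith))
  have T1 := hB χ χ1 χ2 w p pp h hw hi hC
  have hY := YY_nonneg δ χ w p
  have T2 := ale' (g := fun x => ψ x * S1 (w x - v x) * (|w x|^(q-1) * p x))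
    (F := fun x => B0 * L * ((χ x)^2 * (|w x|^(q-1) * |p x|)))
    ((ics h.cs (by fun_prop) (fun x hx => by simp [C2.z0 hx])).const_mul _) (fun x => by
      have := Real.rpow_nonneg (abs_nonneg (w x)) (q-1)
      rw [abs_mul, abs_mul, abs_mul, abs_of_nonneg this]
      have := mul_le_mul (hsupp x B0 hB0 (hb0 x)) (hS.b1 (w x - v x)) (abs_nonneg _) (by positivity)
      have := mul_le_mul_of_nonneg_right this (show 0 ≤ (|w x|^(q-1) * |p x|) by positivity)
      linarith)
  rw [integral_const_mul] at T2
  have T3 := ale (g := fun x => ψ2 x * S (w x - v x)) (F := fun x => w x - v x)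
    (M := B2 * L) (hi.sub hvi) (fun x => by
      rw [abs_mul, mul_assoc]
      exact mul_le_mul (hb2 x) (hS.b0 _) (abs_nonneg _) (by positivity))
  have T3a : ∫ x, |w x - v x| ≤ C0 + D3 := by
    have := integral_mono (hi.sub hvi).abs (hi.abs.add hvi.abs) (fun x => abs_sub (w x) (v x))
    have E := integral_add hi.abs hvi.abs
    simp only [Pi.add_apply] at this E
    simp only [Pi.sub_apply] at this
    linarith
  have T6 := ale' (g := fun x => ψ x * S1 (w x - v x) * v2 x) (F := fun x => L * (|ψ x| * |v2 x|))
    ((ics hc (by fun_prop) (fun x hx => by simp [C2.z0 hx])).const_mul _) (fun x => by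
      rw [abs_mul, abs_mul]
      have := mul_le_mul_of_nonneg_right (hS.b1 (w x - v x)) (show 0 ≤ |ψ x| * |v2 x| by positivity)
      linarith)
  rw [integral_const_mul] at T6
  have i7 : Integrable (fun x => 2 * M * (B1 * ((χ x)^2 * (rho δ (w x) * (p x)^2)))) :=
    ((YY_int h hw).const_mul _).const_mul _
  have i8 : Integrable (fun x => 2 * M * (|ψ x| * (1 + |v x|)^(1+δ) * (v1 x)^2)) :=
    (ics hc (by fun_prop) (fun x hx => by simp [C2.z0 hx])).const_mul _
  have T7 := ale' (g := fun x => ψ x * (S2 (w x - v x) * (p x - v1 x)^2)) (i7.add i8) (fun x => by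
      have hr := rho_pos δ (w x)
      have hr1 := rho_le_one hδ (w x)
      simp only [Pi.add_apply]
      rw [abs_mul, abs_mul, abs_of_nonneg (sq_nonneg (p x - v1 x))]
      set A := |ψ x| * (1 + |v x|)^(1+δ) with hA
      have hA0 : 0 ≤ A := by positivity
      have hA1 : A ≤ B1 * (χ x)^2 := by
        by_cases hx : x ∈ tsupport ψ
        · rw [h1 x hx]; simpa using (le_abs_self _).trans (hb1 x)
        · simp only [hA, C2.z0 hx, abs_zero, zero_mul]; positivity
      have k1 : |ψ x| * |S2 (w x - v x)| ≤ M * A * rho δ (w x) := by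
        have := (hS.b2 (w x - v x)).trans (mul_le_mul_of_nonneg_left (rho_shift hδ (w x) (v x)) hM)
        have := mul_le_mul_of_nonneg_left this (abs_nonneg (ψ x))
        rw [hA]; linarith
      have k2 : (p x - v1 x)^2 ≤ 2 * (p x)^2 + 2 * (v1 x)^2 := by nlinarith [sq_nonneg (p x + v1 x)]
      have k3 := mul_le_mul k1 k2 (sq_nonneg _) (by positivity)
      have k4 := mul_le_mul_of_nonneg_right hA1 (show 0 ≤ 2 * M * (rho δ (w x) * (p x)^2) by positivity)
      have k5 := mul_le_mul_of_nonneg_right hr1 (show 0 ≤ 2 * M * (A * (v1 x)^2) by positivity)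
      linarith)
  have E7 := integral_add i7 i8
  simp only [Pi.add_apply] at E7 T7
  rw [E7, integral_const_mul, integral_const_mul, integral_const_mul] at T7
  change _ ≤ 2 * M * (B1 * YY δ χ w p) + 2 * M * D1 at T7
  have T4 := ale (g := fun x => ψ x * S1 (w x - v x) * f x) (F := f) (M := B0 * L) hf (fun x => by
      rw [abs_mul, abs_mul]
      refine mul_le_mul_of_nonneg_right ?_ (abs_nonneg _)
      exact mul_le_mul (hb0 x) (hS.b1 (w x - v x)) (abs_nonneg _) hB0)
  have T3' := T3.trans (mul_le_mul_of_nonneg_left T3a (show 0 ≤ B2 * L by positivity))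
  have T4' := T4.trans (mul_le_mul_of_nonneg_left hfC (show 0 ≤ B0 * L by positivity))
  have T8 := T2.trans (mul_le_mul_of_nonneg_left T1 (show 0 ≤ B0 * L by positivity))
  refine (abs_add_le _ _).trans ((add_le_add_left (abs_add_le _ _) _).trans ?_)
  rw [abs_neg, abs_mul, abs_of_pos hμ]
  have T9 := mul_le_mul_of_nonneg_left (a := μ) ((abs_add_le _ _).trans
    (add_le_add ((abs_sub _ _).trans (add_le_add T3' T7)) T6)) hμ.le
  have hp1 : 0 ≤ B0 * L * C1 * YY δ χ w p := by positivity
  have hp2 : 0 ≤ μ * (B2 * L * (C0 + D3) + 2 * M * D1 + L * D2) * YY δ χ w p := by positivity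
  have hp3 : 0 ≤ B0 * L * C0 * YY δ χ w p := by positivity
  have hp4 : 0 ≤ μ * (2 * M * B1) + B0 * L := by positivity
  change _ ≤ μ * (_ + _ + L * D2) at T9
  linarith

end NL

namespace NL
open Set Topology

/-- abstract system satisfied by the solution -/
structure Sys (q μ δ c : ℝ) (u ut ux uxx f : ℝ → ℝ → ℝ) : Prop where
  hq : 1 < q
  hδ : 0 < δ
  hδ1 : δ < 1
  hqδ : q + δ < 2
  hμ : 0 < μ
  hc : 0 ≤ c
  mU : Measurable (Function.uncurry u)
  mUt : Measurable (Function.uncurry ut)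
  mUx : Measurable (Function.uncurry ux)
  muxx : Measurable (Function.uncurry uxx)
  mf : Measurable (Function.uncurry f)
  dt : ∀ t > 0, ∀ x, HasDerivAt (fun s => u s x) (ut t x) t
  ct : ∀ x, ContinuousOn (fun s => ut s x) (Ioi 0)
  dx : ∀ t > 0, C2 (u t) (ux t) (uxx t)
  eq : ∀ t > 0, ∀ x, ut t x = -(|u t x|^(q-1) * ux t x) + μ * uxx t x + f t x
  iu : ∀ t > 0, Integrable (u t)
  iff : ∀ t > 0, Integrable (f t)
  bf : ∀ t > 0, ∫ x, |f t x| ≤ c * ∫ x, |u t x|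
  l1 : ∀ t₀ > 0, Tendsto (fun t => ∫ x, |u t x - u t₀ x|) (𝓝 t₀) (𝓝 0)

/-- test data -/
structure TT (δ : ℝ) where
  ψ : ℝ → ℝ
  ψ1 : ℝ → ℝ
  ψ2 : ℝ → ℝ
  S : ℝ → ℝ
  S1 : ℝ → ℝ
  S2 : ℝ → ℝ
  v : ℝ → ℝ
  v1 : ℝ → ℝ
  v2 : ℝ → ℝ
  L : ℝ
  M : ℝ
  hψ : C2 ψ ψ1 ψ2
  cs : HasCompactSupport ψ
  hS : SF δ L M S S1 S2
  hv : C2 v v1 v2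
  vi : Integrable v

variable {q μ δ c : ℝ} {u ut ux uxx f : ℝ → ℝ → ℝ}

noncomputable def TT.m (T : TT δ) (u : ℝ → ℝ → ℝ) (t : ℝ) : ℝ := ∫ x, T.ψ x * T.S (u t x - T.v x)
noncomputable def TT.g (T : TT δ) (u ut : ℝ → ℝ → ℝ) (t : ℝ) : ℝ :=
  ∫ x, T.ψ x * T.S1 (u t x - T.v x) * ut t x

def Idd (T : TT δ) (u ut : ℝ → ℝ → ℝ) (s t : ℝ) : Prop :=
  IntervalIntegrable (T.g u ut) volume s t ∧ ∫ r in s..t, T.g u ut r = T.m u t - T.m u s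

lemma Idd.symm {T : TT δ} {s t : ℝ} (h : Idd T u ut s t) : Idd T u ut t s :=
  ⟨h.1.symm, by rw [intervalIntegral.integral_symm, h.2]; ring⟩
lemma Idd.trans {T : TT δ} {s t r : ℝ} (h : Idd T u ut s t) (h' : Idd T u ut t r) : Idd T u ut s r :=
  ⟨h.1.trans h'.1, by rw [← intervalIntegral.integral_add_adjacent_intervals h.1 h'.1, h.2, h'.2]; ring⟩

def GoodOn (δ : ℝ) (u ut : ℝ → ℝ → ℝ) (a b c d : ℝ) : Prop :=
  ∀ T : TT δ, tsupport T.ψ ⊆ Ioo c d → ∀ s ∈ Ioo a b, ∀ t ∈ Ioo a b, Idd T u ut s t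

def GoodPt (δ : ℝ) (u ut : ℝ → ℝ → ℝ) (t x : ℝ) : Prop :=
  ∃ ε > 0, GoodOn δ u ut (t-ε) (t+ε) (x-ε) (x+ε)

lemma GoodOn.mono {a b c d a' b' c' d' : ℝ} (h : GoodOn δ u ut a b c d) (h1 : a ≤ a') (h2 : b' ≤ b)
    (h3 : c ≤ c') (h4 : d' ≤ d) : GoodOn δ u ut a' b' c' d' :=
  fun T hT s hs t ht => h T (hT.trans (Ioo_subset_Ioo h3 h4)) s (Ioo_subset_Ioo h1 h2 hs) t
    (Ioo_subset_Ioo h1 h2 ht)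

lemma Sys.meas_g (H : Sys q μ δ c u ut ux uxx f) (T : TT δ) : Measurable (T.g u ut) := by
  have h1 : Measurable (fun z : ℝ × ℝ => T.ψ z.2 * T.S1 (u z.1 z.2 - T.v z.2) * ut z.1 z.2) := by
    have a := T.hψ.c0.measurable; have b := T.hS.toC2.c1.measurable; have c := T.hv.c0.measurable
    have d := H.mU; have e := H.mUt
    have d' : Measurable (fun z : ℝ × ℝ => u z.1 z.2) := d
    have e' : Measurable (fun z : ℝ × ℝ => ut z.1 z.2) := e
    fun_prop
  exact (h1.stronglyMeasurable.integral_prod_right').measurable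

lemma Sys.l1bound (H : Sys q μ δ c u ut ux uxx f) {s t : ℝ} (hs : 0 < s) :
    ∃ C0, 0 ≤ C0 ∧ ∀ r ∈ Icc s t, ∫ x, |u r x| ≤ C0 ∧ ∫ x, |f r x| ≤ C0 := by
  have hc : ContinuousOn (fun r => ∫ x, |u r x|) (Icc s t) := by
    intro r hr
    have hr0 : 0 < r := hs.trans_le hr.1
    apply ContinuousAt.continuousWithinAt
    rw [ContinuousAt, tendsto_iff_norm_sub_tendsto_zero]
    refine squeeze_zero' (Eventually.of_forall fun _ => norm_nonneg _) ?_ (H.l1 r hr0)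
    filter_upwards [lt_mem_nhds hr0] with r' hr'
    rw [← integral_sub (H.iu r' hr').abs (H.iu r hr0).abs]
    refine norm_integral_le_of_norm_le ((H.iu r' hr').sub (H.iu r hr0)).abs (Eventually.of_forall fun x => ?_)
    exact abs_abs_sub_abs_le_abs_sub _ _
  obtain ⟨C, hC⟩ := isCompact_Icc.exists_bound_of_continuousOn hc
  have hb : ∀ r ∈ Icc s t, ∫ x, |u r x| ≤ |C| := fun r hr =>
    (le_abs_self _).trans ((hC r hr).trans (le_abs_self _))
  refine ⟨(1+c) * |C|, mul_nonneg (by linarith [H.hc]) (abs_nonneg _), fun r hr => ⟨?_, ?_⟩⟩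
  · have := hb r hr; have := mul_nonneg H.hc (abs_nonneg C); linarith
  · have h1 := hb r hr
    have := (H.bf r (hs.trans_le hr.1)).trans (mul_le_mul_of_nonneg_left h1 H.hc)
    have := abs_nonneg C; linarith

lemma TT.int_m (H : Sys q μ δ c u ut ux uxx f) (T : TT δ) {t : ℝ} (ht : 0 < t) :
    Integrable (fun x => T.ψ x * T.S (u t x - T.v x)) := by
  have a := T.hψ.c0; have b := T.hS.toC2.c0; have c := T.hv.c0; have d := (H.dx t ht).c0
  exact ics T.cs (by fun_prop) (fun x hx => by simp [C2.z0 hx])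

lemma TT.int_g (H : Sys q μ δ c u ut ux uxx f) (T : TT δ) {t : ℝ} (ht : 0 < t) :
    Integrable (fun x => T.ψ x * T.S1 (u t x - T.v x) * ut t x) := by
  have a := T.hψ.c0; have b := T.hS.toC2.c1; have c := T.hv.c0; have d := (H.dx t ht).c0
  have := (split (μ := μ) H.hq (σ := fun x => T.S1 (u t x - T.v x)) a T.cs (by fun_prop) (H.dx t ht) (H.iff t ht)).1
  simpa only [← H.eq t ht] using this

lemma TT.bdd (T : TT δ) : ∃ B, 0 ≤ B ∧ ∀ x, |T.ψ x| ≤ B := by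
  obtain ⟨B, hB⟩ := T.hψ.c0.bounded_above_of_compact_support T.cs
  exact ⟨B, (abs_nonneg _).trans (hB 0), hB⟩

lemma TT.m_lip (H : Sys q μ δ c u ut ux uxx f) (T : TT δ) {B : ℝ} (hB0 : 0 ≤ B) (hB : ∀ x, |T.ψ x| ≤ B)
    {s t : ℝ} (hs : 0 < s) (ht : 0 < t) :
    |T.m u t - T.m u s| ≤ B * T.L * ∫ x, |u t x - u s x| := by
  unfold TT.m
  rw [← integral_sub (T.int_m H ht) (T.int_m H hs)]
  refine ale ((H.iu t ht).sub (H.iu s hs)) fun x => ?_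
  rw [← mul_sub, abs_mul, mul_assoc]
  refine mul_le_mul (hB x) ?_ (abs_nonneg _) hB0
  have := T.hS.lip (u t x - T.v x) (u s x - T.v x)
  simpa using this

lemma TT.m_cont (H : Sys q μ δ c u ut ux uxx f) (T : TT δ) {t : ℝ} (ht : 0 < t) :
    ContinuousAt (T.m u) t := by
  obtain ⟨B, hB0, hB⟩ := T.bdd
  rw [ContinuousAt, tendsto_iff_norm_sub_tendsto_zero]
  have h := (H.l1 t ht).const_mul (B * T.L)
  rw [mul_zero] at h
  refine squeeze_zero' (Eventually.of_forall fun _ => norm_nonneg _) ?_ h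
  filter_upwards [lt_mem_nhds ht] with r' hr'
  exact T.m_lip H hB0 hB ht hr'

/-- multiply the spatial test by a smooth function -/
noncomputable def TT.mulψ (T : TT δ) (θ : ℝ → ℝ) (hθ : ContDiff ℝ 2 θ) : TT δ :=
  { T with
    ψ := fun x => θ x * T.ψ x
    ψ1 := deriv (fun x => θ x * T.ψ x)
    ψ2 := deriv (deriv (fun x => θ x * T.ψ x))
    hψ := C2.of_contDiff (hθ.mul T.hψ.contDiff)
    cs := T.cs.mul_left }

lemma sf_scale {δ : ℝ} (hδ : 0 < δ) {k : ℝ} (hk : 0 < k) : ∃ M, SF δ (1/δ) M (fun r => b0 δ (k*r) / k)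
    (fun r => b1 δ (k*r)) (fun r => k * rho δ (k*r)) := by
  obtain ⟨C, hC, h⟩ := rho_scale hδ hk
  refine ⟨k * C, ⟨fun r => ?_, fun r => ?_, ?_, by simp [b0_zero], fun r => abs_b1_le hδ _, fun r => ?_⟩⟩
  · have h1 := ((b0_deriv δ (k*r)).comp r ((hasDerivAt_id r).const_mul k)).div_const k
    refine h1.congr_deriv ?_
    field_simp
  · have h1 := ((b1_deriv δ (k*r)).comp r ((hasDerivAt_id r).const_mul k))
    refine h1.congr_deriv ?_
    ring
  · have := rho_cont δ; fun_prop
  · rw [abs_of_pos (mul_pos hk (rho_pos _ _)), mul_assoc]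
    exact mul_le_mul_of_nonneg_left (h r) hk.le

end NL

section
namespace NL
open Set Topology
open scoped Manifold ContDiff

variable {q μ δ c : ℝ} {u ut ux uxx f : ℝ → ℝ → ℝ}

lemma Idd.sum (H : Sys q μ δ c u ut ux uxx f) {ι : Type} [Fintype ι] (T : TT δ) (θ : ι → ℝ → ℝ)
    (hθ : ∀ i, ContDiff ℝ 2 (θ i)) (h1 : ∀ x, T.ψ x = ∑ i, θ i x * T.ψ x) {s t : ℝ} (hs : 0 < s) (ht : 0 < t)
    (h : ∀ i, Idd (T.mulψ (θ i) (hθ i)) u ut s t) : Idd T u ut s t := by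
  have e1 : ∀ r > 0, T.m u r = ∑ i, (T.mulψ (θ i) (hθ i)).m u r := by
    intro r hr
    unfold TT.m
    rw [← integral_finsetSum _ (fun i _ => (T.mulψ (θ i) (hθ i)).int_m H hr)]
    refine integral_congr_ae (Eventually.of_forall fun x => ?_)
    simp only [TT.mulψ]
    conv_lhs => rw [h1 x]
    rw [Finset.sum_mul]
  have e2 : ∀ r > 0, T.g u ut r = ∑ i, (T.mulψ (θ i) (hθ i)).g u ut r := by
    intro r hr
    unfold TT.g
    rw [← integral_finsetSum _ (fun i _ => (T.mulψ (θ i) (hθ i)).int_g H hr)]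
    refine integral_congr_ae (Eventually.of_forall fun x => ?_)
    simp only [TT.mulψ]
    conv_lhs => rw [h1 x]
    rw [Finset.sum_mul, Finset.sum_mul]
  have hu : ∀ r ∈ uIcc s t, 0 < r := fun r hr => lt_of_lt_of_le (lt_min hs ht) hr.1
  have hi : IntervalIntegrable (fun r => ∑ i, (T.mulψ (θ i) (hθ i)).g u ut r) volume s t := by
    have := IntervalIntegrable.sum Finset.univ (fun i _ => (h i).1)
    simpa [Finset.sum_fn] using this
  refine ⟨hi.congr (fun r hr => (e2 r (hu r (uIoc_subset_uIcc hr))).symm), ?_⟩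
  rw [intervalIntegral.integral_congr (fun r hr => e2 r (hu r hr)),
    intervalIntegral.integral_finsetSum (fun i _ => (h i).1), e1 t ht, e1 s hs, ← Finset.sum_sub_distrib]
  exact Finset.sum_congr rfl (fun i _ => (h i).2)

lemma partition (H : Sys q μ δ c u ut ux uxx f) {a b c' d' : ℝ} (ha : 0 ≤ a)
    (hg : ∀ t ∈ Ioo a b, ∀ x ∈ Ioo c' d', GoodPt δ u ut t x) : GoodOn δ u ut a b c' d' := by
  intro T hT s hs t ht
  refine isPreconnected_Ioo.induction₂ (fun s t => Idd T u ut s t) ?_ (fun _ _ _ _ _ _ h h' => h.trans h')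
    (fun _ _ _ _ h => h.symm) hs ht
  intro t ht
  have ht0 : 0 < t := ha.trans_lt ht.1
  have hg' := hg t ht
  unfold GoodPt at hg'
  choose! ε hε hG using hg'
  obtain ⟨F, hF1, hF2⟩ := (show IsCompact (tsupport T.ψ) from T.cs).elim_nhds_subcover
    (fun x => Ioo (x - ε x) (x + ε x)) (fun x hx => Ioo_mem_nhds (by linarith [hε x (hT hx)]) (by linarith [hε x (hT hx)]))
  obtain ⟨P, hP⟩ := SmoothPartitionOfUnity.exists_isSubordinate 𝓘(ℝ,ℝ) (isClosed_tsupport T.ψ)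
    (fun i : F => Ioo ((i:ℝ) - ε i) (i + ε i)) (fun i => isOpen_Ioo) (by
      intro x hx
      have := hF2 hx
      simp only [mem_iUnion] at this ⊢
      obtain ⟨i, hi, h⟩ := this
      exact ⟨⟨i, hi⟩, h⟩)
  have hcd : ∀ i : F, ContDiff ℝ 2 (P i) := fun i =>
    ((contMDiff_iff_contDiff.1 (P i).contMDiff).of_le ENat.LEInfty.out)
  have hsum : ∀ x, T.ψ x = ∑ i, P i x * T.ψ x := by
    intro x
    by_cases hx : x ∈ tsupport T.ψ
    · have := P.sum_eq_one hx
      rw [finsum_eq_sum_of_fintype] at this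
      rw [← Finset.sum_mul, this, one_mul]
    · simp [C2.z0 hx]
  have hev : ∀ᶠ r in 𝓝[Ioo a b] t, ∀ i ∈ F, r ∈ Ioo (t - ε i) (t + ε i) := by
    apply eventually_nhdsWithin_of_eventually_nhds
    rw [eventually_all_finset]
    intro i hi
    have := hε i (hT (hF1 i hi))
    exact Ioo_mem_nhds (by linarith) (by linarith)
  filter_upwards [hev, self_mem_nhdsWithin] with r hr hr'
  refine Idd.sum H T (fun i : F => P i) hcd hsum ht0 (ha.trans_lt hr'.1) fun i => ?_
  have h3 := hε i (hT (hF1 i i.2))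
  refine hG i (hT (hF1 i i.2)) _ ?_ t ⟨by linarith, by linarith⟩ r (hr i i.2)
  refine Subset.trans ?_ (hP i)
  exact closure_mono (fun x hx => by
    simp only [TT.mulψ, Function.mem_support] at hx ⊢
    exact left_ne_zero_of_mul hx)

end NL
end

namespace NL
open Set Topology

variable {q μ δ c : ℝ} {u ut ux uxx f : ℝ → ℝ → ℝ}

lemma seqs {a b : ℝ} (hab : a < b) : ∃ s t : ℕ → ℝ, (∀ n, s n ∈ Ioo a b) ∧ (∀ n, t n ∈ Ioo a b) ∧
    (∀ n, s n < t n) ∧ Tendsto s atTop (𝓝 a) ∧ Tendsto t atTop (𝓝 b) := by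
  have h0 : Tendsto (fun n : ℕ => (b-a)/((n:ℝ)+3)) atTop (𝓝 0) := by
    apply Tendsto.const_div_atTop
    exact tendsto_atTop_add_const_right _ _ tendsto_natCast_atTop_atTop
  have h1 : ∀ n : ℕ, 0 < (b-a)/((n:ℝ)+3) := fun n => div_pos (by linarith) (by positivity)
  have h2 : ∀ n : ℕ, (b-a)/((n:ℝ)+3) ≤ (b-a)/3 := fun n =>
    div_le_div_of_nonneg_left (by linarith) (by norm_num) (by linarith [Nat.cast_nonneg (α := ℝ) n])
  refine ⟨fun n => a + (b-a)/((n:ℝ)+3), fun n => b - (b-a)/((n:ℝ)+3), fun n => ?_, fun n => ?_, fun n => ?_, ?_, ?_⟩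
  · have := h1 n; have := h2 n; constructor <;> linarith
  · have := h1 n; have := h2 n; constructor <;> linarith
  · have := h1 n; have := h2 n; dsimp only; linarith
  · simpa using h0.const_add a
  · simpa using h0.const_sub b

lemma lim_int {a b : ℝ} (hab : a < b) {F : ℝ → ℝ} (hF : IntervalIntegrable F volume a b) {s t : ℕ → ℝ}
    (hs : ∀ n, s n ∈ Ioo a b) (ht : ∀ n, t n ∈ Ioo a b) (hs' : Tendsto s atTop (𝓝 a))
    (ht' : Tendsto t atTop (𝓝 b)) : Tendsto (fun n => ∫ r in s n..t n, F r) atTop (𝓝 (∫ r in a..b, F r)) := by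
  have hc := intervalIntegral.continuousOn_primitive_interval' hF left_mem_uIcc
  rw [uIcc_of_le hab.le] at hc
  have e : ∀ n, ∫ r in s n..t n, F r = (∫ r in a..t n, F r) - ∫ r in a..s n, F r := by
    intro n
    rw [eq_sub_iff_add_eq, add_comm]
    apply intervalIntegral.integral_add_adjacent_intervals
    · exact hF.mono_set (by rw [uIcc_of_le hab.le, uIcc_of_le (hs n).1.le]; exact Icc_subset_Icc le_rfl (hs n).2.le)
    · apply hF.mono_set
      rw [uIcc_of_le hab.le]
      exact uIcc_subset_Icc (Ioo_subset_Icc_self (hs n)) (Ioo_subset_Icc_self (ht n))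
  simp_rw [e]
  have h1 : Tendsto (fun n => ∫ r in a..t n, F r) atTop (𝓝 (∫ r in a..b, F r)) :=
    (hc b (right_mem_Icc.2 hab.le)).tendsto.comp (tendsto_nhdsWithin_iff.2 ⟨ht', Eventually.of_forall fun n => Ioo_subset_Icc_self (ht n)⟩)
  have h2 : Tendsto (fun n => ∫ r in a..s n, F r) atTop (𝓝 (∫ r in a..a, F r)) :=
    (hc a (left_mem_Icc.2 hab.le)).tendsto.comp (tendsto_nhdsWithin_iff.2 ⟨hs', Eventually.of_forall fun n => Ioo_subset_Icc_self (hs n)⟩)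
  simpa using h1.sub h2

lemma lim_ineq {a b : ℝ} (hab : a < b) {A F : ℝ → ℝ} (hA : ContinuousAt A a) (hB : ContinuousAt A b)
    (hF : IntervalIntegrable F volume a b)
    (h : ∀ s ∈ Ioo a b, ∀ t ∈ Ioo a b, s < t → A t - A s ≤ ∫ r in s..t, F r) :
    A b - A a ≤ ∫ r in a..b, F r := by
  obtain ⟨s, t, h1, h2, h3, h4, h5⟩ := seqs hab
  exact le_of_tendsto_of_tendsto ((hB.tendsto.comp h5).sub (hA.tendsto.comp h4)) (lim_int hab hF h1 h2 h4 h5)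
    (Eventually.of_forall fun n => h _ (h1 n) _ (h2 n) (h3 n))

lemma Idd.closed (H : Sys q μ δ c u ut ux uxx f) {T : TT δ} {a b : ℝ} (ha : 0 < a) (hab : a < b)
    (hg : IntervalIntegrable (T.g u ut) volume a b)
    (h : ∀ s ∈ Ioo a b, ∀ t ∈ Ioo a b, Idd T u ut s t) : Idd T u ut a b := by
  obtain ⟨s, t, h1, h2, h3, h4, h5⟩ := seqs hab
  refine ⟨hg, ?_⟩
  refine tendsto_nhds_unique (lim_int hab hg h1 h2 h4 h5) ?_
  simp_rw [fun n => (h _ (h1 n) _ (h2 n)).2]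
  exact ((T.m_cont H (ha.trans hab)).tendsto.comp h5).sub ((T.m_cont H ha).tendsto.comp h4)

lemma sf_one (hδ : 0 < δ) : SF δ (1/δ) 1 (b0 δ) (b1 δ) (rho δ) :=
  ⟨b0_deriv δ, b1_deriv δ, rho_cont δ, b0_zero δ, abs_b1_le hδ, fun r => by
    rw [abs_of_pos (rho_pos _ _), one_mul]⟩

lemma Sys.meas_Y (H : Sys q μ δ c u ut ux uxx f) {χ : ℝ → ℝ} (hχ : Continuous χ) :
    Measurable (fun t => YY δ χ (u t) (ux t)) := by
  have h1 : Measurable (fun z : ℝ × ℝ => (χ z.2)^2 * (rho δ (u z.1 z.2) * (ux z.1 z.2)^2)) := by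
    have a := hχ.measurable; have b := (rho_cont δ).measurable
    have d' : Measurable (fun z : ℝ × ℝ => u z.1 z.2) := H.mU
    have e' : Measurable (fun z : ℝ × ℝ => ux z.1 z.2) := H.mUx
    fun_prop
  exact (h1.stronglyMeasurable.integral_prod_right').measurable

/-- energy test -/
noncomputable def tE {X V χ χ1 χ2} (hδ : 0 < δ) (h : Cut X V χ χ1 χ2) : TT δ :=
  ⟨_, _, _, b0 δ, b1 δ, rho δ, fun _ => 0, fun _ => 0, fun _ => 0, 1/δ, 1, h.c2.sq,
    h.cs.comp_left (g := fun r => r^2) (by simp), sf_one hδ, C2.zero, integrable_zero _ _ _⟩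

/-- energy inequality on an open interval of good times, constants uniform -/
lemma energyY (H : Sys q μ δ c u ut ux uxx f) (C0 X : ℝ) (hC0 : 0 ≤ C0) (hX : 0 ≤ X) :
    ∃ C : ℝ, 0 ≤ C ∧ ∀ V χ χ1 χ2, ∀ h : Cut X V χ χ1 χ2, ∀ a b : ℝ, 0 < a → a < b →
      (∀ r ∈ Icc a b, ∫ x, |u r x| ≤ C0 ∧ ∫ x, |f r x| ≤ C0) →
      (∀ s ∈ Ioo a b, ∀ t ∈ Ioo a b, Idd (tE H.hδ h) u ut s t) →
      IntervalIntegrable (fun t => YY δ χ (u t) (ux t)) volume a b ∧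
      (tE H.hδ h).m u b - (tE H.hδ h).m u a ≤ -(μ/2) * (∫ r in a..b, YY δ χ (u r) (ux r)) + C * (b-a) := by
  obtain ⟨C, hC, hE⟩ := energy H.hδ H.hδ1 H.hq H.hqδ H.hμ C0 X hC0 hX
  refine ⟨C, hC, ?_⟩
  intro V χ χ1 χ2 h a b ha hab hb hI
  have hμ := H.hμ
  set T := tE H.hδ h with hT
  set Y := fun t => YY δ χ (u t) (ux t) with hY
  have hY0 : ∀ t, 0 ≤ Y t := fun t => YY_nonneg _ _ _ _
  have mY : Measurable Y := H.meas_Y h.c2.c0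
  have hg : ∀ r ∈ Ioo a b, T.g u ut r ≤ -(μ/2) * Y r + C := by
    intro r hr
    have hr0 := ha.trans hr.1
    have hb' := hb r (Ioo_subset_Icc_self hr)
    have := hE V χ χ1 χ2 (u r) (ux r) (uxx r) (f r) h (H.dx r hr0) (H.iu r hr0) hb'.1 (H.iff r hr0) hb'.2
    simp only [← H.eq r hr0] at this
    simpa [TT.g, hT, tE] using this
  have step : ∀ s ∈ Ioo a b, ∀ t ∈ Ioo a b, s < t → IntervalIntegrable Y volume s t ∧
      T.m u t - T.m u s ≤ -(μ/2) * (∫ r in s..t, Y r) + C * (t - s) := by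
    intro s hs t ht hst
    have hi := hI s hs t ht
    have hsub : ∀ r ∈ Ioc s t, r ∈ Ioo a b := fun r hr => ⟨hs.1.trans hr.1, hr.2.trans_lt ht.2⟩
    have hYi : IntervalIntegrable Y volume s t := by
      have h3 : IntervalIntegrable (fun r => (2/μ) * (C - T.g u ut r)) volume s t :=
        ((intervalIntegrable_const).sub hi.1).const_mul _
      refine h3.mono_fun' mY.aestronglyMeasurable ?_
      rw [uIoc_of_le hst.le]
      refine (ae_restrict_iff' measurableSet_Ioc).2 (Eventually.of_forall fun r hr => ?_)
      have := hg r (hsub r hr)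
      change ‖Y r‖ ≤ 2/μ * (C - T.g u ut r)
      rw [Real.norm_eq_abs, abs_of_nonneg (hY0 r)]
      rw [div_mul_eq_mul_div, le_div_iff₀ hμ]
      linarith
    refine ⟨hYi, ?_⟩
    rw [← hi.2, ← intervalIntegral.integral_const_mul]
    have e : C * (t - s) = ∫ r in s..t, C := by simp [mul_comm]
    rw [e, ← intervalIntegral.integral_add (hYi.const_mul _) intervalIntegrable_const]
    refine intervalIntegral.integral_mono_on_of_le_Ioo hst.le hi.1 ((hYi.const_mul _).add intervalIntegrable_const) (fun r hr => ?_)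
    exact hg r (hsub r (Ioo_subset_Ioc_self hr))
  have mb : ∀ t > 0, 0 ≤ T.m u t := fun t ht =>
    integral_nonneg fun x => mul_nonneg (sq_nonneg _) (b0_nonneg _ _)
  have mb' : ∀ t ∈ Ioo a b, T.m u t ≤ 1/δ * C0 := by
    intro t ht
    have := (ale (M := 1/δ) (H.iu t (ha.trans ht.1)) (g := fun x => T.ψ x * T.S (u t x - T.v x)) (fun x => by
      rw [abs_mul]
      have h1 : |T.ψ x| ≤ 1 := by
        change |(χ x)^2| ≤ 1
        rw [abs_of_nonneg (sq_nonneg _)]; exact h.sq1 x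
      have h2 : |T.S (u t x - T.v x)| ≤ 1/δ * |u t x| := by
        have := T.hS.b0 (u t x - T.v x)
        have e : T.v x = 0 := rfl
        rw [e, sub_zero] at this ⊢
        exact this
      have := mul_le_mul h1 h2 (abs_nonneg _) zero_le_one
      linarith))
    have hδ := H.hδ
    have h3 := mul_le_mul_of_nonneg_left (hb t (Ioo_subset_Icc_self ht)).1 (show 0 ≤ 1/δ by positivity)
    exact (le_abs_self _).trans (this.trans h3)
  obtain ⟨s, t, h1, h2, h3, h4, h5⟩ := seqs hab
  have hYi : IntervalIntegrable Y volume a b := by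
    rw [intervalIntegrable_iff_integrableOn_Ioc_of_le hab.le]
    refine integrableOn_Ioc_of_intervalIntegral_norm_bounded (I := (2/μ) * (C * (b-a) + 1/δ*C0)) (l := atTop)
      (fun n => ?_) h4 h5 (Eventually.of_forall fun n => ?_)
    · have := (step _ (h1 n) _ (h2 n) (h3 n)).1
      rwa [intervalIntegrable_iff_integrableOn_Ioc_of_le (h3 n).le] at this
    · have k := (step _ (h1 n) _ (h2 n) (h3 n)).2
      rw [← intervalIntegral.integral_of_le (h3 n).le]
      have e : ∀ r, ‖Y r‖ = Y r := fun r => by rw [Real.norm_eq_abs, abs_of_nonneg (hY0 r)]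
      simp_rw [e]
      have k1 := mb (t n) (ha.trans (h2 n).1)
      have k2 := mb' (s n) (h1 n)
      have k3 : C * (t n - s n) ≤ C * (b - a) :=
        mul_le_mul_of_nonneg_left (by linarith [(h1 n).1, (h2 n).2]) hC
      rw [div_mul_eq_mul_div, le_div_iff₀ hμ]
      linarith
  refine ⟨hYi, ?_⟩
  have e : -(μ/2) * (∫ r in a..b, Y r) + C * (b - a) = ∫ r in a..b, (-(μ/2) * Y r + C) := by
    rw [intervalIntegral.integral_add (hYi.const_mul _) intervalIntegrable_const, intervalIntegral.integral_const_mul]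
    simp [mul_comm]
  rw [e]
  refine lim_ineq hab (T.m_cont H ha) (T.m_cont H (ha.trans hab)) ((hYi.const_mul _).add intervalIntegrable_const) ?_
  intro s hs t ht hst
  obtain ⟨k1, k2⟩ := step s hs t ht hst
  rw [intervalIntegral.integral_add (k1.const_mul _) intervalIntegrable_const, intervalIntegral.integral_const_mul]
  simp only [intervalIntegral.integral_const, smul_eq_mul]
  linarith

end NL

namespace NL
open Set Topology

variable {q μ δ c : ℝ} {u ut ux uxx f : ℝ → ℝ → ℝ}

lemma tsupport_sq {χ : ℝ → ℝ} : tsupport (fun x => (χ x)^2) ⊆ tsupport χ :=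
  closure_mono (fun x hx => by
    simp only [Function.mem_support] at hx ⊢
    exact fun h => hx (by simp [h]))

lemma gap (H : Sys q μ δ c u ut ux uxx f) (C0 X V n : ℝ) (hC0 : 0 ≤ C0) (hX : 0 ≤ X) (hn : 0 ≤ n) :
    ∃ C : ℝ, 0 ≤ C ∧ ∀ χ χ1 χ2, ∀ h : Cut X V χ χ1 χ2, ∀ a b c' d' : ℝ, 0 < a → a < b →
      (∀ r ∈ Icc a b, ∫ x, |u r x| ≤ C0 ∧ ∫ x, |f r x| ≤ C0) →
      GoodOn δ u ut a b c' d' → tsupport χ ⊆ Ioo c' d' → (∀ x ∈ Ioo c' d', |uxx a x| ≤ n) →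
      IntervalIntegrable (fun t => YY δ χ (u t) (ux t)) volume a b ∧
      ∫ r in a..b, YY δ χ (u r) (ux r) ≤ C * (b-a) ∧
      ∫ x, (χ x)^2 * |u b x - u a x| ≤ C * (b-a) := by
  have hδ := H.hδ
  have hμ := H.hμ
  have hβ := b1_one_pos δ
  set β := b1 δ 1 with hβdef
  obtain ⟨C1, hC1, hE⟩ := energyY H C0 X hC0 hX
  set κ := δ * β * μ / 4 with hκ
  have hκ0 : 0 < κ := by positivity
  obtain ⟨C2', hC2, hK⟩ := kato (L := 1/δ) H.hδ H.hδ1 H.hq H.hqδ H.hμ hκ0 C0 X V n hC0 hX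
    (by positivity) hn
  set D := 4/μ * (C1 + C2'/(δ*β)) with hD
  have hD0 : 0 ≤ D := by positivity
  refine ⟨D + (κ*D + C2')/β, by positivity, ?_⟩
  intro χ χ1 χ2 h a b c' d' ha hab hb hgood hsupp hn'
  have hb0 := ha.trans hab
  obtain ⟨hYi, hE1⟩ := hE V χ χ1 χ2 h a b ha hab hb (hgood _ (tsupport_sq.trans hsupp))
  set Y := fun t => YY δ χ (u t) (ux t) with hY
  set IY := ∫ r in a..b, YY δ χ (u r) (ux r) with hIY
  have cχ := h.c2.c0
  have ca := (H.dx a ha).c0; have cb := (H.dx b hb0).c0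
  set W := ∫ x, (χ x)^2 * |u b x - u a x| with hW
  have iW : Integrable (fun x => (χ x)^2 * |u b x - u a x|) :=
    ics h.cs (by fun_prop) (fun x hx => by simp [C2.z0 hx])
  have iχ : Integrable (fun x => (χ x)^2) := ics h.cs (by fun_prop) (fun x hx => by simp [C2.z0 hx])
  -- Kato
  have key : ∀ k : ℝ, 0 < k → β * W - β * V / k ≤ κ * IY + C2' * (b-a) := by
    intro k hk
    obtain ⟨M, hS⟩ := sf_scale hδ hk
    let T : TT δ := ⟨_, _, _, _, _, _, u a, ux a, uxx a, 1/δ, M, h.c2.sq,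
      h.cs.comp_left (g := fun r => r^2) (by simp), hS, H.dx a ha, H.iu a ha⟩
    have hI := hgood T (tsupport_sq.trans hsupp)
    have hg : ∀ r ∈ Ioo a b, T.g u ut r ≤ κ * Y r + C2' := by
      intro r hr
      have hr0 := ha.trans hr.1
      have hb' := hb r (Ioo_subset_Icc_self hr)
      have := hK M _ _ _ χ χ1 χ2 (u r) (ux r) (uxx r) (f r) (u a) (ux a) (uxx a) hS
        (fun r => mul_nonneg hk.le (rho_pos _ _).le) h (H.dx r hr0) (H.iu r hr0) hb'.1 (H.iff r hr0) hb'.2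
        (H.dx a ha) (H.iu a ha) (hb a (left_mem_Icc.2 hab.le)).1 (fun x hx => hn' x (hsupp hx))
      simp only [← H.eq r hr0] at this
      exact this
    have hFi : IntervalIntegrable (fun r => κ * Y r + C2') volume a b :=
      (hYi.const_mul _).add intervalIntegrable_const
    have h1 : T.m u b - T.m u a ≤ ∫ r in a..b, (κ * Y r + C2') := by
      refine lim_ineq hab (T.m_cont H ha) (T.m_cont H hb0) hFi ?_
      intro s hs t ht hst
      rw [← (hI s hs t ht).2]
      refine intervalIntegral.integral_mono_on_of_le_Ioo hst.le (hI s hs t ht).1 ?_ (fun r hr => hg r ⟨hs.1.trans hr.1, hr.2.trans ht.2⟩)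
      apply hFi.mono_set
      rw [uIcc_of_le hab.le]
      exact uIcc_subset_Icc (Ioo_subset_Icc_self hs) (Ioo_subset_Icc_self ht)
    rw [intervalIntegral.integral_add (hYi.const_mul _) intervalIntegrable_const, intervalIntegral.integral_const_mul] at h1
    simp only [intervalIntegral.integral_const, smul_eq_mul] at h1
    have h2 : T.m u a = 0 := by
      have : ∀ x, T.ψ x * T.S (u a x - T.v x) = 0 := by
        intro x
        have e : u a x - T.v x = 0 := sub_self _
        rw [e, T.hS.z0, mul_zero]
      simp [TT.m, this]
    have h3 : β * W - β * V / k ≤ T.m u b := by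
      have h4 := integral_mono ((iW.const_mul β).sub (iχ.const_mul (β/k))) (T.int_m H hb0) (fun x => by
        change β * ((χ x)^2 * |u b x - u a x|) - β/k * (χ x)^2 ≤ (χ x)^2 * (b0 δ (k * (u b x - u a x)) / k)
        have h5 := b0_ge δ (k * (u b x - u a x))
        rw [abs_mul, abs_of_pos hk] at h5
        have h6 : β * |u b x - u a x| - β/k ≤ b0 δ (k * (u b x - u a x)) / k := by
          rw [le_div_iff₀ hk]
          have : (β * |u b x - u a x| - β/k) * k = β * (k * |u b x - u a x| - 1) := by field_simp
          rw [this]; exact h5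
        have := mul_le_mul_of_nonneg_left h6 (sq_nonneg (χ x))
        linarith)
      have e := integral_sub (iW.const_mul β) (iχ.const_mul (β/k))
      simp only [Pi.sub_apply] at h4
      rw [e, integral_const_mul, integral_const_mul] at h4
      have h7 : β/k * ∫ x, (χ x)^2 ≤ β/k * V := mul_le_mul_of_nonneg_left h.vol (by positivity)
      have h8 : β/k * V = β * V / k := by ring
      change _ ≤ T.m u b at h4
      linarith
    change _ ≤ κ * IY + _ at h1
    linarith
  have key2 : β * W ≤ κ * IY + C2' * (b-a) := by
    have ht : Tendsto (fun k : ℝ => β * W - β * V / k) atTop (𝓝 (β * W - 0)) :=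
      tendsto_const_nhds.sub (tendsto_const_nhds.div_atTop tendsto_id)
    rw [sub_zero] at ht
    refine le_of_tendsto ht ?_
    filter_upwards [eventually_gt_atTop 0] with k hk using key k hk
  -- m1(a) - m1(b)
  have hm : (tE H.hδ h).m u a - (tE H.hδ h).m u b ≤ 1/δ * W := by
    unfold TT.m
    rw [← integral_sub ((tE H.hδ h).int_m H ha) ((tE H.hδ h).int_m H hb0), hW, ← integral_const_mul]
    refine integral_mono (((tE H.hδ h).int_m H ha).sub ((tE H.hδ h).int_m H hb0)) (iW.const_mul _) (fun x => ?_)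
    have := (le_abs_self _).trans ((sf_one hδ).lip (u a x) (u b x))
    rw [abs_sub_comm] at this
    have := mul_le_mul_of_nonneg_left this (sq_nonneg (χ x))
    simp only [tE, sub_zero]
    linarith
  have hIYD : IY ≤ D * (b-a) := by
    have h1 : (μ/2) * IY ≤ 1/δ * W + C1 * (b-a) := by linarith
    have h2 : 1/δ * W ≤ 1/(δ*β) * (κ * IY + C2' * (b-a)) := by
      have := mul_le_mul_of_nonneg_left key2 (show 0 ≤ 1/(δ*β) by positivity)
      have e : 1/(δ*β) * (β * W) = 1/δ * W := by field_simp
      linarith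
    have h3 : 1/(δ*β) * (κ * IY + C2' * (b-a)) = μ/4 * IY + C2'/(δ*β) * (b-a) := by
      rw [hκ]; field_simp
    have h4 : μ/4 * IY ≤ (C1 + C2'/(δ*β)) * (b-a) := by linarith
    have h5 := mul_le_mul_of_nonneg_left h4 (show 0 ≤ 4/μ by positivity)
    have e : 4/μ * (μ/4 * IY) = IY := by field_simp
    rw [hD]; linarith
  have hba : 0 < b - a := by linarith
  refine ⟨hYi, ?_, ?_⟩
  · have : 0 ≤ (κ*D + C2')/β * (b-a) := by positivity
    linarith
  · have h1 : β * W ≤ (κ * D + C2') * (b-a) := by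
      have := mul_le_mul_of_nonneg_left hIYD hκ0.le
      linarith
    have h2 : W ≤ (κ*D + C2')/β * (b-a) := by
      rw [div_mul_eq_mul_div, le_div_iff₀ hβ]; linarith
    have : 0 ≤ D * (b-a) := by positivity
    linarith

end NL

section
namespace NL
open Set Topology
open scoped Manifold ContDiff

variable {q μ δ c : ℝ} {u ut ux uxx f : ℝ → ℝ → ℝ}

/-- gaps of a closed set -/
def Gp (K : Set ℝ) : Set (ℝ × ℝ) := {p | p.1 ∈ K ∧ p.2 ∈ K ∧ p.1 < p.2 ∧ ∀ r ∈ Ioo p.1 p.2, r ∉ K}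

lemma Gp_disj (K : Set ℝ) {p p' : ℝ × ℝ} (hp : p ∈ Gp K) (hp' : p' ∈ Gp K) {r : ℝ}
    (h : r ∈ Ioo p.1 p.2) (h' : r ∈ Ioo p'.1 p'.2) : p = p' := by
  obtain ⟨h1, h2, h3, h4⟩ := hp
  obtain ⟨h1', h2', h3', h4'⟩ := hp'
  refine Prod.ext ?_ ?_
  · rcases lt_trichotomy p.1 p'.1 with h5 | h5 | h5
    · exact absurd h1' (h4 _ ⟨h5, h'.1.trans h.2⟩)
    · exact h5
    · exact absurd h1 (h4' _ ⟨h5, h.1.trans h'.2⟩)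
  · rcases lt_trichotomy p.2 p'.2 with h5 | h5 | h5
    · exact absurd h2 (h4' _ ⟨h'.1.trans h.2, h5⟩)
    · exact h5
    · exact absurd h2' (h4 _ ⟨h.1.trans h'.2, h5⟩)

lemma Gp_countable (K : Set ℝ) : (Gp K).Countable := by
  refine Set.PairwiseDisjoint.countable_of_isOpen (s := fun p : ℝ × ℝ => Ioo p.1 p.2) ?_ (fun _ _ => isOpen_Ioo)
    (fun p hp => nonempty_Ioo.2 hp.2.2.1)
  intro p hp p' hp' hne
  exact disjoint_left.2 fun r h h' => hne (Gp_disj K hp hp' h h')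

lemma Gp_union {K : Set ℝ} {s t : ℝ} (hK : IsClosed K) (hKs : K ⊆ Icc s t) (hs : s ∈ K) (ht : t ∈ K) :
    Icc s t \ K = ⋃ p : Gp K, Ioo p.1.1 p.1.2 := by
  ext r
  simp only [mem_iUnion, Set.mem_sdiff]
  constructor
  · rintro ⟨hr, hrK⟩
    have hA : IsCompact (K ∩ Icc s r) := isCompact_Icc.inter_left hK
    have hB : IsCompact (K ∩ Icc r t) := isCompact_Icc.inter_left hK
    have hA' := hA.sSup_mem ⟨s, hs, le_rfl, hr.1⟩
    have hB' := hB.sInf_mem ⟨t, ht, hr.2, le_rfl⟩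
    have e1 : sSup (K ∩ Icc s r) < r := lt_of_le_of_ne hA'.2.2 (fun h => hrK (h ▸ hA'.1))
    have e2 : r < sInf (K ∩ Icc r t) := lt_of_le_of_ne hB'.2.1 (fun h => hrK (h ▸ hB'.1))
    refine ⟨⟨(sSup (K ∩ Icc s r), sInf (K ∩ Icc r t)), hA'.1, hB'.1, e1.trans e2, ?_⟩, e1, e2⟩
    rintro z ⟨hz1, hz2⟩ hzK
    have hzI := hKs hzK
    rcases le_total z r with h | h
    · exact absurd (le_csSup hA.bddAbove ⟨hzK, hzI.1, h⟩) (not_le.2 hz1)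
    · exact absurd (csInf_le hB.bddBelow ⟨hzK, h, hzI.2⟩) (not_le.2 hz2)
  · rintro ⟨⟨p, h1, h2, h3, h4⟩, hr⟩
    exact ⟨⟨(hKs h1).1.trans hr.1.le, hr.2.le.trans (hKs h2).2⟩, h4 r hr⟩

lemma gapsum {K : Set ℝ} {s t : ℝ} (hst : s ≤ t) (hK : IsClosed K) (hKs : K ⊆ Icc s t) (hs : s ∈ K) (ht : t ∈ K)
    {G : ℝ → ℝ} (hG : IntegrableOn G (Icc s t)) :
    HasSum (fun p : Gp K => ∫ r in p.1.1..p.1.2, G r) ((∫ r in s..t, G r) - ∫ r in K, G r) := by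
  have : Countable (Gp K) := (Gp_countable K).to_subtype
  have h := hasSum_integral_iUnion (μ := volume) (f := G) (s := fun p : Gp K => Ioo p.1.1 p.1.2) (fun _ => measurableSet_Ioo)
    (fun p p' hne => disjoint_left.2 fun r h h' => hne (Subtype.ext (Gp_disj K p.2 p'.2 h h')))
    (by rw [← Gp_union hK hKs hs ht]; exact hG.mono_set sdiff_subset)
  rw [← Gp_union hK hKs hs ht, setIntegral_sdiff hK.measurableSet hG hKs, integral_Icc_eq_integral_Ioc, 
    ← intervalIntegral.integral_of_le hst] at h
  have e : (fun p : Gp K => ∫ r in p.1.1..p.1.2, G r) = fun p : Gp K => ∫ r in Ioo p.1.1 p.1.2, G r := by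
    funext p
    rw [intervalIntegral.integral_of_le p.2.2.2.1.le, integral_Ioc_eq_integral_Ioo]
  rw [e]; exact h

lemma exists_cut {ψ : ℝ → ℝ} (hc : HasCompactSupport ψ) {c' d' : ℝ} (h : tsupport ψ ⊆ Ioo c' d') :
    ∃ X V χ χ1 χ2, 0 ≤ X ∧ Cut X V χ χ1 χ2 ∧ (∀ x ∈ tsupport ψ, χ x = 1) ∧ tsupport χ ⊆ Ioo c' d' := by
  obtain ⟨K, hK, hK1, hK2⟩ := exists_compact_between (show IsCompact (tsupport ψ) from hc) isOpen_Ioo h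
  obtain ⟨χ, h1, h2, h3⟩ := exists_contMDiffMap_one_nhds_of_subset_interior (n := ⊤) 𝓘(ℝ,ℝ) (isClosed_tsupport ψ) hK1
  have hcd : ContDiff ℝ 2 χ := ((contMDiff_iff_contDiff.1 χ.contMDiff).of_le ENat.LEInfty.out)
  have hC2 := C2.of_contDiff hcd
  have hsub : tsupport χ ⊆ K := closure_minimal (fun x hx => by
    by_contra hxK; exact hx (h2 x hxK)) hK.isClosed
  have hcs : HasCompactSupport χ := hK.of_isClosed_subset (isClosed_tsupport _) hsub
  obtain ⟨B1, hB1⟩ := hC2.c1.bounded_above_of_compact_support (hcs.mono' (fun x hx => by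
    by_contra h'; exact hx (hC2.z1 h')))
  obtain ⟨B2, hB2⟩ := hC2.h3.bounded_above_of_compact_support (hcs.mono' (fun x hx => by
    by_contra h'; exact hx (hC2.z2 h')))
  refine ⟨max B1 B2, _, χ, _, _, ?_, ⟨hC2, hcs, ?_, ?_, ?_, le_rfl⟩, ?_, hsub.trans hK2⟩
  · exact le_max_of_le_left ((norm_nonneg _).trans (hB1 0))
  · intro x; rw [abs_of_nonneg (h3 x).1]; exact (h3 x).2
  · exact fun x => (hB1 x).trans (le_max_left _ _)
  · exact fun x => (hB2 x).trans (le_max_right _ _)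
  · exact fun x hx => h1.self_of_nhdsSet x hx

lemma glue (H : Sys q μ δ c u ut ux uxx f) {s t c' d' n : ℝ} (hs0 : 0 < s) (hst : s < t) {K : Set ℝ}
    (hK : IsClosed K) (hKs : K ⊆ Icc s t) (hs : s ∈ K) (ht : t ∈ K) (hn : 0 ≤ n)
    (hb : ∀ r ∈ K, ∀ x ∈ Ioo c' d', |ux r x| ≤ n ∧ |uxx r x| ≤ n)
    (hg : ∀ r ∈ Icc s t, r ∉ K → ∀ x ∈ Ioo c' d', GoodPt δ u ut r x)
    (T : TT δ) (hT : tsupport T.ψ ⊆ Ioo c' d') : Idd T u ut s t := by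
  have : Countable (Gp K) := (Gp_countable K).to_subtype
  have hpos : ∀ r ∈ Icc s t, 0 < r := fun r hr => hs0.trans_le hr.1
  obtain ⟨C0, hC0, hL1⟩ := H.l1bound (s := s) (t := t) hs0
  obtain ⟨X, V, χ, χ1, χ2, hX, hχ, hχ1, hχs⟩ := exists_cut T.cs hT
  obtain ⟨C, hC, hgap⟩ := gap H C0 X V n hC0 hX hn
  obtain ⟨Cg, hCg, hgb⟩ := gbound H.hδ H.hδ1 H.hq H.hqδ H.hμ hC0 T.hS hχ T.hψ T.cs hχ1 T.hv T.vi
  obtain ⟨B, hB0, hB⟩ := T.bdd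
  have hL0 := T.hS.L0
  set Y := fun t => YY δ χ (u t) (ux t) with hY
  have hsub : ∀ p : Gp K, Icc p.1.1 p.1.2 ⊆ Icc s t := fun p => Icc_subset_Icc (hKs p.2.1).1 (hKs p.2.2.1).2
  have hgood : ∀ p : Gp K, GoodOn δ u ut p.1.1 p.1.2 c' d' := by
    intro p
    refine partition H (hs0.le.trans (hKs p.2.1).1) fun r hr x hx => ?_
    exact hg r (hsub p (Ioo_subset_Icc_self hr)) (p.2.2.2.2 r hr) x hx
  have hG : ∀ p : Gp K, _ := fun p => hgap χ χ1 χ2 hχ p.1.1 p.1.2 c' d' (hpos _ (hKs p.2.1)) p.2.2.2.1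
    (fun r hr => hL1 r (hsub p hr)) (hgood p) hχs (fun x hx => (hb _ p.2.1 x hx).2)
  have hsum1 : Summable (fun p : Gp K => C * (p.1.2 - p.1.1)) := by
    have h := gapsum (G := fun _ => (1:ℝ)) hst.le hK hKs hs ht (integrableOn_const (by simp))
    simp only [intervalIntegral.integral_const, smul_eq_mul, mul_one] at h
    exact h.summable.mul_left C
  have hgle : ∀ r ∈ Icc s t, |T.g u ut r| ≤ Cg * (1 + Y r) := by
    intro r hr
    have hr0 := hpos r hr
    have := hgb (u r) (ux r) (uxx r) (f r) (H.dx r hr0) (H.iu r hr0) (hL1 r hr).1 (H.iff r hr0) (hL1 r hr).2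
    simp only [← H.eq r hr0] at this
    exact this
  -- integrability of g off K
  have hYi : IntegrableOn Y (Icc s t \ K) := by
    rw [Gp_union hK hKs hs ht]
    refine integrableOn_iUnion_of_summable_integral_norm ?_ ?_
    · intro p
      exact ((intervalIntegrable_iff_integrableOn_Ioc_of_le p.2.2.2.1.le).1 (hG p).1).mono_set Ioo_subset_Ioc_self
    · refine Summable.of_nonneg_of_le (fun p => integral_nonneg fun _ => norm_nonneg _) (fun p => ?_) hsum1
      have h2 := (hG p).2.1
      rw [intervalIntegral.integral_of_le p.2.2.2.1.le, integral_Ioc_eq_integral_Ioo] at h2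
      have e : ∀ r, ‖Y r‖ = YY δ χ (u r) (ux r) := fun r => abs_of_nonneg (YY_nonneg _ _ _ _)
      simp only [e]; exact h2
  have hgi1 : IntegrableOn (T.g u ut) (Icc s t \ K) := by
    have hi : IntegrableOn (fun r => Cg * (1 + Y r)) (Icc s t \ K) := by
      refine Integrable.const_mul (Integrable.add ?_ hYi) _
      exact (integrableOn_const (by simp) : IntegrableOn (fun _ => (1:ℝ)) (Icc s t)).mono_set sdiff_subset
    refine hi.mono' (H.meas_g T).aestronglyMeasurable ?_
    filter_upwards [ae_restrict_mem (measurableSet_Icc.diff hK.measurableSet)] with r hr using hgle r hr.1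
  -- integrability on K × ℝ
  have hKpos : ∀ r ∈ K, 0 < r := fun r hr => hpos r (hKs hr)
  have hmeas : Measurable (fun z : ℝ × ℝ => T.ψ z.2 * T.S1 (u z.1 z.2 - T.v z.2) * ut z.1 z.2) := by
    have a := T.hψ.c0.measurable; have b := T.hS.toC2.c1.measurable; have c := T.hv.c0.measurable
    have d' : Measurable (fun z : ℝ × ℝ => u z.1 z.2) := H.mU
    have e' : Measurable (fun z : ℝ × ℝ => ut z.1 z.2) := H.mUt
    fun_prop
  have hψi : Integrable (fun x => |T.ψ x|) :=
    (T.hψ.c0.integrable_of_hasCompactSupport T.cs).abs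
  have hKint : Integrable (Function.uncurry fun r x => T.ψ x * T.S1 (u r x - T.v x) * ut r x)
      ((volume.restrict K).prod volume) := by
    refine (integrable_prod_iff (μ := volume.restrict K) (ν := volume) hmeas.aestronglyMeasurable).2 ?_
    have hKfin : IsFiniteMeasure (volume.restrict K) := by
      rw [isFiniteMeasure_restrict]
      exact ((measure_mono hKs).trans_lt (by simp)).ne
    refine ⟨?_, ?_⟩
    · filter_upwards [ae_restrict_mem hK.measurableSet] with r hr using T.int_g H (hKpos r hr)
    · refine Integrable.of_bound (C := T.L * ((n + μ*n) * (∫ x, |T.ψ x|) + B * (n * C0 + C0)))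
        (hmeas.norm.stronglyMeasurable.integral_prod_right').aestronglyMeasurable ?_
      filter_upwards [ae_restrict_mem hK.measurableSet] with r hr
      have hr0 := hKpos r hr
      have hb' := hL1 r (hKs hr)
      rw [Real.norm_of_nonneg (integral_nonneg fun _ => norm_nonneg _)]
      have iu := (H.iu r hr0).abs; have iF := (H.iff r hr0).abs
      have iuf : Integrable (fun x => n * |u r x| + |f r x|) := (iu.const_mul n).add iF
      have iR : Integrable (fun x => T.L * ((n + μ*n) * |T.ψ x| + B * (n * |u r x| + |f r x|))) :=
        ((hψi.const_mul _).add (iuf.const_mul B)).const_mul _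
      have h1 := integral_mono (T.int_g H hr0).norm iR (fun x => ?_)
      · refine h1.trans ?_
        rw [integral_const_mul, integral_add (hψi.const_mul _) (iuf.const_mul B),
          integral_const_mul, integral_const_mul, integral_add (iu.const_mul n) iF, integral_const_mul]
        gcongr
        · exact hb'.1
        · exact hb'.2
      · simp only [Real.norm_eq_abs]
        by_cases hx : x ∈ tsupport T.ψ
        · have hbx := hb r hr x (hT hx)
          have hq := H.hq; have hqδ := H.hqδ; have hδ := H.hδ; have hμ := H.hμ
          have hpw : |u r x|^(q-1) ≤ 1 + |u r x| := by
            rcases le_total (|u r x|) 1 with h | h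
            · have := Real.rpow_le_one (abs_nonneg (u r x)) h (by linarith : 0 ≤ q-1)
              have := abs_nonneg (u r x); linarith
            · have := Real.rpow_le_rpow_of_exponent_le h (by linarith : q-1 ≤ 1)
              rw [Real.rpow_one] at this; linarith
          have hut : |ut r x| ≤ (n + μ*n) + (n * |u r x| + |f r x|) := by
            rw [H.eq r hr0 x]
            have e1 : |(-(|u r x|^(q-1) * ux r x))| ≤ (1 + |u r x|) * n := by
              rw [abs_neg, abs_mul, abs_of_nonneg (Real.rpow_nonneg (abs_nonneg _) _)]
              exact mul_le_mul hpw hbx.1 (abs_nonneg _) (by positivity)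
            have e2 : |μ * uxx r x| ≤ μ * n := by
              rw [abs_mul, abs_of_pos hμ]; exact mul_le_mul_of_nonneg_left hbx.2 hμ.le
            have := abs_add_three (-(|u r x|^(q-1) * ux r x)) (μ * uxx r x) (f r x)
            linarith
          rw [abs_mul, abs_mul]
          have e3 := mul_le_mul (T.hS.b1 (u r x - T.v x)) hut (abs_nonneg _) hL0
          have e4 := mul_le_mul_of_nonneg_left e3 (abs_nonneg (T.ψ x))
          have e5 : |T.ψ x| * (n * |u r x| + |f r x|) ≤ B * (n * |u r x| + |f r x|) :=
            mul_le_mul_of_nonneg_right (hB x) (by positivity)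
          have e6 := mul_le_mul_of_nonneg_left e5 hL0
          linarith
        · have e : T.ψ x = 0 := C2.z0 hx
          have := H.hμ
          rw [e]; simp only [zero_mul, abs_zero]; positivity
  have hgiK : IntegrableOn (T.g u ut) K := hKint.integral_prod_left
  have hgI : IntegrableOn (T.g u ut) (Icc s t) := by
    have := hgi1.union hgiK
    rwa [sdiff_union_of_subset hKs] at this
  have hgII : IntervalIntegrable (T.g u ut) volume s t :=
    (intervalIntegrable_iff_integrableOn_Icc_of_le hst.le).2 hgI
  refine ⟨hgII, ?_⟩
  have hIdd : ∀ p : Gp K, Idd T u ut p.1.1 p.1.2 := fun p =>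
    Idd.closed H (hpos _ (hKs p.2.1)) p.2.2.2.1
      ((intervalIntegrable_iff_integrableOn_Icc_of_le p.2.2.2.1.le).2 (hgI.mono_set (hsub p)))
      (hgood p T hT)
  have S1 := gapsum hst.le hK hKs hs ht hgI
  simp only [fun p : Gp K => (hIdd p).2] at S1
  set P : ℝ → ℝ → ℝ := fun r x => T.ψ x * T.S (u r x - T.v x) with hP
  have hPd : ∀ x, ∀ r > 0, HasDerivAt (fun r => P r x) (T.ψ x * T.S1 (u r x - T.v x) * ut r x) r := by
    intro x r hr
    have h1 := (T.hS.toC2.h1 (u r x - T.v x)).comp r ((H.dt r hr x).sub_const (T.v x))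
    have := h1.const_mul (T.ψ x)
    rw [mul_assoc]; exact this
  have hdc : ∀ x, ContinuousOn (fun r => T.ψ x * T.S1 (u r x - T.v x) * ut r x) (Icc s t) := by
    intro x
    have h1 : ContinuousOn (fun r => u r x) (Icc s t) := fun r hr =>
      (H.dt r (hpos r hr) x).continuousAt.continuousWithinAt
    have h2 := (H.ct x).mono (fun r hr => hpos r hr : Icc s t ⊆ Ioi 0)
    have h3 := T.hS.toC2.c1
    exact (continuousOn_const.mul (h3.comp_continuousOn (h1.sub continuousOn_const))).mul h2
  have hFTC : ∀ x, ∀ a b, a ≤ b → Icc a b ⊆ Icc s t → 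
      ∫ r in a..b, T.ψ x * T.S1 (u r x - T.v x) * ut r x = P b x - P a x := by
    intro x a b hab hsb
    refine intervalIntegral.integral_eq_sub_of_hasDerivAt (f := fun r => P r x) ?_ ?_
    · intro r hr; rw [uIcc_of_le hab] at hr; exact hPd x r (hpos r (hsb hr))
    · apply ContinuousOn.intervalIntegrable; rw [uIcc_of_le hab]; exact (hdc x).mono hsb
  have S2 : ∀ x, HasSum (fun p : Gp K => P p.1.2 x - P p.1.1 x)
      ((P t x - P s x) - ∫ r in K, T.ψ x * T.S1 (u r x - T.v x) * ut r x) := by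
    intro x
    have h := gapsum hst.le hK hKs hs ht ((hdc x).integrableOn_Icc)
    simp only [fun p : Gp K => hFTC x p.1.1 p.1.2 p.2.2.2.1.le (hsub p)] at h
    rwa [hFTC x s t hst.le subset_rfl] at h
  have iP : ∀ r > 0, Integrable (P r) := fun r hr => T.int_m H hr
  have S3 := hasSum_integral_of_summable_integral_norm (F := fun (p : Gp K) x => P p.1.2 x - P p.1.1 x)
    (μ := volume) (fun p => (iP _ (hKpos _ p.2.2.1)).sub (iP _ (hKpos _ p.2.1))) (by
      refine Summable.of_nonneg_of_le (fun p => integral_nonneg fun _ => norm_nonneg _) (fun p => ?_) 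
        (hsum1.mul_left (B * T.L))
      have hp1 := hKpos _ p.2.1; have hp2 := hKpos _ p.2.2.1
      have ca := (H.dx _ hp1).c0; have cb := (H.dx _ hp2).c0; have cχ := hχ.c2.c0
      have iW : Integrable (fun x => (χ x)^2 * |u p.1.2 x - u p.1.1 x|) :=
        ics hχ.cs (by fun_prop) (fun x hx => by simp [C2.z0 hx])
      refine le_trans ?_ (mul_le_mul_of_nonneg_left (hG p).2.2 (mul_nonneg hB0 hL0))
      rw [← integral_const_mul]
      refine integral_mono ((iP _ hp2).sub (iP _ hp1)).norm (iW.const_mul _) (fun x => ?_)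
      change |T.ψ x * _ - T.ψ x * _| ≤ B * T.L * ((χ x)^2 * |u p.1.2 x - u p.1.1 x|)
      rw [← mul_sub, abs_mul]
      by_cases hx : x ∈ tsupport T.ψ
      · rw [hχ1 x hx]
        have h1 := T.hS.lip (u p.1.2 x - T.v x) (u p.1.1 x - T.v x)
        rw [sub_sub_sub_cancel_right] at h1
        have := mul_le_mul (hB x) h1 (abs_nonneg _) hB0
        linarith
      · have e : T.ψ x = 0 := C2.z0 hx
        rw [e, abs_zero, zero_mul]
        positivity)
  simp only [fun x => (S2 x).tsum_eq] at S3
  have iKx : Integrable (fun x => ∫ r in K, T.ψ x * T.S1 (u r x - T.v x) * ut r x) := hKint.integral_prod_right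
  have e1 : ∫ x, (P t x - P s x - ∫ r in K, T.ψ x * T.S1 (u r x - T.v x) * ut r x) =
      T.m u t - T.m u s - ∫ r in K, T.g u ut r := by
    have iPP : Integrable (fun x => P t x - P s x) := (iP t (hKpos t ht)).sub (iP s (hKpos s hs))
    rw [integral_sub iPP iKx, integral_sub (iP t (hKpos t ht)) (iP s (hKpos s hs))]
    have := integral_integral_swap hKint
    unfold TT.m TT.g
    rw [this]
  rw [e1] at S3
  have e2 : (fun p : Gp K => ∫ x, P p.1.2 x - P p.1.1 x) = fun p : Gp K => T.m u p.1.2 - T.m u p.1.1 := by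
    funext p
    exact integral_sub (iP _ (hKpos _ p.2.2.1)) (iP _ (hKpos _ p.2.1))
  rw [e2] at S3
  have := S1.unique S3
  linarith

end NL
end

namespace NL
open Set Topology

variable {q μ δ c : ℝ} {u ut ux uxx f : ℝ → ℝ → ℝ}

/-- difference quotient bounds on an interval -/
def DQ (w : ℝ → ℝ) (α β n : ℝ) : Prop :=
  ∀ a b h : ℝ, a ∈ Ioo α β → b ∈ Ioo α β → a + h ∈ Ioo α β → b + h ∈ Ioo α β →
    |w a - w b| ≤ n * |a - b| ∧ |(w (a+h) - w a) - (w (b+h) - w b)| ≤ n * |h| * |a - b|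

lemma DQ.ext1 {w p pp : ℝ → ℝ} (hw : C2 w p pp) {α β n : ℝ} (hn : 0 ≤ n) (h : DQ w α β n) :
    ∀ y ∈ Ioo α β, |p y| ≤ n ∧ |pp y| ≤ n := by
  intro y hy
  constructor
  · refine (hw.h1 y).le_of_lip' hn ?_
    filter_upwards [Ioo_mem_nhds hy.1 hy.2] with a ha
    exact (h a y 0 ha hy (by simpa using ha) (by simpa using hy)).1
  · refine (hw.h2 y).le_of_lip' hn ?_
    filter_upwards [Ioo_mem_nhds hy.1 hy.2] with z hz
    obtain ⟨k, hk⟩ : ∃ k, k = z - y := ⟨_, rfl⟩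
    have hz' : y + k = z := by rw [hk]; ring
    have hd : HasDerivAt (fun a => w (a + k) - w a) (p (y+k) - p y) y :=
      ((hw.h1 (y+k)).comp_add_const y k).sub (hw.h1 y)
    rw [← hz']
    have e : y + k - y = k := by ring
    rw [e]
    refine hd.le_of_lip' (by positivity) ?_
    have hc : ContinuousAt (fun a : ℝ => a + k) y := by fun_prop
    have h3 := hc.preimage_mem_nhds (Ioo_mem_nhds (a := α) (b := β) (by rw [hz']; exact hz.1) (by rw [hz']; exact hz.2))
    filter_upwards [Ioo_mem_nhds hy.1 hy.2, h3] with a ha ha'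
    exact (h a y k ha hy ha' (by rw [hz']; exact hz)).2

lemma DQ.ext2 {w p pp : ℝ → ℝ} (hw : C2 w p pp) {α β n : ℝ}
    (h : ∀ y ∈ Ioo α β, |p y| ≤ n ∧ |pp y| ≤ n) : DQ w α β n := by
  intro a b k ha hb hak hbk
  have mv : ∀ {g g' : ℝ → ℝ} (hg : ∀ x, HasDerivAt g (g' x) x) {x y C : ℝ}, (∀ z ∈ uIcc x y, |g' z| ≤ C) → 
      |g x - g y| ≤ C * |x - y| := by
    intro g g' hg x y C hC
    have := (convex_uIcc x y).norm_image_sub_le_of_norm_hasDerivWithin_le (f := g) (f' := g') (C := C)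
      (fun z _ => (hg z).hasDerivWithinAt) hC (right_mem_uIcc) (left_mem_uIcc)
    exact this
  have hsub : ∀ {x y : ℝ}, x ∈ Ioo α β → y ∈ Ioo α β → uIcc x y ⊆ Ioo α β := fun hx hy =>
    ordConnected_Ioo.uIcc_subset hx hy
  refine ⟨mv hw.h1 fun z hz => (h z (hsub ha hb hz)).1, ?_⟩
  have hd : ∀ x, HasDerivAt (fun a => w (a + k) - w a) (p (x+k) - p x) x := fun x =>
      ((hw.h1 (x+k)).comp_add_const x k).sub (hw.h1 x)
  refine mv hd fun z hz => ?_
  have hz1 := hsub ha hb hz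
  have hz2 : z + k ∈ Ioo α β := by
    have : z + k ∈ uIcc (a+k) (b+k) := by
      rw [mem_uIcc] at hz ⊢
      rcases hz with hz | hz
      · left; constructor <;> linarith
      · right; constructor <;> linarith
    exact hsub hak hbk this
  have := mv hw.h2 (x := z + k) (y := z) (C := n) fun y hy => (h y (hsub hz2 hz1 hy)).2
  simpa using this

lemma good_open {t x : ℝ} (h : GoodPt δ u ut t x) : ∃ ε > 0, ∀ t' x', |t' - t| < ε → |x' - x| < ε → GoodPt δ u ut t' x' := by
  obtain ⟨ε, hε, h⟩ := h
  refine ⟨ε/2, by positivity, fun t' x' h1 h2 => ⟨ε/2, by positivity, ?_⟩⟩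
  rw [abs_lt] at h1 h2
  exact h.mono (by linarith) (by linarith) (by linarith) (by linarith)

lemma good_isOpen : IsOpen {z : ℝ × ℝ | GoodPt δ u ut z.1 z.2} := by
  rw [Metric.isOpen_iff]
  rintro ⟨t, x⟩ h
  obtain ⟨ε, hε, h⟩ := good_open h
  refine ⟨ε, hε, ?_⟩
  rintro ⟨t', x'⟩ h'
  rw [Metric.mem_ball, Prod.dist_eq, max_lt_iff] at h'
  exact h t' x' h'.1 h'.2

lemma all_good (H : Sys q μ δ c u ut ux uxx f) : ∀ t > 0, ∀ x, GoodPt δ u ut t x := by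
  by_contra hcon
  push Not at hcon
  obtain ⟨t0, ht0, x0, h0⟩ := hcon
  set E : Set (ℝ × ℝ) := {z | ¬ GoodPt δ u ut (Real.exp z.1) z.2} with hE
  have hEc : IsClosed E := by
    have : IsOpen {z : ℝ × ℝ | GoodPt δ u ut (Real.exp z.1) z.2} :=
      good_isOpen.preimage (f := fun z : ℝ × ℝ => (Real.exp z.1, z.2)) (by fun_prop)
    exact this.isClosed_compl
  have : CompleteSpace E := hEc.completeSpace_coe
  have hne : Nonempty E := ⟨⟨(Real.log t0, x0), by simpa [hE, Real.exp_log ht0] using h0⟩⟩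
  let A : ℕ → Set E := fun n => {z | DQ (u (Real.exp z.1.1)) (z.1.2 - 1/(n+1)) (z.1.2 + 1/(n+1)) n}
  have hcu : ∀ y, Continuous (fun s => u (Real.exp s) y) := fun y =>
    continuous_iff_continuousAt.2 fun s =>
      ContinuousAt.comp (f := Real.exp) (H.dt _ (Real.exp_pos s) y).continuousAt Real.continuous_exp.continuousAt
  have hcu' : ∀ y, Continuous (fun z : E => u (Real.exp z.1.1) y) := fun y =>
    (hcu y).comp (continuous_fst.comp continuous_subtype_val)
  have hAc : ∀ n, IsClosed (A n) := by
    intro n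
    have e : A n = ⋂ (a : ℝ) (b : ℝ) (h : ℝ), {z : E | ((a ∈ Ioo (z.1.2 - 1/(n+1)) (z.1.2 + 1/(n+1))) ∧
      (b ∈ Ioo (z.1.2 - 1/(n+1)) (z.1.2 + 1/(n+1))) ∧ (a+h ∈ Ioo (z.1.2 - 1/(n+1)) (z.1.2 + 1/(n+1))) ∧
      (b+h ∈ Ioo (z.1.2 - 1/(n+1)) (z.1.2 + 1/(n+1)))) → 
      (|u (Real.exp z.1.1) a - u (Real.exp z.1.1) b| ≤ n * |a - b| ∧ 
       |(u (Real.exp z.1.1) (a+h) - u (Real.exp z.1.1) a) - (u (Real.exp z.1.1) (b+h) - u (Real.exp z.1.1) b)| ≤ n * |h| * |a - b|)} := by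
      ext z
      simp only [A, DQ, mem_setOf_eq, mem_iInter]
      exact ⟨fun h a b k ⟨h1, h2, h3, h4⟩ => h a b k h1 h2 h3 h4, fun h a b k h1 h2 h3 h4 => h a b k ⟨h1, h2, h3, h4⟩⟩
    rw [e]
    refine isClosed_iInter fun a => isClosed_iInter fun b => isClosed_iInter fun h => ?_
    have oI : ∀ y : ℝ, IsOpen {z : E | y ∈ Ioo (z.1.2 - 1/((n:ℝ)+1)) (z.1.2 + 1/(n+1))} := fun y =>
      (isOpen_lt (f := fun z : E => z.1.2 - 1/((n:ℝ)+1)) (g := fun _ => y) (by fun_prop) continuous_const).inter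
        (isOpen_lt (f := fun _ : E => y) (g := fun z : E => z.1.2 + 1/((n:ℝ)+1)) continuous_const (by fun_prop))
    refine isClosed_imp ?_ ?_
    · exact (oI a).inter ((oI b).inter ((oI (a+h)).inter (oI (b+h))))
    · have h1 := hcu' a; have h2 := hcu' b; have h3 := hcu' (a+h); have h4 := hcu' (b+h)
      have c1 : Continuous (fun z : E => |u (Real.exp z.1.1) a - u (Real.exp z.1.1) b|) := (h1.sub h2).abs
      have c2 : Continuous (fun z : E => |(u (Real.exp z.1.1) (a+h) - u (Real.exp z.1.1) a) -
        (u (Real.exp z.1.1) (b+h) - u (Real.exp z.1.1) b)|) := ((h3.sub h1).sub (h4.sub h2)).abs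
      exact (isClosed_le c1 continuous_const).inter (isClosed_le c2 continuous_const)
  have hAU : ⋃ n, A n = univ := by
    refine eq_univ_of_forall fun z => mem_iUnion.2 ?_
    have hC := H.dx _ (Real.exp_pos z.1.1)
    obtain ⟨M1, hM1⟩ := (isCompact_Icc (a := z.1.2 - 1) (b := z.1.2 + 1)).exists_bound_of_continuousOn hC.c1.continuousOn
    obtain ⟨M2, hM2⟩ := (isCompact_Icc (a := z.1.2 - 1) (b := z.1.2 + 1)).exists_bound_of_continuousOn hC.h3.continuousOn
    obtain ⟨n, hn⟩ := exists_nat_ge (max M1 M2)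
    refine ⟨n, DQ.ext2 hC fun y hy => ?_⟩
    have h1 : 1/((n:ℝ)+1) ≤ 1 := by
      rw [div_le_one (by positivity)]; have : (0:ℝ) ≤ n := Nat.cast_nonneg n
      linarith
    have hy' : y ∈ Icc (z.1.2 - 1) (z.1.2 + 1) := ⟨by linarith [hy.1], by linarith [hy.2]⟩
    exact ⟨(hM1 y hy').trans ((le_max_left _ _).trans hn), (hM2 y hy').trans ((le_max_right _ _).trans hn)⟩
  obtain ⟨n, ⟨⟨⟨τ, x1⟩, hz1⟩, hInt0⟩⟩ := nonempty_interior_of_iUnion_of_closed hAc hAU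
  rw [mem_interior_iff_mem_nhds, Metric.mem_nhds_iff] at hInt0
  obtain ⟨ε, hε, hball⟩ := hInt0
  have hball' : ∀ τ' x', |τ' - τ| < ε → |x' - x1| < ε → ¬ GoodPt δ u ut (Real.exp τ') x' →
      DQ (u (Real.exp τ')) (x' - 1/(n+1)) (x' + 1/(n+1)) n := by
    intro τ' x' h1 h2 h3
    have : (⟨(τ', x'), h3⟩ : E) ∈ Metric.ball (⟨(τ, x1), hz1⟩ : E) ε := by
      rw [Metric.mem_ball, Subtype.dist_eq, Prod.dist_eq, max_lt_iff]
      exact ⟨h1, h2⟩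
    exact hball this
  have hn1 : (0:ℝ) < 1/((n:ℝ)+1) := by positivity
  apply hz1
  -- choose box
  set η := min (ε/2) (1/((n:ℝ)+1)/2) with hη
  have hη0 : 0 < η := by positivity
  have hη1 : η ≤ ε/2 := min_le_left _ _
  have hη2 : η ≤ 1/((n:ℝ)+1)/2 := min_le_right _ _
  have hbox : Ioo (Real.exp (τ-ε)) (Real.exp (τ+ε)) ∈ 𝓝 (Real.exp τ) :=
    Ioo_mem_nhds (Real.exp_lt_exp.2 (by linarith)) (Real.exp_lt_exp.2 (by linarith))
  obtain ⟨ζ, hζ, hζb⟩ := Metric.mem_nhds_iff.1 hbox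
  rw [Real.ball_eq_Ioo] at hζb
  have hlog : ∀ r ∈ Ioo (Real.exp (τ-ε)) (Real.exp (τ+ε)), 0 < r ∧ |Real.log r - τ| < ε := by
    intro r hr
    have hr0 := (Real.exp_pos _).trans hr.1
    refine ⟨hr0, ?_⟩
    have h1 := (Real.lt_log_iff_exp_lt hr0).2 hr.1
    have h2 := (Real.log_lt_iff_lt_exp hr0).2 hr.2
    rw [abs_lt]; constructor <;> linarith
  have main : ∀ T : TT δ, tsupport T.ψ ⊆ Ioo (x1-η) (x1+η) → 
      ∀ s ∈ Ioo (Real.exp (τ-ε)) (Real.exp (τ+ε)), ∀ t ∈ Ioo (Real.exp (τ-ε)) (Real.exp (τ+ε)), s < t → Idd T u ut s t := by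
    intro T hT s hs t ht hst
    have hs0 := (hlog s hs).1; have ht0 := (hlog t ht).1
    set K0 : Set ℝ := Prod.fst '' ((Icc s t ×ˢ Icc (x1-η) (x1+η)) ∩ {z : ℝ × ℝ | ¬ GoodPt δ u ut z.1 z.2}) with hK0
    have hK0c : IsCompact K0 := by
      refine IsCompact.image ?_ continuous_fst
      exact (isCompact_Icc.prod isCompact_Icc).inter_right (by
        have := (good_isOpen (δ := δ) (u := u) (ut := ut)).isClosed_compl
        exact this)
    have hb0 : ∀ r > 0, ∃ M, ∀ x ∈ Ioo (x1-η) (x1+η), |ux r x| ≤ M ∧ |uxx r x| ≤ M := by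
      intro r hr
      have hC := H.dx r hr
      obtain ⟨M1, hM1⟩ := (isCompact_Icc (a := x1-η) (b := x1+η)).exists_bound_of_continuousOn hC.c1.continuousOn
      obtain ⟨M2, hM2⟩ := (isCompact_Icc (a := x1-η) (b := x1+η)).exists_bound_of_continuousOn hC.h3.continuousOn
      exact ⟨max M1 M2, fun x hx => ⟨(hM1 x (Ioo_subset_Icc_self hx)).trans (le_max_left _ _),
        (hM2 x (Ioo_subset_Icc_self hx)).trans (le_max_right _ _)⟩⟩
    obtain ⟨M1, hM1⟩ := hb0 s hs0
    obtain ⟨M2, hM2⟩ := hb0 t ht0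
    refine glue H (K := {s, t} ∪ K0) (n := max n (max M1 M2)) (c' := x1-η) (d' := x1+η) hs0 hst ?_ ?_ (by simp) (by simp)
      (le_max_of_le_left (Nat.cast_nonneg n)) ?_ ?_ T hT
    · exact (Set.toFinite {s, t}).isClosed.union hK0c.isClosed
    · rintro r (hr | ⟨⟨r', x'⟩, ⟨⟨h1, h2⟩, h3⟩, rfl⟩)
      · rcases hr with rfl | rfl
        · exact ⟨le_rfl, hst.le⟩
        · exact ⟨hst.le, le_rfl⟩
      · exact h1
    · rintro r (hr | ⟨⟨r', x'⟩, ⟨⟨h1, h2⟩, h3⟩, rfl⟩) x hx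
      · rcases hr with rfl | rfl
        · have := hM1 x hx
          have h4 : M1 ≤ max (n:ℝ) (max M1 M2) := (le_max_left _ _).trans (le_max_right _ _)
          exact ⟨this.1.trans h4, this.2.trans h4⟩
        · have := hM2 x hx
          have h4 : M2 ≤ max (n:ℝ) (max M1 M2) := (le_max_right _ _).trans (le_max_right _ _)
          exact ⟨this.1.trans h4, this.2.trans h4⟩
      · simp only at h1 h2 h3 ⊢
        have hr' : r' ∈ Ioo (Real.exp (τ-ε)) (Real.exp (τ+ε)) := ⟨hs.1.trans_le h1.1, h1.2.trans_lt ht.2⟩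
        obtain ⟨h5, h6⟩ := hlog r' hr'
        have h7 := hball' (Real.log r') x' h6 (by rw [abs_lt]; constructor <;> linarith [h2.1, h2.2])
          (by rw [Real.exp_log h5]; exact h3)
        rw [Real.exp_log h5] at h7
        have := h7.ext1 (H.dx r' h5) (Nat.cast_nonneg n) x ⟨by linarith [hx.1, h2.2], by linarith [hx.2, h2.1]⟩
        exact ⟨this.1.trans (le_max_left _ _), this.2.trans (le_max_left _ _)⟩
    · intro r hr hrK x hx
      by_contra hbad
      exact hrK (Or.inr ⟨(r, x), ⟨⟨hr, Ioo_subset_Icc_self hx⟩, hbad⟩, rfl⟩)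
  refine ⟨min ζ η, lt_min hζ hη0, fun T hT s hs t ht => ?_⟩
  have hT' : tsupport T.ψ ⊆ Ioo (x1-η) (x1+η) := hT.trans (Ioo_subset_Ioo (by linarith [min_le_right ζ η]) (by linarith [min_le_right ζ η]))
  have hI : Ioo (Real.exp τ - min ζ η) (Real.exp τ + min ζ η) ⊆ Ioo (Real.exp (τ-ε)) (Real.exp (τ+ε)) :=
    (Ioo_subset_Ioo (by linarith [min_le_left ζ η]) (by linarith [min_le_left ζ η])).trans hζb
  rcases lt_trichotomy s t with h | rfl | h
  · exact main T hT' s (hI hs) t (hI ht) h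
  · exact ⟨IntervalIntegrable.refl, by simp⟩
  · exact (main T hT' t (hI ht) s (hI hs) h).symm

lemma all_idd (H : Sys q μ δ c u ut ux uxx f) (T : TT δ) {s t : ℝ} (hs : 0 < s) (ht : 0 < t) : Idd T u ut s t := by
  obtain ⟨R, hR⟩ := (show IsCompact (tsupport T.ψ) from T.cs).isBounded.subset_ball 0
  rw [Real.ball_eq_Ioo] at hR
  have hg : GoodOn δ u ut 0 (max s t + 1) (0-R) (0+R) := partition H le_rfl fun r hr x _ => all_good H r hr.1 x
  exact hg T hR s ⟨hs, by linarith [le_max_left s t]⟩ t ⟨ht, by linarith [le_max_right s t]⟩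

end NL

namespace NL
open Set Topology

variable {q μ δ c : ℝ} {u ut ux uxx f : ℝ → ℝ → ℝ}

lemma cuts : ∃ X : ℝ, 0 ≤ X ∧ ∃ (V : ℕ → ℝ) (χ χ1 χ2 : ℕ → ℝ → ℝ), (∀ k, Cut X (V k) (χ k) (χ1 k) (χ2 k)) ∧
    ∀ x, ∀ᶠ k in atTop, χ k x = 1 ∧ χ1 k x = 0 ∧ χ2 k x = 0 := by
  let B : ContDiffBump (0:ℝ) := ⟨1, 2, by norm_num, by norm_num⟩
  have hcd : ContDiff ℝ 2 B := B.contDiff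
  have hC := C2.of_contDiff hcd
  have hcs : HasCompactSupport B := B.hasCompactSupport
  obtain ⟨B1, hB1⟩ := hC.c1.bounded_above_of_compact_support (hcs.mono' (fun x hx => by
    by_contra h'; exact hx (hC.z1 h')))
  obtain ⟨B2, hB2⟩ := hC.h3.bounded_above_of_compact_support (hcs.mono' (fun x hx => by
    by_contra h'; exact hx (hC.z2 h')))
  have hB1' : 0 ≤ B1 := (norm_nonneg _).trans (hB1 0)
  have hB2' : 0 ≤ B2 := (norm_nonneg _).trans (hB2 0)
  have hone : ∀ x, |x| < 1 → (B x = 1 ∧ deriv B x = 0 ∧ deriv (deriv B) x = 0) := by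
    have h1 : ∀ x, |x| < 1 → (B : ℝ → ℝ) =ᶠ[𝓝 x] fun _ => 1 := by
      intro x hx
      have : {y : ℝ | |y| < 1} ∈ 𝓝 x := (isOpen_lt continuous_abs continuous_const).mem_nhds hx
      filter_upwards [this] with y hy
      apply B.one_of_mem_closedBall
      simp only [Metric.mem_closedBall, dist_zero_right, Real.norm_eq_abs]
      exact hy.le
    have h2 : ∀ x, |x| < 1 → deriv B x = 0 := fun x hx => by rw [(h1 x hx).deriv_eq]; simp
    intro x hx
    refine ⟨(h1 x hx).self_of_nhds, h2 x hx, ?_⟩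
    have : deriv B =ᶠ[𝓝 x] fun _ => 0 := by
      have : {y : ℝ | |y| < 1} ∈ 𝓝 x := (isOpen_lt continuous_abs continuous_const).mem_nhds hx
      filter_upwards [this] with y hy using h2 y hy
    rw [this.deriv_eq]; simp
  refine ⟨max B1 B2, le_max_of_le_left hB1', fun k => ∫ x, (B (((k:ℝ)+1)⁻¹ * x))^2, fun k x => B (((k:ℝ)+1)⁻¹ * x),
    fun k x => ((k:ℝ)+1)⁻¹ * deriv B (((k:ℝ)+1)⁻¹ * x), fun k x => ((k:ℝ)+1)⁻¹ * (((k:ℝ)+1)⁻¹ * deriv (deriv B) (((k:ℝ)+1)⁻¹ * x)), ?_, ?_⟩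
  · intro k
    set a := ((k:ℝ)+1)⁻¹ with ha
    have ha0 : 0 < a := by positivity
    have ha1 : a ≤ 1 := inv_le_one_of_one_le₀ (by linarith [(Nat.cast_nonneg k : (0:ℝ) ≤ k)])
    have hd : ∀ {g g' : ℝ → ℝ}, (∀ x, HasDerivAt g (g' x) x) → ∀ x, HasDerivAt (fun x => g (a * x)) (a * g' (a*x)) x := by
      intro g g' hg x
      have := (hg (a*x)).comp x ((hasDerivAt_id x).const_mul a)
      refine this.congr_deriv (by ring)
    refine ⟨⟨hd hC.h1, fun x => (hd hC.h2 x).const_mul a, ?_⟩, ?_, ?_, ?_, ?_, le_rfl⟩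
    · have := hC.h3; fun_prop
    · exact hcs.comp_homeomorph (Homeomorph.mulLeft₀ a ha0.ne')
    · intro x; rw [abs_of_nonneg B.nonneg]; exact B.le_one
    · intro x; rw [abs_mul, abs_of_pos ha0]
      calc a * _ ≤ 1 * B1 := mul_le_mul ha1 (hB1 _) (abs_nonneg _) zero_le_one
        _ ≤ _ := by rw [one_mul]; exact le_max_left _ _
    · intro x; rw [abs_mul, abs_mul, abs_of_pos ha0]
      calc a * (a * _) ≤ 1 * (1 * B2) := mul_le_mul ha1 (mul_le_mul ha1 (hB2 _) (abs_nonneg _) zero_le_one) (by positivity) zero_le_one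
        _ ≤ _ := by rw [one_mul, one_mul]; exact le_max_right _ _
  · intro x
    obtain ⟨N, hN⟩ := exists_nat_gt |x|
    filter_upwards [eventually_ge_atTop N] with k hk
    have hk' : |x| < k + 1 := by have : (N:ℝ) ≤ k := Nat.cast_le.2 hk
                                 linarith
    have h1 : |((k:ℝ)+1)⁻¹ * x| < 1 := by
      rw [abs_mul, abs_of_pos (by positivity), inv_mul_lt_iff₀ (by positivity)]; linarith
    obtain ⟨e1, e2, e3⟩ := hone _ h1
    exact ⟨e1, by simp only [e2, mul_zero], by simp only [e3, mul_zero]⟩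

lemma fatou2 {s t D : ℝ} {F : ℝ → ℝ → ℝ} (mF : Measurable (Function.uncurry F)) (F0 : ∀ r x, 0 ≤ F r x)
    {χ : ℕ → ℝ → ℝ} (cχ : ∀ k, Continuous (χ k)) (hχ : ∀ x, ∀ᶠ k in atTop, χ k x = 1) {h : ℕ → ℝ → ℝ}
    (h1 : ∀ k, ∀ r ∈ Ioc s t, Integrable (fun x => (χ k x)^2 * F r x) ∧ ∫ x, (χ k x)^2 * F r x ≤ h k r)
    (h2 : ∀ k, IntegrableOn (h k) (Ioc s t)) (h3 : ∀ k, ∫ r in Ioc s t, h k r ≤ D) :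
    Integrable (Function.uncurry F) ((volume.restrict (Ioc s t)).prod volume) := by
  refine ⟨mF.aestronglyMeasurable, ?_⟩
  have hF0 : 0 ≤ᵐ[(volume.restrict (Ioc s t)).prod volume] Function.uncurry F := Eventually.of_forall fun z => F0 z.1 z.2
  rw [hasFiniteIntegral_iff_ofReal hF0]
  have mG : ∀ k, Measurable (fun z : ℝ × ℝ => ENNReal.ofReal ((χ k z.2)^2 * F z.1 z.2)) := by
    intro k
    have a := (cχ k).measurable
    have b : Measurable (fun z : ℝ × ℝ => F z.1 z.2) := mF
    fun_prop
  have e : ∀ z : ℝ × ℝ, ENNReal.ofReal (Function.uncurry F z) = 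
      liminf (fun k => ENNReal.ofReal ((χ k z.2)^2 * F z.1 z.2)) atTop := by
    intro z
    refine (Tendsto.liminf_eq (tendsto_const_nhds.congr' ?_)).symm
    filter_upwards [hχ z.2] with k hk
    rw [hk]; simp [Function.uncurry]
  simp only [e]
  refine (lintegral_liminf_le mG).trans_lt ?_
  refine lt_of_le_of_lt ?_ (ENNReal.ofReal_lt_top (r := D))
  refine liminf_le_of_le (h := ?_)
  intro b hb
  obtain ⟨k, hk⟩ := hb.exists
  refine hk.trans ?_
  rw [lintegral_prod _ (mG k).aemeasurable]
  have h4 : 0 ≤ᵐ[volume.restrict (Ioc s t)] h k := by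
    filter_upwards [ae_restrict_mem measurableSet_Ioc] with r hr
    exact (integral_nonneg fun x => mul_nonneg (sq_nonneg _) (F0 r x)).trans (h1 k r hr).2
  calc _ ≤ ∫⁻ r in Ioc s t, ENNReal.ofReal (h k r) := by
        refine lintegral_mono_ae ?_
        filter_upwards [ae_restrict_mem measurableSet_Ioc] with r hr
        rw [← ofReal_integral_eq_lintegral_ofReal (h1 k r hr).1 (Eventually.of_forall fun x => mul_nonneg (sq_nonneg _) (F0 r x))]
        exact ENNReal.ofReal_le_ofReal (h1 k r hr).2
    _ = ENNReal.ofReal (∫ r in Ioc s t, h k r) := (ofReal_integral_eq_lintegral_ofReal (h2 k) h4).symm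
    _ ≤ _ := ENNReal.ofReal_le_ofReal (h3 k)

lemma F1 (H : Sys q μ δ c u ut ux uxx f) {s t : ℝ} (hs : 0 < s) (hst : s < t) :
    Integrable (Function.uncurry fun r x => rho δ (u r x) * (ux r x)^2) ((volume.restrict (Ioc s t)).prod volume) ∧ 
    Integrable (Function.uncurry fun r x => (u r x)^4 * rho δ (u r x)) ((volume.restrict (Ioc s t)).prod volume) := by
  have hδ := H.hδ; have hμ := H.hμ
  obtain ⟨X, hX, V, χ, χ1, χ2, hcut, hlim⟩ := cuts
  obtain ⟨C0, hC0, hL1⟩ := H.l1bound (s := s) (t := t) hs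
  obtain ⟨C, hC, hE⟩ := energyY H C0 X hC0 hX
  have ht := hs.trans hst
  have hρ := (rho_cont δ).measurable
  have mU : Measurable (fun z : ℝ × ℝ => u z.1 z.2) := H.mU
  have mUx : Measurable (fun z : ℝ × ℝ => ux z.1 z.2) := H.mUx
  set D := 2/μ * (1/δ * C0 + C * (t-s)) with hD
  have hY : ∀ k, IntervalIntegrable (fun r => YY δ (χ k) (u r) (ux r)) volume s t ∧
      ∫ r in s..t, YY δ (χ k) (u r) (ux r) ≤ D := by
    intro k
    have h := hcut k
    obtain ⟨h1, h2⟩ := hE (V k) _ _ _ h s t hs hst hL1 (fun a ha b hb => all_idd H _ (hs.trans ha.1) (hs.trans hb.1))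
    refine ⟨h1, ?_⟩
    have h3 : 0 ≤ (tE H.hδ h).m u t := integral_nonneg fun x => mul_nonneg (sq_nonneg (χ k x)) (b0_nonneg δ _)
    have h4 : (tE H.hδ h).m u s ≤ 1/δ * C0 := by
      have h5 : (tE H.hδ h).m u s ≤ 1/δ * ∫ x, |u s x| := by
        rw [← integral_const_mul]
        refine integral_mono ((tE H.hδ h).int_m H hs) ((H.iu s hs).abs.const_mul _) (fun x => ?_)
        change (χ k x)^2 * b0 δ (u s x - 0) ≤ 1/δ * |u s x|
        rw [sub_zero]
        have := mul_le_mul (h.sq1 x) (b0_le hδ (u s x)) (b0_nonneg δ _) zero_le_one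
        linarith
      have := mul_le_mul_of_nonneg_left (hL1 s ⟨le_rfl, hst.le⟩).1 (show 0 ≤ 1/δ by positivity)
      linarith
    have h6 : μ/2 * ∫ r in s..t, YY δ (χ k) (u r) (ux r) ≤ 1/δ * C0 + C * (t-s) := by linarith
    have h7 := mul_le_mul_of_nonneg_left h6 (show 0 ≤ 2/μ by positivity)
    have e : 2/μ * (μ/2 * ∫ r in s..t, YY δ (χ k) (u r) (ux r)) = ∫ r in s..t, YY δ (χ k) (u r) (ux r) := by field_simp
    rw [hD]; linarith
  have hYI : ∀ k, IntegrableOn (fun r => YY δ (χ k) (u r) (ux r)) (Ioc s t) := fun k =>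
    (intervalIntegrable_iff_integrableOn_Ioc_of_le hst.le).1 (hY k).1
  constructor
  · refine fatou2 (χ := χ) (h := fun k r => YY δ (χ k) (u r) (ux r)) (D := D) ?_ ?_ (fun k => (hcut k).c2.c0)
      (fun x => (hlim x).mono fun k hk => hk.1) ?_ hYI ?_
    · change Measurable (fun z : ℝ × ℝ => rho δ (u z.1 z.2) * (ux z.1 z.2)^2)
      fun_prop
    · exact fun r x => mul_nonneg (rho_pos _ _).le (sq_nonneg _)
    · intro k r hr
      exact ⟨YY_int (hcut k) (H.dx r (hs.trans hr.1)), le_rfl⟩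
    · intro k; rw [← intervalIntegral.integral_of_le hst.le]; exact (hY k).2
  · set Q := 8 * ((1 + C0)/2 + X * C0)^2 * C0 with hQ
    have hQ0 : 0 ≤ Q := by positivity
    have i1 : ∀ k, IntegrableOn (fun r => YY δ (χ k) (u r) (ux r) + 1) (Ioc s t) := fun k =>
      (hYI k).add (integrableOn_const (by simp))
    refine fatou2 (χ := χ) (h := fun k r => Q * (YY δ (χ k) (u r) (ux r) + 1)) (D := Q * (D + (t-s))) ?_ ?_ (fun k => (hcut k).c2.c0)
      (fun x => (hlim x).mono fun k hk => hk.1) ?_ ?_ ?_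
    · change Measurable (fun z : ℝ × ℝ => (u z.1 z.2)^4 * rho δ (u z.1 z.2))
      fun_prop
    · exact fun r x => mul_nonneg (by positivity) (rho_pos _ _).le
    · intro k r hr
      have hr0 := hs.trans hr.1
      exact ⟨ZZ_int (hcut k) (H.dx r hr0), ZZ_le hδ (hcut k) (H.dx r hr0) (H.iu r hr0) (hL1 r (Ioc_subset_Icc_self hr)).1⟩
    · exact fun k => (i1 k).const_mul Q
    · intro k
      rw [integral_const_mul, integral_add (hYI k) (integrableOn_const (by simp)), ← intervalIntegral.integral_of_le hst.le]
      have := (hY k).2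
      simp only [integral_const, MeasurableSet.univ, measureReal_restrict_apply, univ_inter, Real.volume_real_Ioc_of_le hst.le, smul_eq_mul, mul_one]
      exact mul_le_mul_of_nonneg_left (by linarith) hQ0

end NL

namespace NL
open Set Topology

variable {q μ δ c : ℝ} {u ut ux uxx f : ℝ → ℝ → ℝ}

lemma sq_le_rho (hδ : 0 < δ) (hδ1 : δ < 1) (r : ℝ) : r^2 ≤ |r| + 4 * (r^4 * rho δ r) := by
  have hp := rho_pos δ r
  rcases le_total |r| 1 with h | h
  · have : r^2 ≤ |r| := by rw [← sq_abs]; nlinarith [abs_nonneg r]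
    have : 0 ≤ r^4 * rho δ r := by positivity
    linarith
  · have h1 : (1+|r|)^2 * rho δ r ≥ 1 := by
      have : rho δ r ≥ (1+|r|)^(-2:ℝ) := Real.rpow_le_rpow_of_exponent_le (by linarith) (by linarith)
      have e : (1+|r|)^2 * (1+|r|)^(-2:ℝ) = 1 := by
        rw [Real.rpow_neg (by linarith), Real.rpow_two]; field_simp
      have := mul_le_mul_of_nonneg_left this (sq_nonneg (1+|r|))
      linarith
    have h2 : (1+|r|)^2 ≤ 4 * r^2 := by rw [← sq_abs r]; nlinarith
    have h3 : 1 ≤ 4 * r^2 * rho δ r := h1.le.trans (mul_le_mul_of_nonneg_right h2 hp.le)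
    have h4 := mul_le_mul_of_nonneg_left h3 (sq_nonneg r)
    have := abs_nonneg r
    nlinarith

lemma Sys.l1prod (H : Sys q μ δ c u ut ux uxx f) {s t : ℝ} (hs : 0 < s) :
    Integrable (Function.uncurry u) ((volume.restrict (Ioc s t)).prod volume) ∧
    Integrable (Function.uncurry f) ((volume.restrict (Ioc s t)).prod volume) := by
  obtain ⟨C0, hC0, hL1⟩ := H.l1bound (s := s) (t := t) hs
  have key : ∀ g : ℝ → ℝ → ℝ, Measurable (Function.uncurry g) → (∀ r > 0, Integrable (g r)) →
      (∀ r ∈ Icc s t, ∫ x, |g r x| ≤ C0) → Integrable (Function.uncurry g) ((volume.restrict (Ioc s t)).prod volume) := by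
    intro g mg ig bg
    rw [integrable_prod_iff mg.aestronglyMeasurable]
    constructor
    · filter_upwards [ae_restrict_mem measurableSet_Ioc] with r hr using ig r (hs.trans hr.1)
    · refine Integrable.mono' (g := fun _ => C0) (integrableOn_const (by simp)) ?_ ?_
      · exact (mg.norm.stronglyMeasurable.integral_prod_right').aestronglyMeasurable
      · filter_upwards [ae_restrict_mem measurableSet_Ioc] with r hr
        rw [Real.norm_of_nonneg (integral_nonneg fun _ => norm_nonneg _)]
        exact bg r (Ioc_subset_Icc_self hr)
  exact ⟨key u H.mU H.iu fun r hr => (hL1 r hr).1, key f H.mf H.iff fun r hr => (hL1 r hr).2⟩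

lemma conv_zero {δ L M q : ℝ} {S S1 S2 w p pp : ℝ → ℝ} (hq : 1 < q) (hq2 : q < 2) (hS : SF δ L M S S1 S2) (hw : C2 w p pp)
    (iw : Integrable w) (iw2 : Integrable (fun x => (w x)^2))
    (hi : Integrable (fun x => S1 (w x) * (|w x|^(q-1) * p x))) :
    ∫ x, S1 (w x) * (|w x|^(q-1) * p x) = 0 := by
  have hL := hS.L0
  have cg : Continuous (fun z : ℝ => S1 z * |z|^(q-1)) :=
    hS.toC2.c1.mul (continuous_abs.rpow_const (fun x => Or.inr (by linarith)))
  set Ψ : ℝ → ℝ := fun r => ∫ z in (0:ℝ)..r, S1 z * |z|^(q-1) with hΨ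
  have dΨ : ∀ r, HasDerivAt Ψ (S1 r * |r|^(q-1)) r := fun r =>
    intervalIntegral.integral_hasDerivAt_right (cg.intervalIntegrable _ _) (cg.stronglyMeasurableAtFilter _ _) cg.continuousAt
  have bΨ : ∀ r, |Ψ r| ≤ L * (|r| + r^2) := by
    intro r
    have h1 : ‖Ψ r‖ ≤ L * |r|^(q-1) * |r - 0| := by
      refine intervalIntegral.norm_integral_le_of_norm_le_const fun z hz => ?_
      have hz' : |z| ≤ |r| := by
        have := Set.uIoc_subset_uIcc hz
        have := abs_sub_left_of_mem_uIcc this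
        simpa using this
      rw [norm_mul, Real.norm_eq_abs, Real.norm_of_nonneg (by positivity)]
      exact mul_le_mul (hS.b1 z) (Real.rpow_le_rpow (abs_nonneg _) hz' (by linarith)) (by positivity) hL
    rw [sub_zero, mul_assoc] at h1
    refine h1.trans (mul_le_mul_of_nonneg_left ?_ hL)
    have h2 : |r|^(q-1) ≤ 1 + |r| := by
      rcases le_total |r| 1 with h | h
      · have := Real.rpow_le_one (abs_nonneg r) h (show 0 ≤ q-1 by linarith)
        have := abs_nonneg r; linarith
      · have := Real.rpow_le_rpow_of_exponent_le h (show q-1 ≤ 1 by linarith)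
        rw [Real.rpow_one] at this; linarith
    have := mul_le_mul_of_nonneg_right h2 (abs_nonneg r)
    rw [← sq_abs r]; linarith
  have d : ∀ x, HasDerivAt (fun x => Ψ (w x)) (S1 (w x) * (|w x|^(q-1) * p x)) x := fun x => by
    refine ((dΨ (w x)).comp x (hw.h1 x)).congr_deriv (by ring)
  refine integral_eq_zero_of_hasDerivAt_of_integrable d hi ?_
  have cΨ : Continuous (fun x => Ψ (w x)) := continuous_iff_continuousAt.2 fun x => (d x).continuousAt
  refine ((iw.abs.add iw2).const_mul L).mono' cΨ.aestronglyMeasurable (Eventually.of_forall fun x => ?_)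
  exact bΨ (w x)

lemma F2 (H : Sys q μ δ c u ut ux uxx f) {L M : ℝ} {S S1 S2 : ℝ → ℝ} (hS : SF δ L M S S1 S2) (hz : S1 0 = 0)
    {s t : ℝ} (hs : 0 < s) (hst : s < t) :
    Integrable (Function.uncurry fun r x => S1 (u r x) * f r x) ((volume.restrict (Ioc s t)).prod volume) ∧
    Integrable (Function.uncurry fun r x => S2 (u r x) * (ux r x)^2) ((volume.restrict (Ioc s t)).prod volume) ∧
    (∫ x, S (u t x)) - (∫ x, S (u s x)) = (∫ r in Ioc s t, ∫ x, S1 (u r x) * f r x) -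
      μ * ∫ r in Ioc s t, ∫ x, S2 (u r x) * (ux r x)^2 := by
  have hδ := H.hδ; have hμ := H.hμ; have hq := H.hq
  have hq2 : q < 2 := by linarith [H.hqδ]
  have hL0 := hS.L0
  have ht := hs.trans hst
  set ν := ((volume.restrict (Ioc s t)).prod volume : Measure (ℝ × ℝ)) with hν
  obtain ⟨iY, iZ⟩ := F1 H hs hst
  obtain ⟨iU, iF⟩ := H.l1prod (t := t) hs
  rw [← hν] at iY iZ iU iF
  have mU : Measurable (fun z : ℝ × ℝ => u z.1 z.2) := H.mU
  have mUx : Measurable (fun z : ℝ × ℝ => ux z.1 z.2) := H.mUx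
  have mf : Measurable (fun z : ℝ × ℝ => f z.1 z.2) := H.mf
  have mS := hS.toC2.c0.measurable; have mS1 := hS.toC2.c1.measurable; have mS2 := hS.h3.measurable
  have hM : ∀ r, |S2 r| ≤ |M| * rho δ r := fun r => (hS.b2 r).trans (mul_le_mul_of_nonneg_right (le_abs_self _) (rho_pos _ _).le)
  have hS1 : ∀ r, |S1 r| ≤ |M| * |r| := by
    intro r
    have := Convex.norm_image_sub_le_of_norm_hasDerivWithin_le (f := S1) (f' := S2) (s := univ) (C := |M|)
      (x := 0) (y := r) (fun x _ => (hS.h2 x).hasDerivWithinAt) (fun x _ => (hM x).trans (by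
        have := mul_le_mul_of_nonneg_left (rho_le_one hδ x) (abs_nonneg M); linarith)) convex_univ
      (mem_univ _) (mem_univ _)
    simpa [hz] using this
  have iD1 : Integrable (fun z : ℝ × ℝ => S1 (u z.1 z.2) * (|u z.1 z.2|^(q-1) * ux z.1 z.2)) ν := by
    obtain ⟨C, hC, hI⟩ := I2 hδ H.hδ1 hq H.hqδ (κ := 1) one_pos (L := L + |M| + 1) (by positivity)
    refine ((iY.add iZ).add (iU.abs.const_mul C)).mono' (by fun_prop) (Eventually.of_forall fun z => ?_)
    have h1 := hI (u z.1 z.2) (ux z.1 z.2) (S1 (u z.1 z.2)) ((hS.b1 _).trans (by linarith [abs_nonneg M]))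
      ((hS1 _).trans (mul_le_mul_of_nonneg_right (by linarith) (abs_nonneg _)))
    rw [Real.norm_eq_abs, abs_mul, abs_mul, abs_of_nonneg (show 0 ≤ |u z.1 z.2|^(q-1) by positivity)]
    simp only [Pi.add_apply, Function.uncurry] at h1 ⊢
    linarith
  have iD2 : Integrable (fun z : ℝ × ℝ => S1 (u z.1 z.2) * f z.1 z.2) ν := by
    refine (iF.abs.const_mul L).mono' (by fun_prop) (Eventually.of_forall fun z => ?_)
    rw [Real.norm_eq_abs, abs_mul]
    exact mul_le_mul_of_nonneg_right (hS.b1 _) (abs_nonneg _)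
  have iD3 : Integrable (fun z : ℝ × ℝ => S2 (u z.1 z.2) * (ux z.1 z.2)^2) ν := by
    refine (iY.const_mul |M|).mono' (by fun_prop) (Eventually.of_forall fun z => ?_)
    rw [Real.norm_eq_abs, abs_mul, abs_of_nonneg (sq_nonneg (ux z.1 z.2))]
    have := mul_le_mul_of_nonneg_right (hM (u z.1 z.2)) (sq_nonneg (ux z.1 z.2))
    simp only [Function.uncurry]; linarith
  have iD4 : Integrable (fun z : ℝ × ℝ => S (u z.1 z.2)) ν := by
    refine (iU.abs.const_mul L).mono' (mS.comp mU).aestronglyMeasurable (Eventually.of_forall fun z => ?_)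
    exact hS.b0 _
  refine ⟨iD2, iD3, ?_⟩
  obtain ⟨X, hX, V, χ, χ1, χ2, hcut, hlim⟩ := cuts
  set D : ℝ × ℝ → ℝ := fun z => -(S1 (u z.1 z.2) * (|u z.1 z.2|^(q-1) * ux z.1 z.2)) + S1 (u z.1 z.2) * f z.1 z.2
      - μ * (S2 (u z.1 z.2) * (ux z.1 z.2)^2) with hD
  have iD : Integrable D ν := ((iD1.neg.add iD2).sub (iD3.const_mul μ))
  set G : ℕ → ℝ × ℝ → ℝ := fun k z => (χ k z.2)^2 * D z +
    μ * ((2 * (χ1 k z.2)^2 + 2 * χ k z.2 * χ2 k z.2) * S (u z.1 z.2)) with hG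
  have bG : ∀ k z, ‖G k z‖ ≤ |D z| + μ * ((2*X^2+2*X) * |S (u z.1 z.2)|) := by
    intro k z
    refine (norm_add_le _ _).trans (add_le_add ?_ ?_)
    · rw [norm_mul, Real.norm_of_nonneg (sq_nonneg _), Real.norm_eq_abs]
      have := mul_le_mul_of_nonneg_right ((hcut k).sq1 z.2) (abs_nonneg (D z)); linarith
    · rw [norm_mul, Real.norm_of_nonneg hμ.le, norm_mul]
      exact mul_le_mul_of_nonneg_left (mul_le_mul_of_nonneg_right ((hcut k).p2 _) (abs_nonneg _)) hμ.le
  have iB : Integrable (fun z => |D z| + μ * ((2*X^2+2*X) * |S (u z.1 z.2)|)) ν := iD.abs.add ((iD4.abs.const_mul _).const_mul _)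
  have mG : ∀ k, AEStronglyMeasurable (G k) ν := by
    intro k
    have a := (hcut k).c2.c0.measurable; have b := (hcut k).c2.c1.measurable; have c := (hcut k).c2.h3.measurable
    fun_prop
  have iG : ∀ k, Integrable (G k) ν := fun k => iB.mono' (mG k) (Eventually.of_forall (bG k))
  have lim1 : Tendsto (fun k => ∫ z, G k z ∂ν) atTop (𝓝 (∫ z, D z ∂ν)) := by
    refine tendsto_integral_of_dominated_convergence _ mG iB (fun k => Eventually.of_forall (bG k)) (Eventually.of_forall fun z => ?_)
    refine tendsto_const_nhds.congr' ?_
    filter_upwards [hlim z.2] with k hk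
    simp [hG, hk.1, hk.2.1, hk.2.2]
  have lim2 : ∀ r > 0, Tendsto (fun k => ∫ x, (χ k x)^2 * S (u r x)) atTop (𝓝 (∫ x, S (u r x))) := by
    intro r hr
    have cu := (H.dx r hr).c0; have cS := hS.toC2.c0
    refine tendsto_integral_of_dominated_convergence (fun x => L * |u r x|) (fun k => ?_) ((H.iu r hr).abs.const_mul L) (fun k => Eventually.of_forall fun x => ?_) (Eventually.of_forall fun x => ?_)
    · have := (hcut k).c2.c0
      exact Continuous.aestronglyMeasurable (by fun_prop)
    · rw [norm_mul, Real.norm_of_nonneg (sq_nonneg _), Real.norm_eq_abs]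
      have := mul_le_mul ((hcut k).sq1 x) (hS.b0 (u r x)) (abs_nonneg _) zero_le_one; linarith
    · refine tendsto_const_nhds.congr' ?_
      filter_upwards [hlim x] with k hk
      simp [hk.1]
  have main : ∀ k, ∫ z, G k z ∂ν = (∫ x, (χ k x)^2 * S (u t x)) - ∫ x, (χ k x)^2 * S (u s x) := by
    intro k
    have hk := hcut k
    have hcs : HasCompactSupport (fun x => (χ k x)^2) := hk.cs.comp_left (g := fun r => r^2) (by simp)
    let T : TT δ := ⟨_, _, _, S, S1, S2, fun _ => 0, fun _ => 0, fun _ => 0, L, M, hk.c2.sq, hcs, hS, C2.zero, integrable_zero _ _ _⟩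
    have hT := (all_idd H T hs ht).2
    have e1 : ∀ r, T.m u r = ∫ x, (χ k x)^2 * S (u r x) := fun r => by simp [TT.m, T]
    rw [e1, e1, intervalIntegral.integral_of_le hst.le] at hT
    rw [← hT, hν, integral_prod _ (iG k)]
    refine setIntegral_congr_fun measurableSet_Ioc fun r hr => ?_
    have hr0 := hs.trans hr.1
    have hw := H.dx r hr0
    have cu := hw.c0; have cu1 := hw.c1; have cS := hS.toC2.c0; have cS1 := hS.toC2.c1; have cS2 := hS.h3
    have cχ := hk.c2.c0; have cχ1 := hk.c2.c1; have cχ2 := hk.c2.h3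
    have ca : Continuous fun x => |u r x|^(q-1) := cu.abs.rpow_const (fun x => Or.inr (by linarith))
    have e2 : T.g u ut r = ∫ x, (χ k x)^2 * S1 (u r x) * ut r x := by simp [TT.g, T]
    change ∫ x, G k (r, x) = T.g u ut r
    rw [e2]
    simp only [H.eq r hr0]
    rw [(split (μ := μ) hq (σ := fun x => S1 (u r x)) hk.c2.sq.c0 hcs (by fun_prop) hw (H.iff r hr0)).2]
    have e3 := ibp hk.c2.sq hcs hw C2.zero hS.toC2
    simp only [sub_zero, mul_zero, integral_zero, add_zero] at e3
    rw [e3]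
    have j1 : Integrable (fun x => (χ k x)^2 * S1 (u r x) * (|u r x|^(q-1) * ux r x)) :=
      ics hcs (by fun_prop) (fun x hx => by simp only [C2.z0 hx, zero_mul])
    have j2 : Integrable (fun x => (χ k x)^2 * S1 (u r x) * f r x) :=
      ics2 hcs (by fun_prop) (fun x hx => by simp only [C2.z0 hx, zero_mul]) (H.iff r hr0)
    have j3 : Integrable (fun x => (χ k x)^2 * (S2 (u r x) * (ux r x)^2)) :=
      ics hcs (by fun_prop) (fun x hx => by simp only [C2.z0 hx, zero_mul])
    have j4 : Integrable (fun x => (2 * (χ1 k x)^2 + 2 * χ k x * χ2 k x) * S (u r x)) :=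
      ics hk.cs (by fun_prop) (fun x hx => by simp [C2.z0 hx, hk.c2.z1 hx])
    have j1' := j1.fun_neg
    have j43 : Integrable (fun x => μ * ((2 * (χ1 k x)^2 + 2 * χ k x * χ2 k x) * S (u r x) - (χ k x)^2 * (S2 (u r x) * (ux r x)^2))) :=
      (j4.sub j3).const_mul μ
    rw [← integral_neg, ← integral_sub j4 j3, ← integral_const_mul, ← integral_add j1' j43,
      ← integral_add (j1'.fun_add j43) j2]
    refine integral_congr_ae (Eventually.of_forall fun x => ?_)
    simp only [hG, hD, Pi.add_apply, Pi.neg_apply, Pi.sub_apply]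
    ring
  have fin : ∫ z, D z ∂ν = (∫ x, S (u t x)) - ∫ x, S (u s x) :=
    tendsto_nhds_unique lim1 (((lim2 t ht).sub (lim2 s hs)).congr fun k => (main k).symm)
  rw [← fin]
  have z1 : ∫ z, S1 (u z.1 z.2) * (|u z.1 z.2|^(q-1) * ux z.1 z.2) ∂ν = 0 := by
    rw [hν, integral_prod _ iD1]
    refine integral_eq_zero_of_ae ?_
    filter_upwards [ae_restrict_mem measurableSet_Ioc, iD1.prod_right_ae, iZ.prod_right_ae] with r hr h1 h2
    have hr0 := hs.trans hr.1
    refine conv_zero hq hq2 hS (H.dx r hr0) (H.iu r hr0) ?_ h1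
    have cu := (H.dx r hr0).c0
    refine ((H.iu r hr0).abs.add (h2.const_mul 4)).mono' (Continuous.aestronglyMeasurable (by fun_prop)) (Eventually.of_forall fun x => ?_)
    rw [Real.norm_of_nonneg (sq_nonneg _)]
    exact sq_le_rho hδ H.hδ1 _
  have z2 : ∫ z, D z ∂ν = -(∫ z, S1 (u z.1 z.2) * (|u z.1 z.2|^(q-1) * ux z.1 z.2) ∂ν) + (∫ z, S1 (u z.1 z.2) * f z.1 z.2 ∂ν)
      - μ * ∫ z, S2 (u z.1 z.2) * (ux z.1 z.2)^2 ∂ν := by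
    have j1' := iD1.fun_neg
    rw [← integral_neg, ← integral_const_mul, ← integral_add j1' iD2, ← integral_sub (j1'.fun_add iD2) (iD3.const_mul μ)]
  rw [z2, z1, hν, integral_prod _ iD2, integral_prod _ iD3]
  simp

/-- at almost every time the solution is square integrable -/
lemma L2ae (H : Sys q μ δ c u ut ux uxx f) {s : ℝ} (hs : 0 < s) : ∃ r, 0 < r ∧ r < s ∧ Integrable (fun x => (u r x)^2) := by
  have hs2 : 0 < s/2 := by positivity
  have hs3 : s/2 < s := by linarith
  obtain ⟨iY, iZ⟩ := F1 H hs2 hs3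
  have h1 : ∀ᵐ r ∂(volume.restrict (Ioo (s/2) s)), Integrable (fun x => (u r x)^2) := by
    have h3 := ae_restrict_of_ae_restrict_of_subset (Ioo_subset_Ioc_self) iZ.prod_right_ae
    filter_upwards [h3, ae_restrict_mem measurableSet_Ioo] with r h2 hr
    have hr0 := hs2.trans hr.1
    have cu := (H.dx r hr0).c0
    refine ((H.iu r hr0).abs.add (h2.const_mul 4)).mono' (Continuous.aestronglyMeasurable (by fun_prop)) (Eventually.of_forall fun x => ?_)
    rw [Real.norm_of_nonneg (sq_nonneg _)]
    exact sq_le_rho H.hδ H.hδ1 _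
  have h2 := h1.and (ae_restrict_mem measurableSet_Ioo)
  have : NeBot (ae (volume.restrict (Ioo (s/2) s))) := by
    rw [ae_neBot]; intro h
    have := congrArg (fun m => m univ) h
    simp at this; linarith
  obtain ⟨r, hr, hr'⟩ := h2.exists
  exact ⟨r, hs2.trans hr'.1, hr'.2, hr⟩

end NL

namespace NL
open Set Topology

variable {q μ δ c : ℝ} {u ut ux uxx f : ℝ → ℝ → ℝ}

/-- convolution kernels -/
structure Ker (K : ℝ → ℝ) : Prop where
  m : Measurable K
  pos : ∀ x, 0 ≤ K x
  even : ∀ x, K (-x) = K x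
  int : Integrable K
  mass : ∫ x, K x = 1

lemma Ker.pint {K w : ℝ → ℝ} (hK : Ker K) (iw : Integrable w) :
    Integrable (fun z : ℝ × ℝ => K (z.1 - z.2) * w z.2) (volume.prod volume) := by
  have := Integrable.convolution_integrand (L := ContinuousLinearMap.mul ℝ ℝ) (μ := volume) (ν := volume) (f := w) (g := K) iw hK.int
  refine this.congr (Eventually.of_forall fun z => ?_)
  simp [mul_comm]

lemma Ker.sym {K w σ : ℝ → ℝ} {Λ L : ℝ} (hK : Ker K) (iw : Integrable w) (mw : Measurable w) (mσ : Measurable σ) (hσ : ∀ x, |σ x| ≤ L) :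
    Integrable (fun z : ℝ × ℝ => K (z.1 - z.2) * ((σ z.1 - σ z.2) * (w z.1 - w z.2))) (volume.prod volume) ∧
    ∫ x, σ x * (Λ * ((∫ y, K (x - y) * w y) - w x)) =
      -(Λ/2) * ∫ z : ℝ × ℝ, K (z.1 - z.2) * ((σ z.1 - σ z.2) * (w z.1 - w z.2)) ∂(volume.prod volume) := by
  have i1 := hK.pint iw
  have i2 : Integrable (fun z : ℝ × ℝ => K (z.1 - z.2) * w z.1) (volume.prod volume) := by
    refine i1.swap.congr (Eventually.of_forall fun z => ?_)
    simp only [Function.comp, Prod.fst_swap, Prod.snd_swap]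
    rw [← hK.even, neg_sub]
  have mK := hK.m
  have b : ∀ {g : ℝ × ℝ → ℝ}, Integrable g (volume.prod volume) → Integrable (fun z : ℝ × ℝ => σ z.1 * g z) (volume.prod volume) := by
    intro g hg
    exact hg.bdd_mul (c := L) (mσ.comp measurable_fst).aestronglyMeasurable (Eventually.of_forall fun z => hσ z.1)
  have iA : Integrable (fun z : ℝ × ℝ => σ z.1 * (K (z.1 - z.2) * w z.2 - K (z.1 - z.2) * w z.1)) (volume.prod volume) := b (i1.sub i2)
  have iB := iA.swap
  have e : ∀ z : ℝ × ℝ, K (z.1 - z.2) * ((σ z.1 - σ z.2) * (w z.1 - w z.2)) =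
      -((σ z.1 * (K (z.1 - z.2) * w z.2 - K (z.1 - z.2) * w z.1)) + ((fun z : ℝ × ℝ => σ z.1 * (K (z.1 - z.2) * w z.2 - K (z.1 - z.2) * w z.1)) ∘ Prod.swap) z) := by
    intro z
    simp only [Function.comp, Prod.fst_swap, Prod.snd_swap]
    rw [← hK.even (z.2 - z.1), neg_sub]; ring
  have sw : ∫ z, ((fun z : ℝ × ℝ => σ z.1 * (K (z.1 - z.2) * w z.2 - K (z.1 - z.2) * w z.1)) ∘ Prod.swap) z ∂(volume.prod volume)
     = ∫ z, (fun z : ℝ × ℝ => σ z.1 * (K (z.1 - z.2) * w z.2 - K (z.1 - z.2) * w z.1)) z ∂(volume.prod volume) := 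
    integral_prod_swap (μ := volume) (ν := volume) (fun z : ℝ × ℝ => σ z.1 * (K (z.1 - z.2) * w z.2 - K (z.1 - z.2) * w z.1))
  simp only [e]
  refine ⟨(iA.add iB).neg, ?_⟩
  rw [integral_neg, integral_add iA iB, sw, integral_prod _ iA]
  have h : ∀ᵐ x, σ x * (Λ * ((∫ y, K (x - y) * w y) - w x)) = Λ * ∫ y, σ x * (K (x - y) * w y - K (x - y) * w x) := by
    filter_upwards [i1.prod_right_ae, i2.prod_right_ae] with x h1 h2
    rw [integral_const_mul, integral_sub h1 h2, integral_mul_const, integral_sub_left_eq_self K volume x, hK.mass]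
    ring
  rw [integral_congr_ae h, integral_const_mul]
  ring

lemma lint_tendsto {α : Type*} [MeasurableSpace α] {m : Measure α} {F : ℕ → α → ℝ≥0∞} {G : α → ℝ≥0∞} (mF : ∀ n, Measurable (F n))
    (hle : ∀ n a, F n a ≤ G a) (hlim : ∀ a, Tendsto (fun n => F n a) atTop (𝓝 (G a))) :
    Tendsto (fun n => ∫⁻ a, F n a ∂m) atTop (𝓝 (∫⁻ a, G a ∂m)) := by
  refine tendsto_of_le_liminf_of_limsup_le ?_ ?_
  · have : ∀ a, G a = liminf (fun n => F n a) atTop := fun a => (hlim a).liminf_eq.symm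
    simp only [this]
    exact lintegral_liminf_le mF
  · refine limsup_le_of_le (h := Eventually.of_forall fun n => lintegral_mono (hle n))

lemma SF.smul {δ L M k : ℝ} {S S1 S2 : ℝ → ℝ} (h : SF δ L M S S1 S2) (hk : 0 ≤ k) :
    SF δ (k*L) (k*M) (fun r => k * S r) (fun r => k * S1 r) (fun r => k * S2 r) := by
  refine ⟨fun r => (h.h1 r).const_mul k, fun r => (h.h2 r).const_mul k, h.h3.const_mul k, by simp [h.z0], fun r => ?_, fun r => ?_⟩
  · rw [abs_mul, abs_of_nonneg hk]; exact mul_le_mul_of_nonneg_left (h.b1 r) hk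
  · rw [abs_mul, abs_of_nonneg hk, mul_assoc]; exact mul_le_mul_of_nonneg_left (h.b2 r) hk

lemma b0_upper (hδ : 0 < δ) (r : ℝ) : b0 δ r ≤ r^2/2 := by
  wlog h : 0 ≤ r
  · have := this (δ := δ) hδ (-r) (by linarith); rwa [b0_neg, neg_sq] at this
  have h1 : b0 δ r ≤ ∫ z in (0:ℝ)..r, z := by
    refine intervalIntegral.integral_mono_on h ((b1_cont δ).intervalIntegrable _ _) (continuous_id.intervalIntegrable _ _) fun z hz => ?_
    have := abs_b1_le' hδ z
    rw [abs_of_nonneg hz.1] at this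
    exact (le_abs_self _).trans this
  simpa using h1

lemma b0_lower (hδ : 0 < δ) (r : ℝ) : rho δ r * r^2/2 ≤ b0 δ r := by
  wlog h : 0 ≤ r
  · have := this (δ := δ) hδ (-r) (by linarith); rwa [b0_neg, neg_sq, rho_neg] at this
  have h0 : ∀ z ∈ Icc 0 r, rho δ r * z ≤ b1 δ z := by
    intro z hz
    have : ∫ y in (0:ℝ)..z, rho δ r ≤ b1 δ z := by
      refine intervalIntegral.integral_mono_on hz.1 intervalIntegrable_const ((rho_cont δ).intervalIntegrable _ _) fun y hy => ?_
      refine rho_anti hδ ?_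
      rw [abs_of_nonneg hy.1, abs_of_nonneg h]; exact hy.2.trans hz.2
    simp at this; linarith
  have h1 : ∫ z in (0:ℝ)..r, rho δ r * z ≤ b0 δ r :=
    intervalIntegral.integral_mono_on h ((continuous_const.mul continuous_id).intervalIntegrable _ _) ((b1_cont δ).intervalIntegrable _ _) h0
  rw [intervalIntegral.integral_const_mul, integral_id] at h1; linarith

lemma b1_lip (hδ : 0 < δ) (a b : ℝ) : |b1 δ a - b1 δ b| ≤ |a - b| := by
  have := Convex.norm_image_sub_le_of_norm_hasDerivWithin_le (f := b1 δ) (f' := rho δ) (s := univ) (C := 1)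
    (x := b) (y := a) (fun x _ => (b1_deriv δ x).hasDerivWithinAt) (fun x _ => by
      rw [Real.norm_of_nonneg (rho_pos _ _).le]; exact rho_le_one hδ x) convex_univ
    (mem_univ _) (mem_univ _)
  simpa using this

lemma tend_k : Tendsto (fun n : ℕ => ((n:ℝ)+1)⁻¹) atTop (𝓝 0) := by
  simpa using tendsto_one_div_add_atTop_nhds_zero_nat (𝕜 := ℝ)

lemma rho_zero (δ : ℝ) : rho δ 0 = 1 := by simp [rho]

lemma lim_rho (δ r : ℝ) : Tendsto (fun n : ℕ => rho δ (((n:ℝ)+1)⁻¹ * r)) atTop (𝓝 1) := by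
  have h := ((rho_cont δ).tendsto 0).comp (show Tendsto (fun n : ℕ => ((n:ℝ)+1)⁻¹ * r) atTop (𝓝 0) by
    simpa using tend_k.mul_const r)
  rw [rho_zero] at h
  exact h

lemma lim_b1 (δ r : ℝ) : Tendsto (fun n : ℕ => ((n:ℝ)+1) * b1 δ (((n:ℝ)+1)⁻¹ * r)) atTop (𝓝 r) := by
  have h1 : HasDerivAt (fun k => b1 δ (k * r)) r 0 := by
    have := (b1_deriv δ (0*r)).comp 0 ((hasDerivAt_id (0:ℝ)).mul_const r)
    refine this.congr_deriv (by simp [rho_zero])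
  have h2 := (hasDerivAt_iff_tendsto_slope_zero.1 h1).comp (show Tendsto (fun n : ℕ => ((n:ℝ)+1)⁻¹) atTop (𝓝[≠] 0) from
    tendsto_nhdsWithin_iff.2 ⟨tend_k, Eventually.of_forall fun n => by 
      have : (0:ℝ) < ((n:ℝ)+1)⁻¹ := by positivity
      exact this.ne'⟩)
  refine h2.congr fun n => ?_
  simp [b1_zero]

lemma lim_b0 (hδ : 0 < δ) (r : ℝ) : Tendsto (fun n : ℕ => 2 * ((n:ℝ)+1)^2 * b0 δ (((n:ℝ)+1)⁻¹ * r)) atTop (𝓝 (r^2)) := by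
  have h1 : Tendsto (fun n : ℕ => rho δ (((n:ℝ)+1)⁻¹ * r) * r^2) atTop (𝓝 (r^2)) := by
    simpa using (lim_rho δ r).mul_const (r^2)
  refine tendsto_of_tendsto_of_tendsto_of_le_of_le h1 tendsto_const_nhds (fun n => ?_) (fun n => ?_)
  · have h2 := mul_le_mul_of_nonneg_left (b0_lower hδ (((n:ℝ)+1)⁻¹ * r)) (show 0 ≤ 2 * ((n:ℝ)+1)^2 by positivity)
    have e : 2 * ((n:ℝ)+1)^2 * (rho δ (((n:ℝ)+1)⁻¹ * r) * (((n:ℝ)+1)⁻¹ * r)^2/2) = rho δ (((n:ℝ)+1)⁻¹ * r) * r^2 := by field_simp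
    simp only; linarith
  · have h2 := mul_le_mul_of_nonneg_left (b0_upper hδ (((n:ℝ)+1)⁻¹ * r)) (show 0 ≤ 2 * ((n:ℝ)+1)^2 by positivity)
    have e : 2 * ((n:ℝ)+1)^2 * ((((n:ℝ)+1)⁻¹ * r)^2/2) = r^2 := by field_simp
    simp only; linarith

end NL

namespace NL
open Set Topology

variable {q μ δ c : ℝ} {u ut ux uxx f : ℝ → ℝ → ℝ}

lemma E1 (H : Sys q μ δ c u ut ux uxx f) {K : ℝ → ℝ} (hK : Ker K) {Λ : ℝ} (hΛ : 0 ≤ Λ)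
    (hf : ∀ r > 0, ∀ x, f r x = Λ * ((∫ y, K (x - y) * u r y) - u r x))
    {L M : ℝ} {S S1 S2 : ℝ → ℝ} (hS : SF δ L M S S1 S2) (hz : S1 0 = 0) (S0 : ∀ r, 0 ≤ S r)
    (S1m : Monotone S1) (S20 : ∀ r, 0 ≤ S2 r) {s t : ℝ} (hs : 0 < s) (hst : s < t) :
    (∫⁻ x, ENNReal.ofReal (S (u t x))) +
      (∫⁻ r in Ioc s t, ∫⁻ z : ℝ × ℝ, ENNReal.ofReal (Λ/2 * (K (z.1 - z.2) * ((S1 (u r z.1) - S1 (u r z.2)) * (u r z.1 - u r z.2))))) +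
      (∫⁻ r in Ioc s t, ∫⁻ x, ENNReal.ofReal (μ * (S2 (u r x) * (ux r x)^2))) = ∫⁻ x, ENNReal.ofReal (S (u s x)) := by
  obtain ⟨iA, iB, E⟩ := F2 H hS hz hs hst
  have hμ := H.hμ
  have ht := hs.trans hst
  have mS1 := hS.toC2.c1.measurable
  have iS : ∀ r > 0, Integrable (fun x => S (u r x)) := by
    intro r hr
    have cu := (H.dx r hr).c0; have cS := hS.toC2.c0
    exact ((H.iu r hr).abs.const_mul L).mono' (Continuous.aestronglyMeasurable (by fun_prop)) (Eventually.of_forall fun x => hS.b0 _)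
  set P : ℝ → ℝ × ℝ → ℝ := fun r z => Λ/2 * (K (z.1 - z.2) * ((S1 (u r z.1) - S1 (u r z.2)) * (u r z.1 - u r z.2))) with hP
  have P0 : ∀ r z, 0 ≤ P r z := by
    intro r z
    refine mul_nonneg (by positivity) (mul_nonneg (hK.pos _) ?_)
    rcases le_total (u r z.1) (u r z.2) with h | h
    · exact mul_nonneg_of_nonpos_of_nonpos (sub_nonpos.2 (S1m h)) (sub_nonpos.2 h)
    · exact mul_nonneg (sub_nonneg.2 (S1m h)) (sub_nonneg.2 h)
  have hp : ∀ r > 0, Integrable (P r) ∧ ∫ x, S1 (u r x) * f r x = -∫ z, P r z := by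
    intro r hr
    have cu := (H.dx r hr).c0.measurable
    obtain ⟨h1, h2⟩ := hK.sym (Λ := Λ) (H.iu r hr) cu (mS1.comp cu) (fun x => hS.b1 (u r x))
    refine ⟨h1.const_mul _, ?_⟩
    simp only [hf r hr]
    refine h2.trans ?_
    rw [hP, integral_const_mul, neg_mul]; rfl
  have iA' : Integrable (fun r => -∫ x, S1 (u r x) * f r x) (volume.restrict (Ioc s t)) := iA.integral_prod_left.neg
  have iB' : Integrable (fun r => ∫ x, S2 (u r x) * (ux r x)^2) (volume.restrict (Ioc s t)) := iB.integral_prod_left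
  have Q0 : ∀ r, 0 ≤ ∫ x, S2 (u r x) * (ux r x)^2 := fun r => integral_nonneg fun x => mul_nonneg (S20 _) (sq_nonneg _)
  have t2 : (∫⁻ r in Ioc s t, ∫⁻ z : ℝ × ℝ, ENNReal.ofReal (P r z)) = ENNReal.ofReal (-∫ r in Ioc s t, ∫ x, S1 (u r x) * f r x) := by
    rw [← integral_neg, ofReal_integral_eq_lintegral_ofReal iA']
    · refine setLIntegral_congr_fun measurableSet_Ioc fun r hr => ?_
      have := hp r (hs.trans hr.1)
      rw [this.2, neg_neg, ofReal_integral_eq_lintegral_ofReal this.1 (Eventually.of_forall (P0 r))]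
    · filter_upwards [ae_restrict_mem measurableSet_Ioc] with r hr
      have := hp r (hs.trans hr.1)
      simp only [Pi.zero_apply]
      rw [this.2, neg_neg]; exact integral_nonneg (P0 r)
  have t3 : (∫⁻ r in Ioc s t, ∫⁻ x, ENNReal.ofReal (μ * (S2 (u r x) * (ux r x)^2))) = ENNReal.ofReal (μ * ∫ r in Ioc s t, ∫ x, S2 (u r x) * (ux r x)^2) := by
    rw [← integral_const_mul, ofReal_integral_eq_lintegral_ofReal (iB'.const_mul μ) (Eventually.of_forall fun r => mul_nonneg hμ.le (Q0 r))]
    refine lintegral_congr_ae ?_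
    filter_upwards [iB.prod_right_ae] with r hr
    simp only [Function.uncurry] at hr ⊢
    rw [← integral_const_mul, ofReal_integral_eq_lintegral_ofReal (hr.const_mul μ) (Eventually.of_forall fun x => mul_nonneg hμ.le (mul_nonneg (S20 _) (sq_nonneg _)))]
  have n2 : 0 ≤ -∫ r in Ioc s t, ∫ x, S1 (u r x) * f r x := by
    rw [← integral_neg]
    refine setIntegral_nonneg measurableSet_Ioc fun r hr => ?_
    rw [(hp r (hs.trans hr.1)).2, neg_neg]; exact integral_nonneg (P0 r)
  have n1 : 0 ≤ ∫ x, S (u t x) := integral_nonneg fun x => S0 _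
  have n3 : 0 ≤ μ * ∫ r in Ioc s t, ∫ x, S2 (u r x) * (ux r x)^2 := mul_nonneg hμ.le (integral_nonneg Q0)
  rw [t2, t3, ← ofReal_integral_eq_lintegral_ofReal (iS t ht) (Eventually.of_forall fun x => S0 _),
    ← ofReal_integral_eq_lintegral_ofReal (iS s hs) (Eventually.of_forall fun x => S0 _), ← ENNReal.ofReal_add n1 n2,
    ← ENNReal.ofReal_add (add_nonneg n1 n2) n3]
  congr 1; linarith

set_option maxHeartbeats 400000 in
lemma E2 (H : Sys q μ δ c u ut ux uxx f) {K : ℝ → ℝ} (hK : Ker K) {Λ : ℝ} (hΛ : 0 ≤ Λ)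
    (hf : ∀ r > 0, ∀ x, f r x = Λ * ((∫ y, K (x - y) * u r y) - u r x)) {s t : ℝ} (hs : 0 < s) (hst : s < t) :
    (∫⁻ x, ENNReal.ofReal ((u t x)^2)) +
      (∫⁻ r in Ioc s t, ∫⁻ z : ℝ × ℝ, ENNReal.ofReal (Λ * (K (z.1 - z.2) * (u r z.1 - u r z.2)^2))) +
      (∫⁻ r in Ioc s t, ∫⁻ x, ENNReal.ofReal (2 * μ * (ux r x)^2)) = ∫⁻ x, ENNReal.ofReal ((u s x)^2) := by
  have hδ := H.hδ; have hμ := H.hμ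
  have ht := hs.trans hst
  have mU : Measurable (fun z : ℝ × ℝ => u z.1 z.2) := H.mU
  have mUx : Measurable (fun z : ℝ × ℝ => ux z.1 z.2) := H.mUx
  have mU1 : Measurable (fun z : ℝ × (ℝ × ℝ) => u z.1 z.2.1) := mU.comp (g := fun z : ℝ × ℝ => u z.1 z.2) (f := fun z : ℝ × (ℝ × ℝ) => (z.1, z.2.1)) (by fun_prop)
  have mU2 : Measurable (fun z : ℝ × (ℝ × ℝ) => u z.1 z.2.2) := mU.comp (g := fun z : ℝ × ℝ => u z.1 z.2) (f := fun z : ℝ × (ℝ × ℝ) => (z.1, z.2.2)) (by fun_prop)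
  have mK := hK.m
  have mb0 := (b0_cont δ).measurable; have mb1 := (b1_cont δ).measurable; have mr := (rho_cont δ).measurable
  set S : ℕ → ℝ → ℝ := fun n r => 2 * ((n:ℝ)+1)^2 * b0 δ (((n:ℝ)+1)⁻¹ * r) with hSd
  set S1 : ℕ → ℝ → ℝ := fun n r => 2 * (((n:ℝ)+1) * b1 δ (((n:ℝ)+1)⁻¹ * r)) with hS1d
  set S2 : ℕ → ℝ → ℝ := fun n r => 2 * rho δ (((n:ℝ)+1)⁻¹ * r) with hS2d
  have hSF : ∀ n : ℕ, ∃ M, SF δ (2 * ((n:ℝ)+1) * (1/δ)) M (S n) (S1 n) (S2 n) := by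
    intro n
    obtain ⟨M, hM⟩ := sf_scale hδ (k := ((n:ℝ)+1)⁻¹) (by positivity)
    refine ⟨2 * ((n:ℝ)+1) * M, ?_⟩
    · convert hM.smul (k := 2 * ((n:ℝ)+1)) (by positivity) using 2
      · simp only [hSd]; field_simp
      · simp only [hS1d]; ring
      · simp only [hS2d]; field_simp
  have S0 : ∀ n r, 0 ≤ S n r := fun n r => mul_nonneg (by positivity) (b0_nonneg _ _)
  have S1m : ∀ n, Monotone (S1 n) := fun n a b hab => by
    have := b1_mono δ (mul_le_mul_of_nonneg_left hab (show 0 ≤ ((n:ℝ)+1)⁻¹ by positivity))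
    simp only [hS1d]; gcongr
  have S20 : ∀ n r, 0 ≤ S2 n r := fun n r => mul_nonneg zero_le_two (rho_pos _ _).le
  have key := fun n => E1 H hK hΛ hf (hSF n).choose_spec (by simp [hS1d, b1_zero]) (S0 n) (S1m n) (S20 n) hs hst
  have leS : ∀ n r, S n r ≤ r^2 := by
    intro n r
    have h2 := mul_le_mul_of_nonneg_left (b0_upper hδ (((n:ℝ)+1)⁻¹ * r)) (show 0 ≤ 2 * ((n:ℝ)+1)^2 by positivity)
    have e : 2 * ((n:ℝ)+1)^2 * ((((n:ℝ)+1)⁻¹ * r)^2/2) = r^2 := by field_simp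
    simp only [hSd]; linarith
  have limS : ∀ w : ℝ → ℝ, Measurable w → Tendsto (fun n => ∫⁻ x, ENNReal.ofReal (S n (w x))) atTop (𝓝 (∫⁻ x, ENNReal.ofReal ((w x)^2))) := by
    intro w mw
    refine lint_tendsto (fun n => by fun_prop) (fun n x => ENNReal.ofReal_le_ofReal (leS n _)) fun x => ENNReal.tendsto_ofReal (lim_b0 hδ _)
  have leS1 : ∀ n a b, (S1 n a - S1 n b) * (a - b) ≤ 2 * (a-b)^2 := by
    intro n a b
    have h1 := b1_lip hδ (((n:ℝ)+1)⁻¹ * a) (((n:ℝ)+1)⁻¹ * b)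
    rw [← mul_sub, abs_mul, abs_of_pos (show (0:ℝ) < ((n:ℝ)+1)⁻¹ by positivity)] at h1
    have h2 : |S1 n a - S1 n b| ≤ 2 * |a - b| := by
      have e : S1 n a - S1 n b = (2 * ((n:ℝ)+1)) * (b1 δ (((n:ℝ)+1)⁻¹ * a) - b1 δ (((n:ℝ)+1)⁻¹ * b)) := by simp only [hS1d]; ring
      rw [e, abs_mul, abs_of_pos (show (0:ℝ) < 2 * ((n:ℝ)+1) by positivity)]
      refine (mul_le_mul_of_nonneg_left h1 (by positivity)).trans (le_of_eq ?_)
      field_simp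
    calc _ ≤ |(S1 n a - S1 n b) * (a - b)| := le_abs_self _
      _ = |S1 n a - S1 n b| * |a - b| := abs_mul _ _
      _ ≤ 2 * |a-b| * |a-b| := mul_le_mul_of_nonneg_right h2 (abs_nonneg _)
      _ = _ := by rw [mul_assoc, ← sq, sq_abs]
  have lim2 : Tendsto (fun n => ∫⁻ r in Ioc s t, ∫⁻ z : ℝ × ℝ, ENNReal.ofReal (Λ/2 * (K (z.1 - z.2) * ((S1 n (u r z.1) - S1 n (u r z.2)) * (u r z.1 - u r z.2))))) atTop
      (𝓝 (∫⁻ r in Ioc s t, ∫⁻ z : ℝ × ℝ, ENNReal.ofReal (Λ * (K (z.1 - z.2) * (u r z.1 - u r z.2)^2)))) := by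
    have hle : ∀ n r (z : ℝ × ℝ), ENNReal.ofReal (Λ/2 * (K (z.1 - z.2) * ((S1 n (u r z.1) - S1 n (u r z.2)) * (u r z.1 - u r z.2)))) ≤
        ENNReal.ofReal (Λ * (K (z.1 - z.2) * (u r z.1 - u r z.2)^2)) := by
      intro n r z
      refine ENNReal.ofReal_le_ofReal ?_
      have h1 := mul_le_mul_of_nonneg_left (leS1 n (u r z.1) (u r z.2)) (mul_nonneg (show 0 ≤ Λ/2 by positivity) (hK.pos (z.1 - z.2)))
      calc _ = Λ / 2 * K (z.1 - z.2) * ((S1 n (u r z.1) - S1 n (u r z.2)) * (u r z.1 - u r z.2)) := by ring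
        _ ≤ _ := h1
        _ = _ := by ring
    have mP : ∀ n, Measurable (fun p : ℝ × (ℝ × ℝ) => ENNReal.ofReal (Λ/2 * (K (p.2.1 - p.2.2) * ((S1 n (u p.1 p.2.1) - S1 n (u p.1 p.2.2)) * (u p.1 p.2.1 - u p.1 p.2.2))))) := by
      intro n; fun_prop
    have mR := fun n => (mP n).lintegral_prod_right' (ν := volume)
    refine lint_tendsto mR (fun n r => lintegral_mono (hle n r)) fun r => ?_
    have mQ := fun n => (mP n).comp (measurable_prodMk_left (x := r))
    refine lint_tendsto mQ (fun n z => hle n r z) fun z => ?_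
    refine ENNReal.tendsto_ofReal ?_
    have h1 := (((((lim_b1 δ (u r z.1)).const_mul 2).sub ((lim_b1 δ (u r z.2)).const_mul 2)).mul_const (u r z.1 - u r z.2)).const_mul (K (z.1 - z.2))).const_mul (Λ/2)
    convert h1 using 2
    ring
  have lim3 : Tendsto (fun n => ∫⁻ r in Ioc s t, ∫⁻ x, ENNReal.ofReal (μ * (S2 n (u r x) * (ux r x)^2))) atTop
      (𝓝 (∫⁻ r in Ioc s t, ∫⁻ x, ENNReal.ofReal (2 * μ * (ux r x)^2))) := by
    have hle : ∀ n r (x : ℝ), ENNReal.ofReal (μ * (S2 n (u r x) * (ux r x)^2)) ≤ ENNReal.ofReal (2 * μ * (ux r x)^2) := by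
      intro n r x
      refine ENNReal.ofReal_le_ofReal ?_
      have h1 := mul_le_mul_of_nonneg_right (rho_le_one hδ (((n:ℝ)+1)⁻¹ * u r x)) (show 0 ≤ 2 * μ * (ux r x)^2 by positivity)
      simp only [hS2d]; linarith
    have mP : ∀ n, Measurable (fun p : ℝ × ℝ => ENNReal.ofReal (μ * (S2 n (u p.1 p.2) * (ux p.1 p.2)^2))) := by
      intro n; fun_prop
    have mR := fun n => (mP n).lintegral_prod_right' (ν := volume)
    refine lint_tendsto mR (fun n r => lintegral_mono (hle n r)) fun r => ?_
    have mQ := fun n => (mP n).comp (measurable_prodMk_left (x := r))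
    refine lint_tendsto mQ (fun n z => hle n r z) fun z => ?_
    refine ENNReal.tendsto_ofReal ?_
    have h1 := (((lim_rho δ (u r z)).const_mul 2).mul_const ((ux r z)^2)).const_mul μ
    convert h1 using 2
    ring
  have L1 := (((limS (u t) (H.dx t ht).c0.measurable).add lim2).add lim3)
  exact tendsto_nhds_unique L1 ((limS (u s) (H.dx s hs).c0.measurable).congr fun n => (key n).symm)

lemma toB {α : Type*} [MeasurableSpace α] {m : Measure α} [SFinite m] {s t : ℝ} {g : ℝ → α → ℝ} (mg : Measurable (Function.uncurry g))
    (g0 : ∀ r z, 0 ≤ g r z) (hfin : ∫⁻ r in Ioc s t, ∫⁻ z, ENNReal.ofReal (g r z) ∂m ≠ ⊤) :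
    (∀ᵐ r ∂(volume.restrict (Ioc s t)), Integrable (g r) m) ∧
    ∫ r in Ioc s t, ∫ z, g r z ∂m = (∫⁻ r in Ioc s t, ∫⁻ z, ENNReal.ofReal (g r z) ∂m).toReal := by
  have mg' : Measurable (fun r => ∫⁻ z, ENNReal.ofReal (g r z) ∂m) :=
    (ENNReal.measurable_ofReal.comp mg).lintegral_prod_right'
  have h1 := ae_lt_top mg' hfin
  constructor
  · filter_upwards [h1] with r hr
    refine ⟨(mg.comp measurable_prodMk_left).aestronglyMeasurable, ?_⟩
    have g0' : 0 ≤ᵐ[m] g r := Eventually.of_forall (g0 r)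
    rwa [hasFiniteIntegral_iff_ofReal g0']
  · rw [← integral_toReal mg'.aemeasurable h1]
    refine integral_congr_ae (Eventually.of_forall fun r => ?_)
    exact integral_eq_lintegral_of_nonneg_ae (Eventually.of_forall (g0 r)) (mg.comp measurable_prodMk_left).aestronglyMeasurable

lemma E3 (H : Sys q μ δ c u ut ux uxx f) {K : ℝ → ℝ} (hK : Ker K) {Λ : ℝ} (hΛ : 0 ≤ Λ)
    (hf : ∀ r > 0, ∀ x, f r x = Λ * ((∫ y, K (x - y) * u r y) - u r x)) {s t : ℝ} (hs : 0 < s) (hst : s < t) :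
    (∫ x, (u t x)^2) + Λ * (∫ r in Ioc s t, ∫ x, ∫ y, K (x - y) * (u r x - u r y)^2) +
      2 * μ * (∫ r in Ioc s t, ∫ x, (ux r x)^2) = ∫ x, (u s x)^2 := by
  have hμ := H.hμ
  have ht := hs.trans hst
  have mU : Measurable (fun z : ℝ × ℝ => u z.1 z.2) := H.mU
  have mUx : Measurable (fun z : ℝ × ℝ => ux z.1 z.2) := H.mUx
  have mU1 : Measurable (fun z : ℝ × (ℝ × ℝ) => u z.1 z.2.1) := mU.comp (g := fun z : ℝ × ℝ => u z.1 z.2) (f := fun z : ℝ × (ℝ × ℝ) => (z.1, z.2.1)) (by fun_prop)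
  have mU2 : Measurable (fun z : ℝ × (ℝ × ℝ) => u z.1 z.2.2) := mU.comp (g := fun z : ℝ × ℝ => u z.1 z.2) (f := fun z : ℝ × (ℝ × ℝ) => (z.1, z.2.2)) (by fun_prop)
  have mK := hK.m
  have key := E2 H hK hΛ hf hs hst
  have fin : ∫⁻ x, ENNReal.ofReal ((u s x)^2) ≠ ⊤ := by
    obtain ⟨r, hr, hrs, hi⟩ := L2ae H hs
    have h1 := E2 H hK hΛ hf hr hrs
    have h2 : ∫⁻ x, ENNReal.ofReal ((u r x)^2) ≠ ⊤ := by
      rw [← ofReal_integral_eq_lintegral_ofReal hi (Eventually.of_forall fun x => sq_nonneg _)]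
      exact ENNReal.ofReal_ne_top
    rw [← h1] at h2
    exact (ENNReal.add_ne_top.1 (ENNReal.add_ne_top.1 h2).1).1
  have fin' := fin
  rw [← key] at fin'
  obtain ⟨f12, f3⟩ := ENNReal.add_ne_top.1 fin'
  obtain ⟨f1, f2⟩ := ENNReal.add_ne_top.1 f12
  have m2 : Measurable (Function.uncurry fun (r : ℝ) (z : ℝ × ℝ) => Λ * (K (z.1 - z.2) * (u r z.1 - u r z.2)^2)) := by
    change Measurable (fun p : ℝ × (ℝ × ℝ) => Λ * (K (p.2.1 - p.2.2) * (u p.1 p.2.1 - u p.1 p.2.2)^2))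
    fun_prop
  have m3 : Measurable (Function.uncurry fun (r : ℝ) (x : ℝ) => 2 * μ * (ux r x)^2) := by
    change Measurable (fun p : ℝ × ℝ => 2 * μ * (ux p.1 p.2)^2)
    fun_prop
  obtain ⟨a2, e2⟩ := toB m2 (fun r z => mul_nonneg hΛ (mul_nonneg (hK.pos _) (sq_nonneg _))) f2
  obtain ⟨a3, e3⟩ := toB m3 (fun r z => by positivity) f3
  have sqr : ∀ r > 0, ∫ x, (u r x)^2 = (∫⁻ x, ENNReal.ofReal ((u r x)^2)).toReal := fun r hr => by
    have cu := (H.dx r hr).c0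
    exact integral_eq_lintegral_of_nonneg_ae (Eventually.of_forall fun x => sq_nonneg _) (Continuous.aestronglyMeasurable (by fun_prop))
  have e2' : Λ * (∫ r in Ioc s t, ∫ x, ∫ y, K (x - y) * (u r x - u r y)^2) = ∫ r in Ioc s t, ∫ z : ℝ × ℝ, Λ * (K (z.1 - z.2) * (u r z.1 - u r z.2)^2) := by
    rw [← integral_const_mul]
    refine integral_congr_ae ?_
    filter_upwards [a2] with r hr
    rw [Measure.volume_eq_prod] at hr ⊢
    rw [integral_prod _ hr]
    simp only [integral_const_mul]
  have e3' : 2 * μ * (∫ r in Ioc s t, ∫ x, (ux r x)^2) = ∫ r in Ioc s t, ∫ x, 2 * μ * (ux r x)^2 := by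
    simp only [integral_const_mul]
  rw [e2', e3', e2, e3, sqr t ht, sqr s hs, ← key, ENNReal.toReal_add f12 f3, ENNReal.toReal_add f1 f2]

end NL

namespace NL
open Set Topology

lemma ker_exists {J : ℝ → ℝ} (hJpos : ∀ x, 0 ≤ J x) (hJeven : ∀ x, J (-x) = J x)
    (hJint : Integrable J) (hJmass : ∫ x, J x = 1) {lam : ℝ} (hlam : 0 < lam) :
    ∃ K, Ker K ∧ ∀ x, ∀ᵐ y, K (x - y) = lam * J (lam * (x - y)) := by
  set m := hJint.1.mk J with hm
  have mm : Measurable m := hJint.1.stronglyMeasurable_mk.measurable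
  have em : J =ᵐ[volume] m := hJint.1.ae_eq_mk
  have em' : ∀ᵐ x, J (-x) = m (-x) := (Measure.measurePreserving_neg (volume : Measure ℝ)).quasiMeasurePreserving.ae em
  set J' : ℝ → ℝ := fun x => (|m x| + |m (-x)|)/2 with hJ'
  have mJ' : Measurable J' := by fun_prop
  have e1 : J' =ᵐ[volume] J := by
    filter_upwards [em, em'] with x h1 h2
    simp only [hJ']
    rw [← h1, ← h2, hJeven, abs_of_nonneg (hJpos x)]; ring
  have q1 : Measure.QuasiMeasurePreserving (fun x : ℝ => lam * x) volume volume :=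
    ⟨by fun_prop, by rw [Real.map_volume_mul_left hlam.ne']; exact Measure.smul_absolutelyContinuous⟩
  have e2 : ∀ᵐ x, J' (lam * x) = J (lam * x) := q1.ae e1
  have iJ' : Integrable J' := hJint.congr e1.symm
  refine ⟨fun x => lam * J' (lam * x), ⟨by fun_prop, fun x => ?_, fun x => ?_, ?_, ?_⟩, fun x => ?_⟩
  · simp only [hJ']; positivity
  · simp only [hJ', mul_neg, neg_neg]; ring
  · exact (iJ'.comp_mul_left' hlam.ne').const_mul lam
  · rw [integral_const_mul, Measure.integral_comp_mul_left, integral_congr_ae e1, hJmass, abs_of_pos (inv_pos.2 hlam)]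
    simp [hlam.ne']
  · have := (quasiMeasurePreserving_sub_left (volume : Measure ℝ) x).ae e2
    filter_upwards [this] with y hy
    rw [hy]

lemma Ker.bd {K w : ℝ → ℝ} (hK : Ker K) (iw : Integrable w) {Λ : ℝ} (hΛ : 0 ≤ Λ) :
    Integrable (fun x => Λ * ((∫ y, K (x - y) * w y) - w x)) ∧
    ∫ x, |Λ * ((∫ y, K (x - y) * w y) - w x)| ≤ 2 * Λ * ∫ x, |w x| := by
  have i1 := hK.pint iw
  have i2 := hK.pint iw.abs
  have h1 : Integrable (fun x => ∫ y, K (x - y) * w y) := i1.integral_prod_left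
  have h2 : Integrable (fun x => ∫ y, K (x - y) * |w y|) := i2.integral_prod_left
  have hi : Integrable (fun x => Λ * ((∫ y, K (x - y) * w y) - w x)) := (h1.sub iw).const_mul Λ
  refine ⟨hi, ?_⟩
  have e : ∫ x, ∫ y, K (x - y) * |w y| = ∫ y, |w y| := by
    rw [← integral_prod _ i2, integral_prod_symm _ i2]
    refine integral_congr_ae (Eventually.of_forall fun y => ?_)
    simp only
    rw [integral_mul_const, integral_sub_right_eq_self K y, hK.mass, one_mul]
  have h3 := integral_mono hi.abs ((h2.add iw.abs).const_mul Λ) (fun x => by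
    simp only [Pi.add_apply]
    rw [abs_mul, abs_of_nonneg hΛ]
    refine mul_le_mul_of_nonneg_left ((abs_sub _ _).trans (add_le_add ?_ le_rfl)) hΛ
    refine (abs_integral_le_integral_abs).trans (le_of_eq ?_)
    simp only [abs_mul, abs_of_nonneg (hK.pos _)])
  refine h3.trans (le_of_eq ?_)
  rw [integral_const_mul]
  simp only [Pi.add_apply]
  rw [integral_add h2 iw.abs, e]; ring

lemma tend_slope {g : ℝ → ℝ} {g' x : ℝ} (h : HasDerivAt g g' x) :
    Tendsto (fun n : ℕ => ((n:ℝ)+1) * (g (x + ((n:ℝ)+1)⁻¹) - g x)) atTop (𝓝 g') := by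
  have h2 := (hasDerivAt_iff_tendsto_slope_zero.1 h).comp (show Tendsto (fun n : ℕ => ((n:ℝ)+1)⁻¹) atTop (𝓝[≠] 0) from
    tendsto_nhdsWithin_iff.2 ⟨tend_k, Eventually.of_forall fun n => by 
      have : (0:ℝ) < ((n:ℝ)+1)⁻¹ := by positivity
      exact this.ne'⟩)
  refine h2.congr fun n => ?_
  simp

lemma meas_dx {V W : ℝ → ℝ → ℝ} (mV : Measurable (Function.uncurry V)) (h : ∀ t > 0, ∀ x, HasDerivAt (V t) (W t x) x)
    (h0 : ∀ t ≤ 0, ∀ x, W t x = 0) : Measurable (Function.uncurry W) := by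
  have mV' : Measurable (fun z : ℝ × ℝ => V z.1 z.2) := mV
  refine measurable_of_tendsto_metrizable (f := fun (n : ℕ) (z : ℝ × ℝ) => if 0 < z.1 then ((n:ℝ)+1) * (V z.1 (z.2 + ((n:ℝ)+1)⁻¹) - V z.1 z.2) else 0) (fun n => ?_) ?_
  · have m1 : Measurable (fun z : ℝ × ℝ => V z.1 (z.2 + ((n:ℝ)+1)⁻¹)) :=
      mV'.comp (g := fun z : ℝ × ℝ => V z.1 z.2) (f := fun z : ℝ × ℝ => (z.1, z.2 + ((n:ℝ)+1)⁻¹)) (by fun_prop)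
    exact Measurable.ite (measurableSet_lt measurable_const measurable_fst) (by fun_prop) measurable_const
  · rw [tendsto_pi_nhds]
    intro z
    by_cases hz : 0 < z.1
    · simp only [hz, if_true]; exact tend_slope (h z.1 hz z.2)
    · simp only [hz, if_false]
      rw [Function.uncurry, h0 _ (not_lt.1 hz)]; exact tendsto_const_nhds

lemma meas_dt {V W : ℝ → ℝ → ℝ} (mV : Measurable (Function.uncurry V)) (h : ∀ t > 0, ∀ x, HasDerivAt (fun s => V s x) (W t x) t)
    (h0 : ∀ t ≤ 0, ∀ x, W t x = 0) : Measurable (Function.uncurry W) := by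
  have mV' : Measurable (fun z : ℝ × ℝ => V z.1 z.2) := mV
  refine measurable_of_tendsto_metrizable (f := fun (n : ℕ) (z : ℝ × ℝ) => if 0 < z.1 then ((n:ℝ)+1) * (V (z.1 + ((n:ℝ)+1)⁻¹) z.2 - V z.1 z.2) else 0) (fun n => ?_) ?_
  · have m1 : Measurable (fun z : ℝ × ℝ => V (z.1 + ((n:ℝ)+1)⁻¹) z.2) :=
      mV'.comp (g := fun z : ℝ × ℝ => V z.1 z.2) (f := fun z : ℝ × ℝ => (z.1 + ((n:ℝ)+1)⁻¹, z.2)) (by fun_prop)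
    exact Measurable.ite (measurableSet_lt measurable_const measurable_fst) (by fun_prop) measurable_const
  · rw [tendsto_pi_nhds]
    intro z
    by_cases hz : 0 < z.1
    · simp only [hz, if_true]; exact tend_slope (h z.1 hz z.2)
    · simp only [hz, if_false]
      rw [Function.uncurry, h0 _ (not_lt.1 hz)]; exact tendsto_const_nhds

lemma sys_of_sol {J : ℝ → ℝ} {q lam μ : ℝ} (hq1 : 1 < q) (hq2 : q < 2) (hlam : 0 < lam) (hμ : 0 < μ) {φ : ℝ → ℝ} {u : ℝ → ℝ → ℝ}
    (hu : IsRescaledSol J q lam μ φ u) {K : ℝ → ℝ} (hK : Ker K) (hKJ : ∀ x, ∀ᵐ y, K (x - y) = lam * J (lam * (x - y))) :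
    ∃ U Ut Ux Uxx F : ℝ → ℝ → ℝ, Sys q μ ((2-q)/2) (2*lam^q) U Ut Ux Uxx F ∧ (∀ t > 0, U t = u t ∧ Ux t = deriv (u t)) ∧
      (∀ r > 0, ∀ x, F r x = lam^q * ((∫ y, K (x - y) * U r y) - U r x)) := by
  obtain ⟨h1, h2, h3, h4, h5, -⟩ := hu
  have hΛ : 0 ≤ lam^q := by positivity
  set U : ℝ → ℝ → ℝ := fun t x => if 0 < t then u t x else 0 with hU
  set Ut : ℝ → ℝ → ℝ := fun t x => if 0 < t then deriv (fun s => u s x) t else 0 with hUt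
  set Ux : ℝ → ℝ → ℝ := fun t x => if 0 < t then deriv (u t) x else 0 with hUx
  set Uxx : ℝ → ℝ → ℝ := fun t x => if 0 < t then deriv (deriv (u t)) x else 0 with hUxx
  set F : ℝ → ℝ → ℝ := fun t x => if 0 < t then lam^q * ((∫ y, K (x - y) * u t y) - u t x) else 0 with hF
  have eU : ∀ t > 0, U t = u t := fun t ht => by simp [hU, ht.lt]
  have eUx : ∀ t > 0, Ux t = deriv (u t) := fun t ht => by simp [hUx, ht.lt]
  have eUxx : ∀ t > 0, Uxx t = deriv (deriv (u t)) := fun t ht => by simp [hUxx, ht.lt]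
  have eF : ∀ t > 0, F t = fun x => lam^q * ((∫ y, K (x - y) * u t y) - u t x) := fun t ht => by simp [hF, ht.lt]
  have dx : ∀ t > 0, C2 (U t) (Ux t) (Uxx t) := fun t ht => by
    rw [eU t ht, eUx t ht, eUxx t ht]; exact C2.of_contDiff (h3 t ht)
  have dt' : ∀ t > 0, ∀ x, HasDerivAt (fun s => u s x) (Ut t x) t := fun t ht x => by
    simp only [hUt, ht.lt, if_true]
    exact (((h4 x).differentiableOn one_ne_zero).differentiableAt (Ioi_mem_nhds ht)).hasDerivAt
  have dt : ∀ t > 0, ∀ x, HasDerivAt (fun s => U s x) (Ut t x) t := fun t ht x => by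
    refine (dt' t ht x).congr_of_eventuallyEq ?_
    filter_upwards [Ioi_mem_nhds ht] with s hs
    rw [eU s hs]
  have mU : Measurable (Function.uncurry U) := by
    have hv : Measurable (Function.uncurry fun τ x => u (Real.exp τ) x) := by
      refine measurable_uncurry_of_continuous_of_measurable (u := fun τ x => u (Real.exp τ) x) (fun x => ?_) (fun τ => ?_)
      · exact (h4 x).continuousOn.comp_continuous Real.continuous_exp (fun τ => Real.exp_pos τ)
      · exact (h3 _ (Real.exp_pos τ)).continuous.measurable
    have hv' : Measurable (fun z : ℝ × ℝ => if 0 < z.1 then u (Real.exp (Real.log z.1)) z.2 else 0) := by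
      refine Measurable.ite (measurableSet_lt measurable_const measurable_fst) ?_ measurable_const
      exact hv.comp (f := fun z : ℝ × ℝ => (Real.log z.1, z.2)) ((Real.measurable_log.comp measurable_fst).prodMk measurable_snd)
    convert hv' using 1
    ext z
    simp only [Function.uncurry, hU]
    split_ifs with h
    · rw [Real.exp_log h]
    · rfl
  have mUt : Measurable (Function.uncurry Ut) := meas_dt mU dt (fun t ht x => by simp [hUt, ht])
  have mUx : Measurable (Function.uncurry Ux) := meas_dx mU (fun t ht => (dx t ht).h1) (fun t ht x => by simp [hUx, ht])
  have mUxx : Measurable (Function.uncurry Uxx) := meas_dx mUx (fun t ht => (dx t ht).h2) (fun t ht x => by simp [hUxx, ht])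
  have eq : ∀ t > 0, ∀ x, Ut t x = -(|U t x|^(q-1) * Ux t x) + μ * Uxx t x + F t x := by
    intro t ht x
    have h6 := h5 t ht x
    have e : ∫ y, lam * J (lam * (x - y)) * u t y = ∫ y, K (x - y) * u t y := by
      refine integral_congr_ae ?_
      filter_upwards [hKJ x] with y hy
      rw [hy]
    rw [e] at h6
    rw [eU t ht, eUx t ht, eUxx t ht, eF t ht]
    simp only [hUt, ht.lt, if_true]
    linarith
  have mF : Measurable (Function.uncurry F) := by
    have mU' : Measurable (fun z : ℝ × ℝ => U z.1 z.2) := mU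
    have mUt' : Measurable (fun z : ℝ × ℝ => Ut z.1 z.2) := mUt
    have mUx' : Measurable (fun z : ℝ × ℝ => Ux z.1 z.2) := mUx
    have mUxx' : Measurable (fun z : ℝ × ℝ => Uxx z.1 z.2) := mUxx
    have : Measurable (fun z : ℝ × ℝ => if 0 < z.1 then Ut z.1 z.2 + |U z.1 z.2|^(q-1) * Ux z.1 z.2 - μ * Uxx z.1 z.2 else 0) :=
      Measurable.ite (measurableSet_lt measurable_const measurable_fst) (by fun_prop) measurable_const
    convert this using 1
    ext z
    split_ifs with h
    · rw [eq z.1 h z.2]; simp only [Function.uncurry]; ring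
    · simp [Function.uncurry, hF, h]
  refine ⟨U, Ut, Ux, Uxx, F, ⟨hq1, by linarith, by linarith, by linarith, hμ, by positivity, mU, mUt, mUx, mUxx, mF, dt, ?_, dx, eq, ?_, ?_, ?_, ?_⟩,
    fun t ht => ⟨eU t ht, eUx t ht⟩, fun t ht x => by rw [eF t ht, eU t ht]⟩
  · intro x
    refine ((h4 x).continuousOn_deriv_of_isOpen isOpen_Ioi le_rfl).congr fun t ht => ?_
    have ht' : 0 < t := ht
    simp only [hUt, ht', if_true]
  · intro t ht; rw [eU t ht]; exact h1 t ht.le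
  · intro t ht; rw [eF t ht]; exact (hK.bd (h1 t ht.le) hΛ).1
  · intro t ht; rw [eF t ht, eU t ht]; exact (hK.bd (h1 t ht.le) hΛ).2
  · intro t₀ ht
    have h6 := h2 t₀ ht.le
    rw [nhdsWithin_eq_nhds.2 (Ici_mem_nhds ht)] at h6
    refine h6.congr' ?_
    filter_upwards [Ioi_mem_nhds ht] with t ht'
    rw [eU t ht', eU t₀ ht]

end NL

theorem stmt14
    (J : ℝ → ℝ) (hJpos : ∀ x, 0 ≤ J x) (hJeven : ∀ x, J (-x) = J x)
    (hJint : Integrable J) (hJmass : ∫ x, J x = 1)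
    (q : ℝ) (hq1 : 1 < q) (hq2 : q < 2)
    (lam μ : ℝ) (hlam : 0 < lam) (hμ : 0 < μ)
    (φ : ℝ → ℝ) (hφ : Integrable φ)
    (u : ℝ → ℝ → ℝ) (hu : IsRescaledSol J q lam μ φ u) :
    ∀ t₁ t₂ : ℝ, 0 < t₁ → t₁ < t₂ →
      (∫ x, (u t₂ x) ^ 2)
        + lam ^ q * (∫ t in Set.Ioc t₁ t₂, ∫ x, ∫ y,
            lam * J (lam * (x - y)) * (u t x - u t y) ^ 2)
        + 2 * μ * (∫ t in Set.Ioc t₁ t₂, ∫ x, (deriv (u t) x) ^ 2)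
      = ∫ x, (u t₁ x) ^ 2 := by
  intro t₁ t₂ ht₁ h12
  obtain ⟨K, hK, hKJ⟩ := NL.ker_exists hJpos hJeven hJint hJmass hlam
  obtain ⟨U, Ut, Ux, Uxx, F, H, hU, hF⟩ := NL.sys_of_sol hq1 hq2 hlam hμ hu hK hKJ
  have key := NL.E3 H hK (by positivity : 0 ≤ lam^q) hF ht₁ h12
  rw [(hU t₂ (ht₁.trans h12)).1, (hU t₁ ht₁).1] at key
  have e1 : (∫ t in Set.Ioc t₁ t₂, ∫ x, ∫ y, lam * J (lam * (x - y)) * (u t x - u t y) ^ 2)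
      = ∫ r in Set.Ioc t₁ t₂, ∫ x, ∫ y, K (x - y) * (U r x - U r y) ^ 2 := by
    refine setIntegral_congr_fun measurableSet_Ioc fun r hr => ?_
    have hr0 : 0 < r := ht₁.trans hr.1
    simp only [(hU r hr0).1]
    refine integral_congr_ae (Eventually.of_forall fun x => ?_)
    refine integral_congr_ae ?_
    filter_upwards [hKJ x] with y hy
    rw [hy]
  have e2 : (∫ t in Set.Ioc t₁ t₂, ∫ x, (deriv (u t) x) ^ 2)
      = ∫ r in Set.Ioc t₁ t₂, ∫ x, (Ux r x) ^ 2 := by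
    refine setIntegral_congr_fun measurableSet_Ioc fun r hr => ?_
    have hr0 : 0 < r := ht₁.trans hr.1
    simp only [(hU r hr0).2]
  rw [e1, e2]
  exact key
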